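/- (Theorem 2.2) Let m > 2 be an integer and ν, η, ε > 0. Let (u, b, π) be a smooth solution of the 2½-dimensional Hall-MHD system on [0,T) × ℝ², Schwartz-class in the space variable for each t, with sup_{0≤t≤T'} (‖u(t)‖_{Hᵐ} + ‖b(t)‖_{Hᵐ}) < ∞ for every T' < T. Suppose there exist p ∈ (2,∞] and r ∈ [2,∞) with 2/p + 2/r ≤ 1 such that ∫₀ᵀ ‖j₃(t,·)‖_{Lᵖ(ℝ²)}^{r} dt < ∞, where j₃ = ∂₁b₂ − ∂₂b₁ is the third component of the current density. Then sup_{0≤t<T} (‖u(t)‖_{Hᵐ} + ‖b(t)‖_{Hᵐ}) < ∞. -/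

import Mathlib

open MeasureTheory
open scoped ENNReal

noncomputable section

/-- Partial derivative in the `i`-th coordinate direction of `ℝ²`. -/
def pd (i : Fin 2) (f : (Fin 2 → ℝ) → ℝ) (x : Fin 2 → ℝ) : ℝ :=
  fderiv ℝ f x (Pi.single i 1)

/-- The Laplacian `Δ = ∂₁² + ∂₂²` of a scalar function on `ℝ²`. -/
def lap (f : (Fin 2 → ℝ) → ℝ) (x : Fin 2 → ℝ) : ℝ :=
  pd 0 (pd 0 f) x + pd 1 (pd 1 f) x

/-- The 2½-dimensional curl `∇×F = (∂₂F₃, −∂₁F₃, ∂₁F₂ − ∂₂F₁)` of `F : ℝ² → ℝ³`. -/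
def curl (F : (Fin 2 → ℝ) → (Fin 3 → ℝ)) (x : Fin 2 → ℝ) : Fin 3 → ℝ :=
  ![pd 1 (fun y => F y 2) x, -(pd 0 (fun y => F y 2) x),
    pd 0 (fun y => F y 1) x - pd 1 (fun y => F y 0) x]

/-- The advection term `(f·∇)g = f₁∂₁g + f₂∂₂g` for `f, g : ℝ² → ℝ³`. -/
def advect (f g : (Fin 2 → ℝ) → (Fin 3 → ℝ)) (x : Fin 2 → ℝ) (i : Fin 3) : ℝ :=
  f x 0 * pd 0 (fun y => g y i) x + f x 1 * pd 1 (fun y => g y i) x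

/-- A function is Schwartz-class: it is smooth and all its iterated derivatives decay
faster than any polynomial. -/
def IsSchwartz {F : Type*} [NormedAddCommGroup F] [NormedSpace ℝ F]
    (f : (Fin 2 → ℝ) → F) : Prop :=
  ContDiff ℝ (⊤ : ℕ∞) f ∧
    ∀ k n : ℕ, ∃ C : ℝ, ∀ x, ‖x‖ ^ k * ‖iteratedFDeriv ℝ n f x‖ ≤ C

/-- A smooth solution of the 2½-dimensional Hall-MHD system on `S × ℝ²`, Schwartz-class in
the space variable for each time `t ∈ S`:
`∂ₜu + (u·∇)u + ∇π = νΔu + (b·∇)b`, `∂ₜb + (u·∇)b = ηΔb + (b·∇)u − ε∇×(j×b)`,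
`∂₁u₁ + ∂₂u₂ = 0`, `∂₁b₁ + ∂₂b₂ = 0`, where `j = ∇×b`. -/
structure IsHallMHDSolution (ν η ε : ℝ) (S : Set ℝ)
    (u b : ℝ → (Fin 2 → ℝ) → (Fin 3 → ℝ)) (π : ℝ → (Fin 2 → ℝ) → ℝ) : Prop where
  smooth_u : ContDiffOn ℝ (⊤ : ℕ∞) (fun p : ℝ × (Fin 2 → ℝ) => u p.1 p.2) (S ×ˢ Set.univ)
  smooth_b : ContDiffOn ℝ (⊤ : ℕ∞) (fun p : ℝ × (Fin 2 → ℝ) => b p.1 p.2) (S ×ˢ Set.univ)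
  smooth_pi : ContDiffOn ℝ (⊤ : ℕ∞) (fun p : ℝ × (Fin 2 → ℝ) => π p.1 p.2) (S ×ˢ Set.univ)
  schwartz_u : ∀ t ∈ S, IsSchwartz (u t)
  schwartz_b : ∀ t ∈ S, IsSchwartz (b t)
  schwartz_pi : ∀ t ∈ S, IsSchwartz (π t)
  div_u : ∀ t ∈ S, ∀ x, pd 0 (fun y => u t y 0) x + pd 1 (fun y => u t y 1) x = 0
  div_b : ∀ t ∈ S, ∀ x, pd 0 (fun y => b t y 0) x + pd 1 (fun y => b t y 1) x = 0
  momentum : ∀ t ∈ S, ∀ x, ∀ i : Fin 3,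
    deriv (fun s => u s x i) t + advect (u t) (u t) x i
        + ![pd 0 (π t) x, pd 1 (π t) x, 0] i
      = ν * lap (fun y => u t y i) x + advect (b t) (b t) x i
  induction : ∀ t ∈ S, ∀ x, ∀ i : Fin 3,
    deriv (fun s => b s x i) t + advect (u t) (b t) x i
      = η * lap (fun y => b t y i) x + advect (b t) (u t) x i
        - ε * curl (fun y => crossProduct (curl (b t) y) (b t y)) x i

/-- The `Hᵐ(ℝ²)` norm: `‖f‖_{Hᵐ} = (∑_{k=0}^{m} ∫ ‖Dᵏf(x)‖² dx)^{1/2}`. -/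
def hSobNorm (m : ℕ) (f : (Fin 2 → ℝ) → (Fin 3 → ℝ)) : ℝ :=
  Real.sqrt (∑ k ∈ Finset.range (m + 1), ∫ x, ‖iteratedFDeriv ℝ k f x‖ ^ 2)

end

open MeasureTheory
open scoped ENNReal

noncomputable section
namespace HMHD

open scoped SchwartzMap

/-- the plane -/
abbrev E2 := Fin 2 → ℝ

lemma isSchwartz_iff {f : E2 → ℝ} : IsSchwartz f ↔ ∃ g : 𝓢(E2, ℝ), (g : E2 → ℝ) = f := by
  constructor
  · rintro ⟨h1, h2⟩
    exact ⟨⟨f, h1, h2⟩, rfl⟩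
  · rintro ⟨g, rfl⟩
    exact ⟨g.smooth _, g.decay'⟩

/-- The algebra of Schwartz functions on the plane. -/
def SchA : NonUnitalSubalgebra ℝ (E2 → ℝ) where
  carrier := {f | IsSchwartz f}
  add_mem' := by
    intro a b ha hb
    obtain ⟨f, rfl⟩ := isSchwartz_iff.1 ha
    obtain ⟨g, rfl⟩ := isSchwartz_iff.1 hb
    exact isSchwartz_iff.2 ⟨f + g, by ext x; simp⟩
  zero_mem' := isSchwartz_iff.2 ⟨0, by ext x; simp⟩
  mul_mem' := by
    intro a b ha hb
    obtain ⟨f, rfl⟩ := isSchwartz_iff.1 ha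
    obtain ⟨g, rfl⟩ := isSchwartz_iff.1 hb
    exact isSchwartz_iff.2 ⟨SchwartzMap.pairing (ContinuousLinearMap.mul ℝ ℝ) f g, by ext x; simp⟩
  smul_mem' := by
    intro c a ha
    obtain ⟨f, rfl⟩ := isSchwartz_iff.1 ha
    exact isSchwartz_iff.2 ⟨c • f, by ext x; simp⟩

/-- Schwartz functions on the plane, as a type. -/
def Sch : Type := ↥SchA

instance : NonUnitalCommRing Sch := inferInstanceAs (NonUnitalCommRing ↥SchA)
instance : Module ℝ Sch := inferInstanceAs (Module ℝ ↥SchA)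
instance : IsScalarTower ℝ Sch Sch := inferInstanceAs (IsScalarTower ℝ ↥SchA ↥SchA)
instance : SMulCommClass ℝ Sch Sch := inferInstanceAs (SMulCommClass ℝ ↥SchA ↥SchA)

/-- the underlying function -/
def Sch.fn (f : Sch) : E2 → ℝ := f.1

instance : CoeFun Sch (fun _ => E2 → ℝ) := ⟨Sch.fn⟩
instance : CoeOut Sch (E2 → ℝ) := ⟨Sch.fn⟩

@[simp] lemma add_app (f g : Sch) (x : E2) : (f + g) x = f x + g x := rfl
@[simp] lemma sub_app (f g : Sch) (x : E2) : (f - g) x = f x - g x := rfl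
@[simp] lemma neg_app (f : Sch) (x : E2) : (-f) x = -f x := rfl
@[simp] lemma mul_app (f g : Sch) (x : E2) : (f * g) x = f x * g x := rfl
@[simp] lemma smul_app (c : ℝ) (f : Sch) (x : E2) : (c • f) x = c * f x := rfl
@[simp] lemma zero_app (x : E2) : (0 : Sch) x = 0 := rfl

lemma Sch.ext' {f g : Sch} (h : ∀ x, f x = g x) : f = g := Subtype.ext (funext h)

lemma Sch.isS (f : Sch) : IsSchwartz (f : E2 → ℝ) := f.2

lemma Sch.contDiff (f : Sch) : ContDiff ℝ (⊤ : ℕ∞) (f : E2 → ℝ) := f.2.1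

lemma Sch.diff (f : Sch) : Differentiable ℝ (f : E2 → ℝ) :=
  f.contDiff.differentiable (by simp)

lemma Sch.cont (f : Sch) : Continuous (f : E2 → ℝ) := f.contDiff.continuous

lemma Sch.integrable (f : Sch) : Integrable (f : E2 → ℝ) := by
  obtain ⟨g, hg⟩ := isSchwartz_iff.1 f.isS
  rw [← hg]; exact g.integrable

lemma Sch.memLp (f : Sch) (p : ℝ≥0∞) : MemLp (f : E2 → ℝ) p := by
  obtain ⟨g, hg⟩ := isSchwartz_iff.1 f.isS
  rw [← hg]; exact g.memLp p

lemma pd_isSchwartz (i : Fin 2) (f : E2 → ℝ) (hf : IsSchwartz f) : IsSchwartz (pd i f) := by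
  obtain ⟨g, rfl⟩ := isSchwartz_iff.1 hf
  refine isSchwartz_iff.2 ⟨SchwartzMap.evalCLM ℝ E2 ℝ (Pi.single i 1) (SchwartzMap.fderivCLM ℝ E2 ℝ g), ?_⟩
  ext x; simp [pd]

/-- partial derivative on Schwartz functions -/
def D (i : Fin 2) : Sch →ₗ[ℝ] Sch where
  toFun f := ⟨pd i f, pd_isSchwartz i f f.2⟩
  map_add' f g := by
    apply Sch.ext'; intro x
    change fderiv ℝ ((f : E2 → ℝ) + (g : E2 → ℝ)) x _ = _
    rw [fderiv_add (f.diff x) (g.diff x)]; rfl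
  map_smul' c f := by
    apply Sch.ext'; intro x
    change fderiv ℝ (c • (f : E2 → ℝ)) x _ = _
    rw [fderiv_const_smul (f.diff x)]; rfl

lemma D_coe (i : Fin 2) (f : Sch) : ((D i f : Sch) : E2 → ℝ) = pd i f := rfl

lemma D_app (i : Fin 2) (f : Sch) (x : E2) : (D i f) x = fderiv ℝ (f : E2 → ℝ) x (Pi.single i 1) := rfl

lemma D_mul (i : Fin 2) (f g : Sch) : D i (f * g) = D i f * g + f * D i g := by
  apply Sch.ext'; intro x
  change fderiv ℝ ((f : E2 → ℝ) * (g : E2 → ℝ)) x _ = _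
  rw [fderiv_mul (f.diff x) (g.diff x)]
  simp [D_app]; ring

lemma D_comm (i j : Fin 2) (f : Sch) : D i (D j f) = D j (D i f) := by
  apply Sch.ext'; intro x
  have key : ∀ i j : Fin 2, (D i (D j f)) x =
      fderiv ℝ (fderiv ℝ (f : E2 → ℝ)) x (Pi.single i 1) (Pi.single j 1) := by
    intro i j
    change fderiv ℝ (fun y => fderiv ℝ (f : E2 → ℝ) y (Pi.single j 1)) x _ = _
    have hd : DifferentiableAt ℝ (fderiv ℝ (f : E2 → ℝ)) x :=
      ((f.contDiff.fderiv_right (m := 1) (by norm_cast)).differentiable (by simp)) x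
    rw [fderiv_clm_apply hd (differentiableAt_const _)]
    simp
  rw [key, key]
  have := (f.contDiff.contDiffAt (x := x)).isSymmSndFDerivAt (by simp; exact WithTop.coe_le_coe.2 (le_top (a := (2 : ℕ∞))))
  exact this _ _

/-- the integral on Schwartz functions -/
def I : Sch →ₗ[ℝ] ℝ where
  toFun f := ∫ x, f x
  map_add' f g := by
    change ∫ x, (f x + g x) = _
    rw [integral_add f.integrable g.integrable]
  map_smul' c f := by
    change ∫ x, c * f x = _
    rw [integral_const_mul]; rfl

lemma I_def (f : Sch) : I f = ∫ x, f x := rfl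

lemma I_mono {f g : Sch} (h : ∀ x, f x ≤ g x) : I f ≤ I g :=
  integral_mono f.integrable g.integrable h

lemma I_nonneg {f : Sch} (h : ∀ x, 0 ≤ f x) : 0 ≤ I f := integral_nonneg h

lemma I_sq_nonneg (f : Sch) : 0 ≤ I (f * f) := I_nonneg fun _ => mul_self_nonneg _

lemma I_ibp (i : Fin 2) (f g : Sch) : I (D i f * g) = - I (f * D i g) := by
  have := integral_mul_fderiv_eq_neg_fderiv_mul_of_integrable (μ := volume) (𝕜 := ℝ)
    (f := (f : E2 → ℝ)) (g := (g : E2 → ℝ)) (v := Pi.single i 1) (D i f * g).integrable (f * D i g).integrable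
    (f * g).integrable (fun x _ => f.diff x) (fun x _ => g.diff x)
  simp only [I_def]
  have h2 : ∫ x, (f * D i g) x = ∫ x, f x * (fderiv ℝ (g : E2 → ℝ) x) (Pi.single i 1) := rfl
  have h3 : ∫ x, (D i f * g) x = ∫ x, (fderiv ℝ (f : E2 → ℝ) x) (Pi.single i 1) * g x := rfl
  rw [h2, h3, this]; simp

lemma I_abs_le {f g : Sch} (h : ∀ x, |f x| ≤ g x) : |I f| ≤ I g := by
  rw [abs_le]
  refine ⟨?_, I_mono fun x => (abs_le.1 (h x)).2⟩
  rw [neg_le, ← map_neg]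
  exact I_mono fun x => by simp; linarith [(abs_le.1 (h x)).1]

/-- Cauchy-Schwarz -/
lemma I_cs (f g : Sch) : I (f * g) ^ 2 ≤ I (f * f) * I (g * g) := by
  have key : ∀ t : ℝ, 0 ≤ I (g * g) * (t * t) + (2 * I (f * g)) * t + I (f * f) := by
    intro t
    have h := I_sq_nonneg (f + t • g)
    have e : (f + t • g) * (f + t • g) = (t * t) • (g * g) + (2 * t) • (f * g) + f * f := by
      apply Sch.ext'; intro x; simp; ring
    rw [e] at h
    simp only [map_add, map_smul, smul_eq_mul] at h
    linarith
  have := discrim_le_zero key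
  unfold discrim at this
  nlinarith

lemma I_young (f g : Sch) {δ : ℝ} (hδ : 0 < δ) :
    |I (f * g)| ≤ δ * I (f * f) + (4 * δ)⁻¹ * I (g * g) := by
  have e : δ * I (f * f) + (4 * δ)⁻¹ * I (g * g) = I (δ • (f * f) + (4 * δ)⁻¹ • (g * g)) := by simp
  rw [e]
  apply I_abs_le
  intro x
  simp only [mul_app, add_app, smul_app]
  have h1 : δ * (f x * f x) + (4 * δ)⁻¹ * (g x * g x) - |f x * g x|
      = δ⁻¹ * (δ * |f x| - |g x| / 2) ^ 2 := by
    rw [abs_mul]; field_simp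
    rw [← sq_abs (f x), ← sq_abs (g x)]; ring
  have : 0 ≤ δ⁻¹ * (δ * |f x| - |g x| / 2) ^ 2 := by positivity
  linarith

lemma I_bdd (g f : Sch) {K : ℝ} (h : ∀ x, |g x| ≤ K) :
    I ((g * f) * (g * f)) ≤ K ^ 2 * I (f * f) := by
  have e : K ^ 2 * I (f * f) = I ((K ^ 2) • (f * f)) := by simp
  rw [e]
  apply I_mono
  intro x
  simp only [mul_app, smul_app]
  have : g x ^ 2 ≤ K ^ 2 := sq_le_sq' (by linarith [(abs_le.1 (h x)).1]) (abs_le.1 (h x)).2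
  nlinarith [mul_self_nonneg (f x)]

end HMHD
end


open MeasureTheory
open scoped ENNReal

noncomputable section
namespace HMHD
open Filter Topology

lemma Sch.tendsto_line (h : Sch) (x : E2) (i : Fin 2) :
    Tendsto (fun s : ℝ => h (Function.update x i s)) atBot (𝓝 0) := by
  obtain ⟨g, hg⟩ := isSchwartz_iff.1 h.isS
  rw [← hg]
  have h1 := g.tendsto_cocompact
  have h2 := (isClosedEmbedding_update x i).tendsto_cocompact
  exact h1.comp (h2.comp atBot_le_cocompact)

lemma Sch.hasDerivAt_line (h : Sch) (x : E2) (i : Fin 2) (s : ℝ) :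
    HasDerivAt (fun s : ℝ => h (Function.update x i s)) ((D i h) (Function.update x i s)) s := by
  have h1 := (h.diff (Function.update x i s)).hasFDerivAt
  have h2 : HasDerivAt (fun s : ℝ => Function.update x i s) (Pi.single i (1 : ℝ)) s :=
    hasDerivAt_update x i s
  exact h1.comp_hasDerivAt s h2

lemma Sch.line_le (h : Sch) (x : E2) (i : Fin 2) :
    ‖h x‖ₑ ≤ ∫⁻ s : ℝ, ‖(D i h) (Function.update x i s)‖ₑ := by
  by_cases hfin : ∫⁻ s : ℝ, ‖(D i h) (Function.update x i s)‖ₑ = ∞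
  · rw [hfin]; exact le_top
  have hc : Continuous (fun s : ℝ => (D i h) (Function.update x i s)) :=
    (D i h).cont.comp (continuous_const.update i continuous_id)
  have hIntg : Integrable (fun s : ℝ => (D i h) (Function.update x i s)) :=
    ⟨hc.aestronglyMeasurable, lt_top_iff_ne_top.2 hfin⟩
  have := integral_Iic_of_hasDerivAt_of_tendsto' (a := x i)
    (fun s _ => h.hasDerivAt_line x i s) hIntg.integrableOn (h.tendsto_line x i)
  simp only [Function.update_eq_self, sub_zero] at this
  rw [← this]
  calc _ ≤ ∫⁻ s in Set.Iic (x i), ‖(D i h) (Function.update x i s)‖ₑ := enorm_integral_le_lintegral_enorm _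
    _ ≤ _ := setLIntegral_le_lintegral _ _

lemma lint_abs (f : Sch) : ∫⁻ x, ‖f x‖ₑ = ENNReal.ofReal (∫ x, |f x|) := by
  rw [ofReal_integral_eq_lintegral_ofReal f.integrable.abs (ae_of_all _ fun _ => abs_nonneg _)]
  congr 1; funext x
  rw [Real.enorm_eq_ofReal_abs]

lemma lad_base (h : Sch) : I (h * h) ≤ ((∫ x, |(D 0 h) x|) + ∫ x, |(D 1 h) x|) ^ 2 := by
  have key : ∫⁻ x, ‖(h * h) x‖ₑ ≤ (∫⁻ x, (‖(D 0 h) x‖ₑ + ‖(D 1 h) x‖ₑ)) ^ (2 : ℝ) := by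
    have hm : Measurable fun x => (‖(D 0 h) x‖ₑ + ‖(D 1 h) x‖ₑ) :=
      ((D 0 h).cont.measurable.enorm).add ((D 1 h).cont.measurable.enorm)
    have h2 : Real.HolderConjugate (Fintype.card (Fin 2) : ℝ) 2 := by
      rw [Real.holderConjugate_iff]; norm_num
    refine le_trans ?_ (lintegral_prod_lintegral_pow_le (fun _ => volume) h2 hm)
    apply lintegral_mono
    intro x
    simp only [Fin.prod_univ_two, Fintype.card_fin]
    norm_num
    gcongr
    · refine (h.line_le x 0).trans (lintegral_mono fun s => le_self_add)
    · refine (h.line_le x 1).trans (lintegral_mono fun s => le_add_self)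
  rw [lintegral_add_left (D 0 h).cont.measurable.enorm, lint_abs, lint_abs, lint_abs,
    ← ENNReal.ofReal_add (by positivity) (by positivity),
    ENNReal.ofReal_rpow_of_nonneg (by positivity) (by positivity)] at key
  rw [ENNReal.ofReal_le_ofReal_iff (by positivity)] at key
  have e : ∫ x, |(h * h) x| = I (h * h) := by
    rw [I_def]; congr 1; funext x; simp
  rw [e] at key
  exact_mod_cast key

lemma abs_cs (f g : Sch) : (∫ x, |f x * g x|) ^ 2 ≤ I (f * f) * I (g * g) := by
  have key : ∀ t : ℝ, 0 ≤ I (g * g) * (t * t) + (2 * ∫ x, |f x * g x|) * t + I (f * f) := by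
    intro t
    have h : 0 ≤ ∫ x, ((t * t) * (g * g) x + (2 * t) * |(f * g) x| + (f * f) x) := by
      apply integral_nonneg
      intro x
      simp only [mul_app, abs_mul, Pi.zero_apply]
      nlinarith [sq_nonneg (t * |g x| + |f x|), sq_abs (g x), sq_abs (f x)]
    have hi : Integrable (fun x => (t * t) * (g * g) x + (2 * t) * |(f * g) x|) :=
      ((g * g).integrable.const_mul _).add ((f * g).integrable.abs.const_mul _)
    rw [integral_add hi (f * f).integrable, integral_add ((g * g).integrable.const_mul _)
      ((f * g).integrable.abs.const_mul _), integral_const_mul, integral_const_mul] at h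
    simp only [I_def]
    simp only [mul_app] at h ⊢
    linarith
  have := discrim_le_zero key
  unfold discrim at this
  nlinarith

/-- `I` of a square -/
def N2 (f : Sch) : ℝ := I (f * f)
/-- `I` of a fourth power -/
def N4 (f : Sch) : ℝ := I ((f * f) * (f * f))
/-- Dirichlet energy -/
def G2 (f : Sch) : ℝ := N2 (D 0 f) + N2 (D 1 f)

lemma N2_nonneg (f : Sch) : 0 ≤ N2 f := I_sq_nonneg f
lemma N4_nonneg (f : Sch) : 0 ≤ N4 f := I_sq_nonneg _
lemma G2_nonneg (f : Sch) : 0 ≤ G2 f := add_nonneg (N2_nonneg _) (N2_nonneg _)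

/-- powers `f^(n+1)` -/
def fp (f : Sch) : ℕ → Sch
  | 0 => f
  | n + 1 => f * fp f n

lemma fp_app (f : Sch) (n : ℕ) (x : E2) : (fp f n) x = f x ^ (n + 1) := by
  induction n with
  | zero => simp [fp]
  | succ n ih => simp [fp, ih]; ring

lemma D_fp (f : Sch) (i : Fin 2) (n : ℕ) :
    D i (fp f (n + 1)) = ((n : ℝ) + 2) • (fp f n * D i f) := by
  induction n with
  | zero =>
    simp only [fp, D_mul]; apply Sch.ext'; intro x; simp; ring
  | succ n ih =>
    rw [fp, D_mul, ih]; apply Sch.ext'; intro x; simp [fp_app]; ring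

lemma gn_step (f : Sch) (n : ℕ) :
    N2 (fp f (n + 1)) ≤ 2 * ((n : ℝ) + 2) ^ 2 * (N2 (fp f n) * G2 f) := by
  have h := lad_base (fp f (n + 1))
  have e : ∀ i, ∫ x, |(D i (fp f (n + 1))) x| = ((n : ℝ) + 2) * ∫ x, |(fp f n) x * (D i f) x| := by
    intro i
    rw [D_fp, ← integral_const_mul]
    congr 1; funext x
    simp only [smul_app, mul_app]
    rw [abs_mul, abs_of_nonneg (by positivity : (0 : ℝ) ≤ (n : ℝ) + 2)]
  rw [e, e] at h
  have h0 := abs_cs (fp f n) (D 0 f)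
  have h1 := abs_cs (fp f n) (D 1 f)
  set A := ∫ x, |(fp f n) x * (D 0 f) x|
  set B := ∫ x, |(fp f n) x * (D 1 f) x|
  unfold N2 G2
  unfold N2
  have hn : 0 ≤ ((n : ℝ) + 2) ^ 2 := by positivity
  have h3 : (A + B) ^ 2 ≤ 2 * (A ^ 2 + B ^ 2) := by nlinarith [sq_nonneg (A - B)]
  calc _ ≤ _ := h
    _ = ((n : ℝ) + 2) ^ 2 * (A + B) ^ 2 := by ring
    _ ≤ ((n : ℝ) + 2) ^ 2 * (2 * (I (fp f n * fp f n) * I (D 0 f * D 0 f) + I (fp f n * fp f n) * I (D 1 f * D 1 f))) := by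
      gcongr; linarith
    _ = _ := by ring

lemma gn_even (n : ℕ) : ∃ C : ℝ, 0 ≤ C ∧ ∀ f : Sch, N2 (fp f n) ≤ C * (N2 f * G2 f ^ n) := by
  induction n with
  | zero => exact ⟨1, by norm_num, fun f => by simp [fp]⟩
  | succ n ih =>
    obtain ⟨C, hC, h⟩ := ih
    refine ⟨2 * ((n : ℝ) + 2) ^ 2 * C, by positivity, fun f => (gn_step f n).trans ?_⟩
    have := h f
    have hG := G2_nonneg f
    calc _ ≤ 2 * ((n : ℝ) + 2) ^ 2 * ((C * (N2 f * G2 f ^ n)) * G2 f) := by gcongr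
      _ = _ := by ring

lemma lady (f : Sch) : N4 f ≤ 8 * (N2 f * G2 f) := by
  have := gn_step f 0
  have e : N2 (fp f (0 + 1)) = N4 f := by simp only [N2, N4, fp]
  rw [e] at this
  simp only [fp] at this
  norm_num at this
  linarith

lemma agmon (f : Sch) (x : E2) :
    f x ^ 2 ≤ N2 f + N2 (D 1 (D 0 f)) + N2 (D 0 f) + N2 (D 1 f) := by
  set h := f * f with hh
  have h1 : ‖h x‖ₑ ≤ ∫⁻ y, ‖(D 1 (D 0 h)) y‖ₑ := by
    refine (h.line_le x 0).trans ?_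
    refine (lintegral_mono fun s => (D 0 h).line_le (Function.update x 0 s) 1).trans ?_
    have e : ∫⁻ y, ‖(D 1 (D 0 h)) y‖ₑ =
        ∫⁻ z : ℝ × ℝ, ‖(D 1 (D 0 h)) ((MeasurableEquiv.finTwoArrow).symm z)‖ₑ :=
      (((volume_preserving_finTwoArrow ℝ).symm _).lintegral_comp (D 1 (D 0 h)).cont.measurable.enorm).symm
    rw [e]
    have hm : Measurable fun z : ℝ × ℝ => ‖(D 1 (D 0 h)) ((MeasurableEquiv.finTwoArrow).symm z)‖ₑ :=
      (D 1 (D 0 h)).cont.measurable.enorm.comp (MeasurableEquiv.measurable _)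
    rw [Measure.volume_eq_prod, lintegral_prod _ hm.aemeasurable]
    apply le_of_eq
    congr 1; funext s; congr 1; funext r
    congr 2
    ext j; fin_cases j <;> simp [MeasurableEquiv.finTwoArrow, Function.update]
  rw [lint_abs, Real.enorm_eq_ofReal_abs, ENNReal.ofReal_le_ofReal_iff (by positivity)] at h1
  have e2 : |h x| = f x ^ 2 := by rw [hh, mul_app, abs_mul_self]; ring
  rw [e2] at h1
  refine h1.trans ?_
  have e3 : N2 f + N2 (D 1 (D 0 f)) + N2 (D 0 f) + N2 (D 1 f) =
    I (f * f + D 1 (D 0 f) * D 1 (D 0 f) + D 0 f * D 0 f + D 1 f * D 1 f) := by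
    simp only [N2, map_add]
  rw [e3]
  apply integral_mono (D 1 (D 0 h)).integrable.abs (Sch.integrable _)
  intro y
  have e4 : (D 1 (D 0 h)) y = 2 * (f y * (D 1 (D 0 f)) y + (D 0 f) y * (D 1 f) y) := by
    rw [hh, D_mul, map_add, D_mul, D_mul]; simp; ring
  simp only [e4, add_app, mul_app]
  rw [abs_le]
  constructor <;> nlinarith [sq_nonneg (f y + (D 1 (D 0 f)) y), sq_nonneg (f y - (D 1 (D 0 f)) y),
    sq_nonneg ((D 0 f) y + (D 1 f) y), sq_nonneg ((D 0 f) y - (D 1 f) y)]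

end HMHD
end


open MeasureTheory
open scoped ENNReal

noncomputable section
namespace HMHD

lemma rpow_le_one_add {M a r : ℝ} (hM : 0 ≤ M) (ha : 0 ≤ a) (har : a ≤ r) : M ^ a ≤ 1 + M ^ r := by
  rcases le_total M 1 with h | h
  · have := Real.rpow_le_one hM h ha
    have := Real.rpow_nonneg hM r
    linarith
  · have := Real.rpow_le_rpow_of_exponent_le h har
    linarith

lemma pow_interp {z μ s : ℝ} (n : ℕ) (hz : 0 ≤ z) (hμ : 0 < μ) (hs : 1 ≤ s) (hn : s ≤ n + 1) :
    z ^ s ≤ μ ^ (s - 1) * z + μ ^ (s - 1 - n) * z ^ (n + 1) := by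
  rcases hz.eq_or_lt with h | h
  · subst h
    rw [Real.zero_rpow (by linarith)]; simp
  · have e1 : z ^ s = z ^ (s - 1) * z := by
      rw [← Real.rpow_add_one h.ne']; congr 1; ring
    have e2 : z ^ s = z ^ (s - 1 - n) * z ^ (n + 1) := by
      rw [← Real.rpow_natCast, ← Real.rpow_add h]; congr 1; push_cast; ring
    rcases le_total z μ with hzm | hzm
    · have : z ^ (s - 1) * z ≤ μ ^ (s - 1) * z := by
        gcongr
      have : 0 ≤ μ ^ (s - 1 - n) * z ^ (n + 1) := by positivity
      linarith
    · have : z ^ (s - 1 - n) * z ^ (n + 1) ≤ μ ^ (s - 1 - n) * z ^ (n + 1) := by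
        gcongr ?_ * _
        exact Real.rpow_le_rpow_of_nonpos hμ hzm (by linarith)
      have : 0 ≤ μ ^ (s - 1) * z := by positivity
      linarith

lemma gn_real (s : ℝ) (hs : 1 < s) : ∃ C : ℝ, 0 ≤ C ∧ ∀ f : Sch, ∀ θ > 0,
    ∫ x, (f x ^ 2) ^ s ≤ C * (N2 f * (G2 f + θ) ^ (s - 1)) := by
  obtain ⟨n, hn⟩ := exists_nat_ge s
  obtain ⟨C, hC, h⟩ := gn_even n
  refine ⟨1 + C, by positivity, fun f θ hθ => ?_⟩
  have hG := G2_nonneg f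
  set μ := G2 f + θ with hμ
  have hμ0 : 0 < μ := by positivity
  have e : ∀ x, (f x ^ 2) ^ s ≤ (μ ^ (s - 1) • (f * f) + μ ^ (s - 1 - n) • (fp f n * fp f n)) x := by
    intro x
    refine (pow_interp n (sq_nonneg _) hμ0 hs.le (by linarith)).trans (le_of_eq ?_)
    simp [fp_app]; ring
  calc _ ≤ ∫ x, (μ ^ (s - 1) • (f * f) + μ ^ (s - 1 - n) • (fp f n * fp f n)) x := by
        apply integral_mono_of_nonneg (Filter.Eventually.of_forall fun x => ?_) (Sch.integrable _)
          (Filter.Eventually.of_forall e)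
        simp only [Pi.zero_apply]; positivity
    _ = μ ^ (s - 1) * N2 f + μ ^ (s - 1 - n) * N2 (fp f n) := by
        rw [← I_def]; simp [N2]
    _ ≤ μ ^ (s - 1) * N2 f + μ ^ (s - 1 - n) * (C * (N2 f * μ ^ n)) := by
        have h1 := h f
        have h2 := N2_nonneg f
        have : G2 f ^ n ≤ μ ^ n := by gcongr; linarith
        gcongr
        exact h1.trans (by gcongr)
    _ = _ := by
        have : μ ^ (s - 1) = μ ^ (s - 1 - n) * μ ^ n := by
          rw [← Real.rpow_natCast, ← Real.rpow_add hμ0]; congr 1; ring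
        rw [this]; ring

lemma gn_crit_fin (P r : ℝ) (hP : 2 < P) (hr : 2 ≤ r) (hPr : 2 / P + 2 / r ≤ 1) (δ : ℝ) (hδ : 0 < δ) :
    ∃ C : ℝ, 0 ≤ C ∧ ∀ j f : Sch, I ((j * f) * (j * f)) ≤
      δ * G2 f + C * (1 + ((∫ x, |j x| ^ P) ^ (1 / P)) ^ r) * N2 f := by
  set a := 1 - 2 / P with ha
  have ha0 : 0 < a := by
    have : 2 / P < 1 := by rw [div_lt_one (by linarith)]; exact hP
    linarith
  have ha1 : a < 1 := by
    have : 0 < 2 / P := by positivity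
    linarith
  set s' := 1 / a with hs'
  have hs1 : 1 < s' := by rw [hs', lt_div_iff₀ ha0]; linarith
  obtain ⟨C, hC, h⟩ := gn_real s' hs1
  have hconj : Real.HolderConjugate (P / 2) s' := by
    rw [Real.holderConjugate_iff]
    refine ⟨by linarith, ?_⟩
    rw [hs', ha]; field_simp; ring
  set K := C * δ ^ (-(1 - a) / a) with hK
  have hK0 : 0 ≤ K := by positivity
  refine ⟨K, hK0, fun j f => ?_⟩
  apply le_of_forall_pos_le_add
  intro θ' hθ'
  set θ := θ' / δ with hθ
  have hθ0 : 0 < θ := by positivity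
  have hN := N2_nonneg f
  have hG := G2_nonneg f
  set μ := G2 f + θ with hμ
  have hμ0 : 0 < μ := by positivity
  set M := (∫ x, |j x| ^ P) ^ (1 / P) with hM
  have hM0 : 0 ≤ M := by positivity
  have hold : I ((j * f) * (j * f)) ≤ (∫ x, (j x ^ 2) ^ (P / 2)) ^ (1 / (P / 2)) *
      (∫ x, (f x ^ 2) ^ s') ^ (1 / s') := by
    have e : I ((j * f) * (j * f)) = ∫ x, (j x ^ 2) * (f x ^ 2) := by
      rw [I_def]; congr 1; funext x; simp; ring
    rw [e]
    have m1 : MemLp (fun x => j x ^ 2) (ENNReal.ofReal (P / 2)) := by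
      have := (j * j).memLp (ENNReal.ofReal (P / 2))
      exact this.ae_eq (Filter.Eventually.of_forall fun x => by simp; ring)
    have m2 : MemLp (fun x => f x ^ 2) (ENNReal.ofReal s') := by
      have := (f * f).memLp (ENNReal.ofReal s')
      exact this.ae_eq (Filter.Eventually.of_forall fun x => by simp; ring)
    exact integral_mul_le_Lp_mul_Lq_of_nonneg hconj (Filter.Eventually.of_forall fun x => sq_nonneg _)
      (Filter.Eventually.of_forall fun x => sq_nonneg _) m1 m2
  have e1 : (∫ x, (j x ^ 2) ^ (P / 2)) ^ (1 / (P / 2)) = M ^ (2 : ℝ) := by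
    rw [hM, ← Real.rpow_mul (by positivity)]
    congr 1
    · congr 1; funext x
      rw [← sq_abs, ← Real.rpow_natCast, ← Real.rpow_mul (abs_nonneg _)]; congr 1; push_cast; ring
    · ring
  have e2 : (∫ x, (f x ^ 2) ^ s') ^ (1 / s') ≤ (C * (N2 f * μ ^ (s' - 1))) ^ a := by
    have : 1 / s' = a := by rw [hs']; field_simp
    rw [this]
    apply Real.rpow_le_rpow (integral_nonneg fun x => by positivity) (h f θ hθ0) ha0.le
  have e3 : M ^ (2 : ℝ) * (C * (N2 f * μ ^ (s' - 1))) ^ a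
      = (K * M ^ (2 / a) * N2 f) ^ a * (δ * μ) ^ (1 - a) := by
    rw [hK, Real.mul_rpow (by positivity) (by positivity), Real.mul_rpow (by positivity) (by positivity),
      Real.mul_rpow (by positivity) (by positivity), Real.mul_rpow (by positivity) (by positivity),
      Real.mul_rpow (by positivity) (by positivity), Real.mul_rpow (by positivity) (by positivity),
      ← Real.rpow_mul hμ0.le, ← Real.rpow_mul hδ.le, ← Real.rpow_mul hM0]
    have q1 : (s' - 1) * a = 1 - a := by rw [hs']; field_simp
    have q2 : -(1 - a) / a * a = -(1 - a) := by field_simp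
    have q3 : 2 / a * a = 2 := by field_simp
    rw [q1, q2, q3, Real.rpow_neg hδ.le]
    have : δ ^ (1 - a) ≠ 0 := by positivity
    field_simp
  have e4 : (K * M ^ (2 / a) * N2 f) ^ a * (δ * μ) ^ (1 - a) ≤ K * M ^ (2 / a) * N2 f + δ * μ := by
    have p1 : 0 ≤ K * M ^ (2 / a) * N2 f := by positivity
    have p2 : 0 ≤ δ * μ := by positivity
    refine (Real.geom_mean_le_arith_mean2_weighted ha0.le (by linarith) p1 p2 (by ring)).trans ?_
    nlinarith
  have e5 : M ^ (2 / a) ≤ 1 + M ^ r := by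
    apply rpow_le_one_add hM0 (by positivity)
    rw [div_le_iff₀ ha0]
    have : 2 / r ≤ a := by linarith
    rw [div_le_iff₀ (by linarith)] at this
    linarith
  rw [e1] at hold
  calc _ ≤ _ := hold
    _ ≤ M ^ (2 : ℝ) * (C * (N2 f * μ ^ (s' - 1))) ^ a := by gcongr
    _ ≤ K * M ^ (2 / a) * N2 f + δ * μ := by rw [e3]; exact e4
    _ ≤ K * (1 + M ^ r) * N2 f + δ * μ := by gcongr
    _ = _ := by rw [hμ, hθ]; field_simp; ring

lemma gn_crit (p : ℝ≥0∞) (r : ℝ) (hp : 2 < p) (hr : 2 ≤ r)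
    (hpr : 2 / p + 2 / ENNReal.ofReal r ≤ 1) (δ : ℝ) (hδ : 0 < δ) :
    ∃ C : ℝ, 0 ≤ C ∧ ∀ j f : Sch, I ((j * f) * (j * f)) ≤
      δ * G2 f + C * (1 + (eLpNorm (j : E2 → ℝ) p volume).toReal ^ r) * N2 f := by
  by_cases hpt : p = ∞
  · subst hpt
    refine ⟨1, by norm_num, fun j f => ?_⟩
    set M := (eLpNorm (j : E2 → ℝ) ∞ volume).toReal with hM
    have hM0 : 0 ≤ M := ENNReal.toReal_nonneg
    have hae : ∀ᵐ x, |j x| ≤ M := by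
      have := ae_le_eLpNormEssSup (f := (j : E2 → ℝ)) (μ := volume)
      filter_upwards [this] with x hx
      have hfin : eLpNorm (j : E2 → ℝ) ∞ volume ≠ ∞ := (j.memLp ∞).2.ne
      rw [hM, ← Real.norm_eq_abs, ← toReal_enorm]
      apply ENNReal.toReal_mono hfin
      rw [eLpNorm_exponent_top]; exact hx
    have h1 : I ((j * f) * (j * f)) ≤ M ^ 2 * N2 f := by
      have e : M ^ 2 * N2 f = I ((M ^ 2) • (f * f)) := by simp [N2]
      rw [e]
      apply integral_mono_ae (Sch.integrable _) (Sch.integrable _)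
      filter_upwards [hae] with x hx
      simp only [mul_app, smul_app]
      have : j x ^ 2 ≤ M ^ 2 := sq_le_sq' (by linarith [(abs_le.1 hx).1]) (abs_le.1 hx).2
      nlinarith [mul_self_nonneg (f x)]
    have h2 : M ^ 2 ≤ 1 + M ^ r := by
      have := rpow_le_one_add hM0 (by norm_num) hr
      rw [Real.rpow_two] at this; exact this
    have hN := N2_nonneg f
    have hG := G2_nonneg f
    have : M ^ 2 * N2 f ≤ (1 + M ^ r) * N2 f := by gcongr
    have : 0 ≤ δ * G2 f := by positivity
    linarith
  · have hP : 2 < p.toReal := by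
      have := (ENNReal.toReal_lt_toReal (by norm_num) hpt).2 hp
      simpa using this
    have hPr : 2 / p.toReal + 2 / r ≤ 1 := by
      have h0 : p ≠ 0 := by rintro rfl; simp at hp
      have hr0 : (ENNReal.ofReal r) ≠ 0 := by
        simp; linarith
      have := (ENNReal.toReal_le_toReal (by
        simp [ENNReal.div_eq_top, h0, hr0]) (by norm_num)).2 hpr
      rw [ENNReal.toReal_add (by simp [ENNReal.div_eq_top, h0]) (by simp [ENNReal.div_eq_top]; linarith)] at this
      rw [ENNReal.toReal_div, ENNReal.toReal_div, ENNReal.toReal_ofReal (by linarith)] at this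
      simpa using this
    obtain ⟨C, hC, h⟩ := gn_crit_fin p.toReal r hP hr hPr δ hδ
    refine ⟨C, hC, fun j f => ?_⟩
    have e : (eLpNorm (j : E2 → ℝ) p volume).toReal = (∫ x, |j x| ^ p.toReal) ^ (1 / p.toReal) := by
      rw [(j.memLp p).eLpNorm_eq_integral_rpow_norm (by rintro rfl; simp at hp) hpt,
        ENNReal.toReal_ofReal (by positivity)]
      simp [Real.norm_eq_abs]
    rw [e]; exact h j f

end HMHD
end


open MeasureTheory
open scoped ENNReal

noncomputable section
namespace HMHD

/-- iterated derivative along a word -/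
def dw : List (Fin 2) → Sch →ₗ[ℝ] Sch
  | [] => LinearMap.id
  | i :: w => (D i).comp (dw w)

@[simp] lemma dw_nil (f : Sch) : dw [] f = f := rfl
lemma dw_cons (i : Fin 2) (w : List (Fin 2)) (f : Sch) : dw (i :: w) f = D i (dw w f) := rfl

lemma dw_D (w : List (Fin 2)) (i : Fin 2) (f : Sch) : dw w (D i f) = D i (dw w f) := by
  induction w with
  | nil => rfl
  | cons j w ih => rw [dw_cons, ih, D_comm, dw_cons]

/-- words of given length -/
def words : ℕ → Finset (List (Fin 2))
  | 0 => {[]}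
  | k + 1 => (words k).image (List.cons 0) ∪ (words k).image (List.cons 1)

lemma mem_words {k : ℕ} {w : List (Fin 2)} : w ∈ words k ↔ w.length = k := by
  induction k generalizing w with
  | zero => simp [words]
  | succ k ih =>
    simp only [words, Finset.mem_union, Finset.mem_image, ih]
    constructor
    · rintro (⟨a, ha, rfl⟩ | ⟨a, ha, rfl⟩) <;> simp [ha]
    · intro h
      cases w with
      | nil => simp at h
      | cons i w =>
        simp at h
        fin_cases i
        · left; exact ⟨w, h, rfl⟩
        · right; exact ⟨w, h, rfl⟩

lemma sum_words_succ (k : ℕ) (F : List (Fin 2) → ℝ) :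
    ∑ w ∈ words (k + 1), F w = ∑ w ∈ words k, (F (0 :: w) + F (1 :: w)) := by
  rw [words, Finset.sum_union, Finset.sum_image, Finset.sum_image, Finset.sum_add_distrib]
  · intro a _ b _ h; simpa using h
  · intro a _ b _ h; simpa using h
  · rw [Finset.disjoint_left]
    intro a h1 h2
    simp only [Finset.mem_image] at h1 h2
    obtain ⟨x, _, rfl⟩ := h1
    obtain ⟨y, _, h⟩ := h2
    simp at h

/-- all splittings of a word -/
def splits : List (Fin 2) → List (List (Fin 2) × List (Fin 2))
  | [] => [([], [])]
  | i :: w => (splits w).map (fun p => (i :: p.1, p.2)) ++ (splits w).map (fun p => (p.1, i :: p.2))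

/-- splittings with nonempty first part -/
def sp1 : List (Fin 2) → List (List (Fin 2) × List (Fin 2))
  | [] => []
  | i :: w => (splits w).map (fun p => (i :: p.1, p.2)) ++ (sp1 w).map (fun p => (p.1, i :: p.2))

lemma splits_len {w : List (Fin 2)} {p} (h : p ∈ splits w) : p.1.length + p.2.length = w.length := by
  induction w generalizing p with
  | nil => simp [splits] at h; simp [h]
  | cons i w ih =>
    simp only [splits, List.mem_append, List.mem_map] at h
    rcases h with ⟨q, hq, rfl⟩ | ⟨q, hq, rfl⟩ <;> have := ih hq <;> simp <;> omega

lemma sp1_len {w : List (Fin 2)} {p} (h : p ∈ sp1 w) :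
    p.1.length + p.2.length = w.length ∧ 1 ≤ p.1.length := by
  induction w generalizing p with
  | nil => simp [sp1] at h
  | cons i w ih =>
    simp only [sp1, List.mem_append, List.mem_map] at h
    rcases h with ⟨q, hq, rfl⟩ | ⟨q, hq, rfl⟩
    · have := splits_len hq; simp; omega
    · have := ih hq; simp; omega

lemma D_list_sum (i : Fin 2) (L : List Sch) : D i L.sum = (L.map (D i)).sum := by
  induction L with
  | nil => simp
  | cons a L ih => simp [ih]

lemma list_sum_add {α : Type} (L : List α) (F G : α → Sch) :
    (L.map (fun a => F a + G a)).sum = (L.map F).sum + (L.map G).sum := by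
  induction L with
  | nil => simp
  | cons a L ih => simp [ih]; abel

lemma leib (w : List (Fin 2)) (f g : Sch) :
    dw w (f * g) = ((splits w).map (fun p => dw p.1 f * dw p.2 g)).sum := by
  induction w with
  | nil => simp [splits]
  | cons i w ih =>
    rw [dw_cons, ih, D_list_sum]
    simp only [splits, List.map_append, List.map_map, List.sum_append]
    rw [← list_sum_add]
    congr 1
    apply List.map_congr_left
    intro p _
    simp [D_mul, dw_cons]

lemma splits_sum (w : List (Fin 2)) (F : List (Fin 2) × List (Fin 2) → Sch) :
    ((splits w).map F).sum = F ([], w) + ((sp1 w).map F).sum := by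
  induction w generalizing F with
  | nil => simp [splits, sp1]
  | cons i w ih =>
    simp only [splits, sp1, List.map_append, List.map_map, List.sum_append]
    have := ih (F ∘ fun p => (p.1, i :: p.2))
    rw [this]
    simp only [Function.comp]
    abel

/-- Leibniz remainder -/
def R1 (w : List (Fin 2)) (f g : Sch) : Sch := ((sp1 w).map (fun p => dw p.1 f * dw p.2 g)).sum

lemma leib1 (w : List (Fin 2)) (f g : Sch) :
    dw w (f * g) = f * dw w g + R1 w f g := by
  rw [leib, splits_sum]; rfl

lemma N2_mul_le (f g : Sch) : N2 (f * g) ^ 2 ≤ N4 f * N4 g := by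
  have := I_cs (f * f) (g * g)
  have e : (f * f) * (g * g) = (f * g) * (f * g) := by
    apply Sch.ext'; intro x; simp; ring
  rw [e] at this
  exact this

lemma N2_mul_le' (f g : Sch) {a : ℝ} (ha : 0 < a) : N2 (f * g) ≤ a * N4 f + (4 * a)⁻¹ * N4 g := by
  have := I_young (f * f) (g * g) ha
  have e : (f * f) * (g * g) = (f * g) * (f * g) := by
    apply Sch.ext'; intro x; simp; ring
  rw [e] at this
  exact (le_abs_self _).trans this

lemma N2_add_le (f g : Sch) : N2 (f + g) ≤ 2 * N2 f + 2 * N2 g := by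
  have e : 2 * N2 f + 2 * N2 g = I ((2 : ℝ) • (f * f) + (2 : ℝ) • (g * g)) := by simp [N2]
  rw [e]
  apply I_mono
  intro x; simp; nlinarith [sq_nonneg (f x - g x)]

lemma N2_bdd (g f : Sch) (h : ∀ x, |g x| ≤ 1) : N2 (g * f) ≤ N2 f := by
  have := I_bdd g f h
  simpa [N2] using this

lemma N4_bdd (g f : Sch) (h : ∀ x, |g x| ≤ 1) : N4 (g * f) ≤ N4 f := by
  unfold N4
  have e : ((g * f) * (g * f)) * ((g * f) * (g * f)) = ((g * g) * (f * f)) * ((g * g) * (f * f)) := by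
    apply Sch.ext'; intro x; simp; ring
  rw [e]
  apply N2_bdd
  intro x
  have := h x
  simp only [mul_app, abs_mul]
  nlinarith [abs_nonneg (g x)]

/-- Data for the weighted estimate. -/
structure Dat where
  f : Fin 6 → Sch
  p : Sch
  φ : Sch
  κ : ℝ

/-- weighted sum of order `k` derivatives -/
def yk (k : ℕ) (d : Dat) : ℝ := ∑ c, ∑ w ∈ words k, N2 (d.φ * dw w (d.f c))
/-- unweighted sum of order `k` derivatives -/
def Yk (k : ℕ) (f : Fin 6 → Sch) : ℝ := ∑ c, ∑ w ∈ words k, N2 (dw w (f c))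
/-- sum of fourth powers -/
def Lam (k : ℕ) (f : Fin 6 → Sch) : ℝ := ∑ c, ∑ l ∈ Finset.range k, ∑ w ∈ words l, N4 (dw w (f c))
/-- right-hand side quantity -/
def Xk (k : ℕ) (d : Dat) : ℝ := (1 + Lam k d.f) * yk k d + Lam k d.f + Yk k d.f

/-- the momentum nonlinearity -/
def Nu (f : Fin 6 → Sch) (i j : Fin 6) : Sch :=
  f 0 * D 0 (f i) + f 1 * D 1 (f i) - (f 3 * D 0 (f j) + f 4 * D 1 (f j))

/-- admissible data -/
structure Adm (d : Dat) : Prop where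
  hφ : ∀ x, |d.φ x| ≤ 1
  hκ0 : 0 ≤ d.κ
  hκ1 : d.κ ≤ 1
  hD : ∀ i x, |(D i d.φ) x| ≤ d.κ
  hf : ∀ c x, d.κ * |d.f c x| ≤ 1
  du : D 0 (d.f 0) + D 1 (d.f 1) = 0
  db : D 0 (d.f 3) + D 1 (d.f 4) = 0
  pois : D 0 (D 0 d.p) + D 1 (D 1 d.p) = -(D 0 (Nu d.f 0 3) + D 1 (Nu d.f 1 4))

/-- controlled functionals -/
def Ctrl (k : ℕ) (F : Dat → ℝ) : Prop :=
  ∀ δ > 0, ∃ C : ℝ, 0 ≤ C ∧ ∀ d, Adm d → |F d| ≤ δ * yk (k + 1) d + C * Xk k d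

lemma yk_nonneg (k d) : 0 ≤ yk k d := Finset.sum_nonneg fun _ _ => Finset.sum_nonneg fun _ _ => N2_nonneg _
lemma Yk_nonneg (k f) : 0 ≤ Yk k f := Finset.sum_nonneg fun _ _ => Finset.sum_nonneg fun _ _ => N2_nonneg _
lemma Lam_nonneg (k f) : 0 ≤ Lam k f := Finset.sum_nonneg fun _ _ => Finset.sum_nonneg fun _ _ =>
  Finset.sum_nonneg fun _ _ => N4_nonneg _
lemma Xk_nonneg (k d) : 0 ≤ Xk k d := by
  have := yk_nonneg k d; have := Yk_nonneg k d.f; have := Lam_nonneg k d.f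
  unfold Xk; positivity

lemma le_yk {k : ℕ} {w : List (Fin 2)} (hw : w.length = k) (d : Dat) (c : Fin 6) :
    N2 (d.φ * dw w (d.f c)) ≤ yk k d := by
  unfold yk
  refine le_trans ?_ (Finset.single_le_sum (f := fun c => ∑ w ∈ words k, N2 (d.φ * dw w (d.f c)))
    (fun _ _ => Finset.sum_nonneg fun _ _ => N2_nonneg _) (Finset.mem_univ c))
  exact Finset.single_le_sum (f := fun w => N2 (d.φ * dw w (d.f c))) (fun _ _ => N2_nonneg _) (mem_words.2 hw)

lemma le_Yk {k : ℕ} {w : List (Fin 2)} (hw : w.length = k) (f : Fin 6 → Sch) (c : Fin 6) :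
    N2 (dw w (f c)) ≤ Yk k f := by
  unfold Yk
  refine le_trans ?_ (Finset.single_le_sum (f := fun c => ∑ w ∈ words k, N2 (dw w (f c)))
    (fun _ _ => Finset.sum_nonneg fun _ _ => N2_nonneg _) (Finset.mem_univ c))
  exact Finset.single_le_sum (f := fun w => N2 (dw w (f c))) (fun _ _ => N2_nonneg _) (mem_words.2 hw)

lemma le_Lam {k : ℕ} {w : List (Fin 2)} (hw : w.length < k) (f : Fin 6 → Sch) (c : Fin 6) :
    N4 (dw w (f c)) ≤ Lam k f := by
  unfold Lam
  refine le_trans ?_ (Finset.single_le_sum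
    (f := fun c => ∑ l ∈ Finset.range k, ∑ w ∈ words l, N4 (dw w (f c)))
    (fun _ _ => Finset.sum_nonneg fun _ _ => Finset.sum_nonneg fun _ _ => N4_nonneg _) (Finset.mem_univ c))
  refine le_trans ?_ (Finset.single_le_sum (f := fun l => ∑ w ∈ words l, N4 (dw w (f c)))
    (fun _ _ => Finset.sum_nonneg fun _ _ => N4_nonneg _) (Finset.mem_range.2 hw))
  exact Finset.single_le_sum (f := fun w => N4 (dw w (f c))) (fun _ _ => N4_nonneg _) (mem_words.2 rfl)

lemma yk_le_Yk (k : ℕ) {d : Dat} (hd : Adm d) : yk k d ≤ Yk k d.f :=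
  Finset.sum_le_sum fun _ _ => Finset.sum_le_sum fun _ _ => N2_bdd _ _ hd.hφ

lemma Ctrl.zero {k} : Ctrl k (fun _ => 0) := fun δ hδ => ⟨0, le_rfl, fun d _ => by
  have := yk_nonneg (k + 1) d
  simp; positivity⟩

lemma Ctrl.add {k F G} (hF : Ctrl k F) (hG : Ctrl k G) : Ctrl k (fun d => F d + G d) := by
  intro δ hδ
  obtain ⟨C1, h1, k1⟩ := hF (δ / 2) (by positivity)
  obtain ⟨C2, h2, k2⟩ := hG (δ / 2) (by positivity)
  refine ⟨C1 + C2, by positivity, fun d hd => ?_⟩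
  have a := k1 d hd; have b := k2 d hd
  have := abs_add_le (F d) (G d)
  linarith

lemma Ctrl.smul {k F} (hF : Ctrl k F) (a : ℝ) : Ctrl k (fun d => a * F d) := by
  intro δ hδ
  obtain ⟨C1, h1, k1⟩ := hF (δ / (|a| + 1)) (by positivity)
  refine ⟨(|a| + 1) * C1, by positivity, fun d hd => ?_⟩
  have h := k1 d hd
  have hX := Xk_nonneg k d
  rw [abs_mul]
  calc |a| * |F d| ≤ (|a| + 1) * |F d| := by gcongr; linarith
    _ ≤ (|a| + 1) * (δ / (|a| + 1) * yk (k + 1) d + C1 * Xk k d) := by gcongr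
    _ = _ := by field_simp

lemma Ctrl.neg {k F} (hF : Ctrl k F) : Ctrl k (fun d => - F d) := by
  have := hF.smul (-1); simpa using this

lemma Ctrl.sub {k F G} (hF : Ctrl k F) (hG : Ctrl k G) : Ctrl k (fun d => F d - G d) := by
  have := hF.add hG.neg; simpa [sub_eq_add_neg] using this

lemma Ctrl.congr {k F G} (hF : Ctrl k F) (h : ∀ d, Adm d → G d = F d) : Ctrl k G := by
  intro δ hδ
  obtain ⟨C1, h1, k1⟩ := hF δ hδ
  exact ⟨C1, h1, fun d hd => by rw [h d hd]; exact k1 d hd⟩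

lemma Ctrl.sum {k} {ι : Type} (s : Finset ι) {F : ι → Dat → ℝ} (h : ∀ i ∈ s, Ctrl k (F i)) :
    Ctrl k (fun d => ∑ i ∈ s, F i d) := by
  classical
  induction s using Finset.induction_on with
  | empty => simpa using Ctrl.zero
  | insert a s ha ih =>
    simp only [Finset.sum_insert ha]
    exact (h a (by simp)).add (ih fun i hi => h i (by simp [hi]))

lemma Ctrl.listsum {k} {ι : Type} (L : List ι) (F : ι → Dat → Sch) (G H : Dat → Sch)
    (h : ∀ i ∈ L, Ctrl k (fun d => I (G d * (F i d * H d)))) :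
    Ctrl k (fun d => I (G d * ((L.map (fun i => F i d)).sum * H d))) := by
  induction L with
  | nil => simpa using Ctrl.zero
  | cons a L ih =>
    have h1 := (h a (by simp)).add (ih fun i hi => h i (by simp [hi]))
    refine h1.congr fun d _ => ?_
    simp [add_mul, mul_add]

/-- bilinear estimate -/
lemma ctrl_bi {k : ℕ} (a b : List (Fin 2)) (ha : a.length = k + 1) (hb : b.length = k) (p q : Fin 6)
    (ψ : Dat → Sch) (hψ : ∀ d, Adm d → ∀ x, |ψ d x| ≤ 1) :
    Ctrl k (fun d => I ((d.φ * dw a (d.f p)) * (ψ d * dw b (d.f q)))) := by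
  intro δ hδ
  refine ⟨(4 * δ)⁻¹, by positivity, fun d hd => (I_young _ _ hδ).trans ?_⟩
  have h1 := le_yk ha d p
  have h2 := N2_bdd (ψ d) (dw b (d.f q)) (hψ d hd)
  have h3 := le_Yk hb d.f q
  have h4 : Yk k d.f ≤ Xk k d := by
    have := yk_nonneg k d; have := Lam_nonneg k d.f
    have : 0 ≤ (1 + Lam k d.f) * yk k d := by positivity
    unfold Xk; linarith
  unfold N2 at *
  gcongr
  linarith

lemma G2_phi {k : ℕ} {d : Dat} (hd : Adm d) (b : List (Fin 2)) (hb : b.length = k) (q : Fin 6) :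
    G2 (d.φ * dw b (d.f q)) ≤ 4 * (yk (k + 1) d + Yk k d.f) := by
  have key : ∀ i, N2 (D i (d.φ * dw b (d.f q))) ≤ 2 * (yk (k + 1) d + Yk k d.f) := by
    intro i
    rw [D_mul]
    refine (N2_add_le _ _).trans ?_
    have h1 := le_yk (w := i :: b) (by simp [hb]) d q (k := k + 1)
    rw [dw_cons] at h1
    have h2 := N2_bdd (D i d.φ) (dw b (d.f q)) (fun x => (hd.hD i x).trans hd.hκ1)
    have h3 := le_Yk hb d.f q
    linarith
  have := key 0; have := key 1
  unfold G2; linarith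

lemma le_of_sq_le {N a b : ℝ} (ha : 0 ≤ a) (hb : 0 ≤ b) (h : N ^ 2 ≤ 4 * (a * b)) : N ≤ a + b := by
  nlinarith [sq_nonneg (a - b)]

/-- trilinear estimate -/
lemma ctrl_tri {k : ℕ} (a b c : List (Fin 2)) (ha : a.length < k) (hb : b.length ≤ k) (p q r : Fin 6)
    (ψ : Dat → Sch) (hψ : ∀ d, Adm d → N2 (ψ d * dw c (d.f r)) ≤ yk (k + 1) d + Yk k d.f) :
    Ctrl k (fun d => I ((dw a (d.f p) * (d.φ * dw b (d.f q))) * (ψ d * dw c (d.f r)))) := by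
  intro δ hδ
  set δ' := δ / 2 with hδ'
  have hd0 : 0 < δ' := by positivity
  set B := (4 * δ')⁻¹ with hB
  have hB0 : 0 < B := by positivity
  refine ⟨δ + 8 * B ^ 2 / δ' + B, by positivity, fun d hd => ?_⟩
  have hy := yk_nonneg k d
  have hyy := yk_nonneg (k + 1) d
  have hY := Yk_nonneg k d.f
  have hL := Lam_nonneg k d.f
  have h1 := I_young (ψ d * dw c (d.f r)) (dw a (d.f p) * (d.φ * dw b (d.f q))) hd0
  rw [mul_comm] at h1
  refine h1.trans ?_
  have h2 := hψ d hd
  have h3 := le_Lam ha d.f p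
  change δ' * N2 _ + B * N2 _ ≤ _
  have hX : Xk k d = yk k d + Lam k d.f * yk k d + Lam k d.f + Yk k d.f := by unfold Xk; ring
  have hly : 0 ≤ Lam k d.f * yk k d := by positivity
  have hN4 := N4_nonneg (dw a (d.f p))
  have main : N2 (dw a (d.f p) * (d.φ * dw b (d.f q))) ≤
      ((δ' / B) * (yk (k + 1) d + Yk k d.f) + (8 * B / δ') * (Lam k d.f * yk k d)) + Lam k d.f := by
    have h4 := N2_mul_le (dw a (d.f p)) (d.φ * dw b (d.f q))
    have p1 : 0 ≤ (δ' / B) * (yk (k + 1) d + Yk k d.f) := by positivity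
    have p2 : 0 ≤ (8 * B / δ') * (Lam k d.f * yk k d) := by positivity
    rcases hb.lt_or_eq with hb | hb
    · have h5 := (N4_bdd d.φ (dw b (d.f q)) hd.hφ).trans (le_Lam hb d.f q)
      have : N2 (dw a (d.f p) * (d.φ * dw b (d.f q))) ≤ Lam k d.f := by
        apply le_of_sq_le_sq _ hL
        refine h4.trans ?_
        rw [sq]
        gcongr
        exact N4_nonneg _
      linarith
    · have h5 := lady (d.φ * dw b (d.f q))
      have h6 := G2_phi hd b hb q
      have h7 := le_yk hb d q
      have h8 : N4 (d.φ * dw b (d.f q)) ≤ 8 * (yk k d * (4 * (yk (k + 1) d + Yk k d.f))) := by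
        refine h5.trans ?_
        gcongr
        exact G2_nonneg _
      have h9 := le_of_sq_le (N := N2 (dw a (d.f p) * (d.φ * dw b (d.f q)))) p1 p2 (h4.trans (by
        calc _ ≤ Lam k d.f * (8 * (yk k d * (4 * (yk (k + 1) d + Yk k d.f)))) := by
              gcongr
              exact N4_nonneg _
          _ = _ := by field_simp))
      linarith
  calc _ ≤ δ' * (yk (k + 1) d + Yk k d.f) + B * (((δ' / B) * (yk (k + 1) d + Yk k d.f)
        + (8 * B / δ') * (Lam k d.f * yk k d)) + Lam k d.f) := by gcongr
    _ = δ * yk (k + 1) d + (δ * Yk k d.f + 8 * B ^ 2 / δ' * (Lam k d.f * yk k d) + B * Lam k d.f) := by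
        rw [hδ']; field_simp; ring
    _ ≤ _ := by
        rw [hX]
        have c1 : 0 ≤ 8 * B ^ 2 / δ' := by positivity
        set c2 := 8 * B ^ 2 / δ'
        have : 0 ≤ δ * (yk k d + Lam k d.f * yk k d + Lam k d.f) := by positivity
        have : 0 ≤ c2 * (yk k d + Yk k d.f + Lam k d.f) := by positivity
        have : 0 ≤ B * (yk k d + Lam k d.f * yk k d + Yk k d.f) := by positivity
        nlinarith

lemma psi_phi {k : ℕ} {c : List (Fin 2)} (hc : c.length = k ∨ c.length = k + 1) (r : Fin 6) (d : Dat)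
    (hd : Adm d) : N2 (d.φ * dw c (d.f r)) ≤ yk (k + 1) d + Yk k d.f := by
  have hyy := yk_nonneg (k + 1) d
  have hY := Yk_nonneg k d.f
  rcases hc with hc | hc
  · have := (N2_bdd d.φ _ hd.hφ).trans (le_Yk hc d.f r); linarith
  · have := le_yk hc d r; linarith

lemma psi_Dphi {k : ℕ} {c : List (Fin 2)} (hc : c.length = k) (r : Fin 6) (i : Fin 2) (d : Dat)
    (hd : Adm d) : N2 (D i d.φ * dw c (d.f r)) ≤ yk (k + 1) d + Yk k d.f := by
  have hyy := yk_nonneg (k + 1) d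
  have := (N2_bdd (D i d.φ) _ (fun x => (hd.hD i x).trans hd.hκ1)).trans (le_Yk hc d.f r); linarith

/-- trilinear estimate, arbitrary order of two lower factors -/
lemma ctrl_tri2 {k : ℕ} (a b c : List (Fin 2)) (hab : a.length + b.length ≤ k + 1) (h1 : 1 ≤ a.length)
    (h2 : 1 ≤ b.length) (hk : 2 ≤ k) (p q r : Fin 6)
    (ψ : Dat → Sch) (hψ : ∀ d, Adm d → N2 (ψ d * dw c (d.f r)) ≤ yk (k + 1) d + Yk k d.f) :
    Ctrl k (fun d => I (d.φ * ((dw a (d.f p) * dw b (d.f q)) * (ψ d * dw c (d.f r))))) := by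
  by_cases h : a.length < k
  · refine (ctrl_tri a b c h (by omega) p q r ψ hψ).congr fun d _ => ?_
    congr 1; apply Sch.ext'; intro x; simp; ring
  · refine (ctrl_tri b a c (by omega) (by omega) q p r ψ hψ).congr fun d _ => ?_
    congr 1; apply Sch.ext'; intro x; simp; ring

/-- Leibniz remainder terms are controlled -/
lemma ctrl_R1 {k : ℕ} (hk : 2 ≤ k) (w c : List (Fin 2)) (hw : w.length = k) (p q r : Fin 6) (i : Fin 2)
    (ψ : Dat → Sch) (hψ : ∀ d, Adm d → N2 (ψ d * dw c (d.f r)) ≤ yk (k + 1) d + Yk k d.f) :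
    Ctrl k (fun d => I (d.φ * (R1 w (d.f p) (D i (d.f q)) * (ψ d * dw c (d.f r))))) := by
  unfold R1
  apply Ctrl.listsum (sp1 w) (fun s d => dw s.1 (d.f p) * dw s.2 (D i (d.f q))) (fun d => d.φ)
    (fun d => ψ d * dw c (d.f r))
  intro s hs
  have hl := sp1_len hs
  have := ctrl_tri2 s.1 (i :: s.2) c (k := k) (by simp; omega) hl.2 (by simp) hk p q r ψ hψ
  simpa only [dw_D, dw_cons] using this

/-- transport terms -/
lemma ctrl_mhd {k : ℕ} (hk : 2 ≤ k) (w : List (Fin 2)) (hw : w.length = k) (p q r : Fin 6) (i : Fin 2) :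
    Ctrl k (fun d => I ((d.φ * d.φ) * (dw w (d.f r) * dw w (d.f p * D i (d.f q))))) := by
  have h1 := ctrl_R1 hk w w hw p q r i (fun d => d.φ) (fun d hd => psi_phi (Or.inl hw) r d hd)
  have h2 := ctrl_tri (k := k) [] w (i :: w) (by simp; omega) hw.le p r q (fun d => d.φ)
    (fun d hd => psi_phi (Or.inr (by simp [hw])) q d hd)
  refine (h1.add h2).congr fun d _ => ?_
  rw [leib1, dw_D, dw_cons, dw_nil, ← map_add]
  congr 1; apply Sch.ext'; intro x; simp; ring

/-- Hall commutators -/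
lemma ctrl_hall {k : ℕ} (hk : 2 ≤ k) (w : List (Fin 2)) (hw : w.length = k) (p q r : Fin 6) (i j : Fin 2) :
    Ctrl k (fun d => I ((d.φ * d.φ) * (R1 w (d.f p) (D i (d.f q)) * D j (dw w (d.f r))))) := by
  have h1 := ctrl_R1 hk w (j :: w) hw p q r i (fun d => d.φ)
    (fun d hd => psi_phi (Or.inr (by simp [hw])) r d hd)
  refine h1.congr fun d _ => ?_
  rw [dw_cons]
  congr 1; apply Sch.ext'; intro x; simp; ring

/-- Hall cutoff errors -/
lemma ctrl_hall_err {k : ℕ} (hk : 2 ≤ k) (w : List (Fin 2)) (hw : w.length = k) (p q r : Fin 6) (i j : Fin 2) :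
    Ctrl k (fun d => I ((d.φ * D j d.φ) * (dw w (d.f r) * dw w (d.f p * D i (d.f q))))) := by
  have h1 := ctrl_R1 hk w w hw p q r i (fun d => D j d.φ) (fun d hd => psi_Dphi hw r j d hd)
  have h2 := ctrl_bi (k := k) (i :: w) w (by simp [hw]) hw q r (fun d => D j d.φ * d.f p) (by
    intro d hd x
    have h1 := hd.hD j x
    have h2 := hd.hf p x
    simp only [mul_app, abs_mul]
    have := abs_nonneg (d.f p x)
    nlinarith)
  refine (h1.add h2).congr fun d _ => ?_
  rw [leib1, dw_D, dw_cons, ← map_add]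
  congr 1; apply Sch.ext'; intro x; simp; ring

/-- viscous cutoff errors -/
lemma ctrl_visc_err {k : ℕ} (w : List (Fin 2)) (hw : w.length = k) (r : Fin 6) (i j : Fin 2) :
    Ctrl k (fun d => I ((d.φ * D j d.φ) * (dw w (d.f r) * D i (dw w (d.f r))))) := by
  have h2 := ctrl_bi (k := k) (i :: w) w (by simp [hw]) hw r r (fun d => D j d.φ) (by
    intro d hd x
    exact (hd.hD j x).trans hd.hκ1)
  refine h2.congr fun d _ => ?_
  rw [dw_cons]
  congr 1; apply Sch.ext'; intro x; simp; ring

end HMHD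
end


open MeasureTheory
open scoped ENNReal

noncomputable section
namespace HMHD

lemma press {q n0 n1 : Sch} (h : D 0 (D 0 q) + D 1 (D 1 q) = -(D 0 n0 + D 1 n1)) :
    G2 q ≤ N2 n0 + N2 n1 := by
  have e1 : G2 q = - I ((D 0 (D 0 q) + D 1 (D 1 q)) * q) := by
    rw [add_mul, map_add, I_ibp 0 (D 0 q) q, I_ibp 1 (D 1 q) q]; unfold G2 N2; ring
  have e2 : I ((D 0 n0 + D 1 n1) * q) = - I (D 0 q * n0) - I (D 1 q * n1) := by
    rw [add_mul, map_add, I_ibp, I_ibp, mul_comm n0, mul_comm n1]; ring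
  rw [h, neg_mul, map_neg, neg_neg, e2] at e1
  have h1 := I_young (D 0 q) n0 (δ := 1 / 2) (by norm_num)
  have h2 := I_young (D 1 q) n1 (δ := 1 / 2) (by norm_num)
  have a1 := neg_abs_le (I (D 0 q * n0))
  have a2 := neg_abs_le (I (D 1 q * n1))
  unfold G2 N2 at *
  norm_num at h1 h2
  linarith

lemma N2_smul (a : ℝ) (f : Sch) : N2 (a • f) = a ^ 2 * N2 f := by
  unfold N2
  have : (a • f) * (a • f) = (a ^ 2) • (f * f) := by apply Sch.ext'; intro x; simp; ring
  rw [this]; simp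

/-- bounded quantities in the pressure estimate -/
def Bd (k : ℕ) (F : Dat → Sch) : Prop :=
  ∃ C : ℝ, 0 ≤ C ∧ ∀ d, Adm d → N2 (d.κ • F d) ≤ C * (Yk k d.f + Lam k d.f)

lemma Bd.zero {k} : Bd k (fun _ => 0) := ⟨0, le_rfl, fun d _ => by simp [N2]⟩

lemma Bd.add {k F G} (hF : Bd k F) (hG : Bd k G) : Bd k (fun d => F d + G d) := by
  obtain ⟨C1, h1, k1⟩ := hF
  obtain ⟨C2, h2, k2⟩ := hG
  refine ⟨2 * C1 + 2 * C2, by positivity, fun d hd => ?_⟩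
  rw [smul_add]
  refine (N2_add_le _ _).trans ?_
  have := k1 d hd; have := k2 d hd
  linarith

lemma Bd.neg {k F} (hF : Bd k F) : Bd k (fun d => - F d) := by
  obtain ⟨C1, h1, k1⟩ := hF
  refine ⟨C1, h1, fun d hd => ?_⟩
  rw [smul_neg]; unfold N2; rw [neg_mul_neg]; exact k1 d hd

lemma Bd.sub {k F G} (hF : Bd k F) (hG : Bd k G) : Bd k (fun d => F d - G d) := by
  have := hF.add hG.neg; simpa [sub_eq_add_neg] using this

lemma Bd.list {k} {ι : Type} (L : List ι) (F : ι → Dat → Sch) (h : ∀ i ∈ L, Bd k (F i)) :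
    Bd k (fun d => (L.map (fun i => F i d)).sum) := by
  induction L with
  | nil => simpa using Bd.zero
  | cons a L ih =>
    have h1 := (h a (by simp)).add (ih fun i hi => h i (by simp [hi]))
    simpa using h1

lemma bd_term {k : ℕ} (w : List (Fin 2)) (hw : w.length + 1 = k) (p q : Fin 6) (i : Fin 2) :
    Bd k (fun d => dw w (d.f p * D i (d.f q))) := by
  have h1 : Bd k (fun d => d.f p * dw (i :: w) (d.f q)) := by
    refine ⟨1, by norm_num, fun d hd => ?_⟩
    have e : d.κ • (d.f p * dw (i :: w) (d.f q)) = (d.κ • d.f p) * dw (i :: w) (d.f q) := by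
      rw [smul_mul_assoc]
    rw [e]
    refine (N2_bdd _ _ ?_).trans ?_
    · intro x; rw [smul_app, abs_mul, abs_of_nonneg hd.hκ0]; exact hd.hf p x
    · have := le_Yk (w := i :: w) (k := k) (by simp [hw]) d.f q
      have := Lam_nonneg k d.f
      linarith
  have h2 : Bd k (fun d => R1 w (d.f p) (D i (d.f q))) := by
    unfold R1
    apply Bd.list (sp1 w) (fun s d => dw s.1 (d.f p) * dw s.2 (D i (d.f q)))
    intro s hs
    have hl := sp1_len hs
    refine ⟨1, by norm_num, fun d hd => ?_⟩
    have e : N2 (d.κ • (dw s.1 (d.f p) * dw s.2 (D i (d.f q)))) ≤ N2 (dw s.1 (d.f p) * dw (i :: s.2) (d.f q)) := by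
      rw [N2_smul, dw_D, dw_cons]
      have := hd.hκ0; have := hd.hκ1
      have := N2_nonneg (dw s.1 (d.f p) * D i (dw s.2 (d.f q)))
      have : d.κ ^ 2 ≤ 1 := by nlinarith
      nlinarith
    refine e.trans ?_
    have h4 := N2_mul_le (dw s.1 (d.f p)) (dw (i :: s.2) (d.f q))
    have h5 := le_Lam (w := s.1) (k := k) (by omega) d.f p
    have h6 := le_Lam (w := i :: s.2) (k := k) (by simp; omega) d.f q
    have hL := Lam_nonneg k d.f
    have hY := Yk_nonneg k d.f
    have : N2 (dw s.1 (d.f p) * dw (i :: s.2) (d.f q)) ≤ Lam k d.f := by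
      apply le_of_sq_le_sq _ hL
      refine h4.trans ?_
      rw [sq]
      gcongr
      exact N4_nonneg _
    linarith
  have := h1.add h2
  simpa only [leib1, dw_D, dw_cons] using this

lemma bd_Nu {k : ℕ} (w : List (Fin 2)) (hw : w.length + 1 = k) (i j : Fin 6) :
    Bd k (fun d => dw w (Nu d.f i j)) := by
  have := ((bd_term w hw 0 i 0).add (bd_term w hw 1 i 1)).sub
    ((bd_term w hw 3 j 0).add (bd_term w hw 4 j 1))
  simpa only [Nu, map_add, map_sub] using this

lemma ctrl_press {k : ℕ} (hk : 1 ≤ k) (w : List (Fin 2)) (hw : w.length = k) (r : Fin 6) (j : Fin 2) :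
    Ctrl k (fun d => I ((d.φ * D j d.φ) * (dw w (d.f r) * dw w d.p))) := by
  obtain ⟨i, w', rfl⟩ : ∃ i w', w = i :: w' := by
    cases w with
    | nil => simp at hw; omega
    | cons i w' => exact ⟨i, w', rfl⟩
  obtain ⟨C0, hC0, h0⟩ := bd_Nu (k := k) w' (by simpa using hw) 0 3
  obtain ⟨C1, hC1, h1⟩ := bd_Nu (k := k) w' (by simpa using hw) 1 4
  intro δ hδ
  refine ⟨1 + C0 + C1, by positivity, fun d hd => ?_⟩
  have e : (d.φ * D j d.φ) * (dw (i :: w') (d.f r) * dw (i :: w') d.p)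
      = (d.φ * dw (i :: w') (d.f r)) * (D j d.φ * dw (i :: w') d.p) := by
    apply Sch.ext'; intro x; simp; ring
  beta_reduce
  rw [e]
  refine (I_young _ _ (δ := 1) one_pos).trans ?_
  have a1 := le_yk hw d r
  have a2 : I ((D j d.φ * dw (i :: w') d.p) * (D j d.φ * dw (i :: w') d.p)) ≤ d.κ ^ 2 * N2 (dw (i :: w') d.p) :=
    I_bdd _ _ (hd.hD j)
  have a3 : N2 (dw (i :: w') d.p) ≤ G2 (dw w' d.p) := by
    rw [dw_cons]; unfold G2
    have := N2_nonneg (D 0 (dw w' d.p)); have := N2_nonneg (D 1 (dw w' d.p))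
    fin_cases i <;> simp <;> linarith
  have a4 : G2 (dw w' d.p) ≤ N2 (dw w' (Nu d.f 0 3)) + N2 (dw w' (Nu d.f 1 4)) := by
    apply press
    have := congrArg (dw w') hd.pois
    simpa only [map_add, map_neg, dw_D] using this
  have a5 := h0 d hd
  have a6 := h1 d hd
  beta_reduce at a5 a6
  rw [N2_smul] at a5 a6
  have hy := yk_nonneg k d; have hY := Yk_nonneg k d.f; have hL := Lam_nonneg k d.f
  have hX : Xk k d = yk k d + Lam k d.f * yk k d + Lam k d.f + Yk k d.f := by unfold Xk; ring
  have hly : 0 ≤ Lam k d.f * yk k d := by positivity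
  have a7 : d.κ ^ 2 * N2 (dw (i :: w') d.p) ≤ (C0 + C1) * (Yk k d.f + Lam k d.f) := by
    calc _ ≤ d.κ ^ 2 * (N2 (dw w' (Nu d.f 0 3)) + N2 (dw w' (Nu d.f 1 4))) := by
          gcongr; exact a3.trans a4
      _ ≤ _ := by linarith
  have hD := yk_nonneg (k + 1) d
  have : 0 ≤ δ * yk (k + 1) d := by positivity
  have : 0 ≤ (C0 + C1) * (yk k d + Lam k d.f * yk k d) := by positivity
  have h8 : 0 ≤ (C0 + C1) * (Yk k d.f + Lam k d.f) := by positivity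
  unfold N2 at *
  rw [hX]
  norm_num
  nlinarith

/-- viscosity coefficients -/
def vc (ν η : ℝ) : Fin 6 → ℝ := ![ν, ν, ν, η, η, η]

/-- current -/
def Jc (f : Fin 6 → Sch) : Sch := D 0 (f 4) - D 1 (f 3)
/-- Hall scalar -/
def Qc (f : Fin 6 → Sch) : Sch := f 3 * D 0 (f 5) + f 4 * D 1 (f 5)

/-- pressure and Hall terms -/
def ext (ε : ℝ) (f : Fin 6 → Sch) (p : Sch) : Fin 6 → Sch :=
  ![-D 0 p, -D 1 p, 0, -(ε • D 1 (Qc f)), ε • D 0 (Qc f), -(ε • (D 0 (f 3 * Jc f) + D 1 (f 4 * Jc f)))]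

/-- transport terms -/
def tra (f : Fin 6 → Sch) (c : Fin 6) : Sch :=
  -(f 0 * D 0 (f c) + f 1 * D 1 (f c)) + (f 3 * D 0 (f (c + 3)) + f 4 * D 1 (f (c + 3)))

/-- right-hand side of the evolution -/
def rhs (ν η ε : ℝ) (f : Fin 6 → Sch) (p : Sch) (c : Fin 6) : Sch :=
  vc ν η c • (D 0 (D 0 (f c)) + D 1 (D 1 (f c))) + tra f c + ext ε f p c

lemma ctrl_tra {k : ℕ} (hk : 2 ≤ k) (w : List (Fin 2)) (hw : w.length = k) (c : Fin 6) :
    Ctrl k (fun d => I ((d.φ * d.φ) * (dw w (d.f c) * dw w (tra d.f c)))) := by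
  have h := ((ctrl_mhd hk w hw 0 c c 0).add (ctrl_mhd hk w hw 1 c c 1)).neg.add
    ((ctrl_mhd hk w hw 3 (c + 3) c 0).add (ctrl_mhd hk w hw 4 (c + 3) c 1))
  refine h.congr fun d _ => ?_
  simp only [tra, map_add, map_neg, mul_add, mul_neg]

lemma ctrl_visc {k : ℕ} (w : List (Fin 2)) (hw : w.length = k) (c : Fin 6) (a : ℝ) :
    Ctrl k (fun d => I ((d.φ * d.φ) * (dw w (d.f c) * dw w (a • (D 0 (D 0 (d.f c)) + D 1 (D 1 (d.f c))))))
      + a * (N2 (d.φ * dw (0 :: w) (d.f c)) + N2 (d.φ * dw (1 :: w) (d.f c)))) := by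
  have h := ((ctrl_visc_err w hw c 0 0).add (ctrl_visc_err w hw c 1 1)).smul (-(2 * a))
  refine h.congr fun d _ => ?_
  have key : ∀ i, I ((d.φ * d.φ) * (dw w (d.f c) * D i (D i (dw w (d.f c))))) =
      - N2 (d.φ * D i (dw w (d.f c))) - 2 * I ((d.φ * D i d.φ) * (dw w (d.f c) * D i (dw w (d.f c)))) := by
    intro i
    set g := dw w (d.f c)
    have e1 : (d.φ * d.φ) * (g * D i (D i g)) = D i (D i g) * (d.φ * d.φ * g) := by
      apply Sch.ext'; intro x; simp; ring
    rw [e1, I_ibp, ← map_neg]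
    have e2 : - (D i g * D i (d.φ * d.φ * g)) = -((d.φ * D i g) * (d.φ * D i g))
        - (2 : ℝ) • ((d.φ * D i d.φ) * (g * D i g)) := by
      rw [D_mul, D_mul]; apply Sch.ext'; intro x; simp; ring
    rw [e2, map_sub, map_neg, map_smul]; rfl
  have e3 : (d.φ * d.φ) * (dw w (d.f c) * dw w (a • (D 0 (D 0 (d.f c)) + D 1 (D 1 (d.f c))))) =
      a • ((d.φ * d.φ) * (dw w (d.f c) * D 0 (D 0 (dw w (d.f c)))))
      + a • ((d.φ * d.φ) * (dw w (d.f c) * D 1 (D 1 (dw w (d.f c))))) := by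
    rw [map_smul, map_add, dw_D, dw_D, dw_D, dw_D]
    apply Sch.ext'; intro x; simp; ring
  rw [e3, map_add, map_smul, map_smul, key, key, dw_cons, dw_cons]
  simp only [smul_eq_mul]; ring

lemma ctrl_ext_p {k : ℕ} (hk : 1 ≤ k) (w : List (Fin 2)) (hw : w.length = k) :
    Ctrl k (fun d => I ((d.φ * d.φ) * (dw w (d.f 0) * dw w (-D 0 d.p))) +
      I ((d.φ * d.φ) * (dw w (d.f 1) * dw w (-D 1 d.p)))) := by
  have h := ((ctrl_press hk w hw 0 0).add (ctrl_press hk w hw 1 1)).smul 2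
  refine h.congr fun d hd => ?_
  rw [map_neg, map_neg, dw_D, dw_D]
  have key : ∀ i c, I ((d.φ * d.φ) * (dw w (d.f c) * -(D i (dw w d.p)))) =
      2 * I ((d.φ * D i d.φ) * (dw w (d.f c) * dw w d.p)) + I ((d.φ * d.φ) * (D i (dw w (d.f c)) * dw w d.p)) := by
    intro i c
    set g := dw w (d.f c)
    set q := dw w d.p
    have e1 : (d.φ * d.φ) * (g * -(D i q)) = -(D i q * (d.φ * d.φ * g)) := by
      apply Sch.ext'; intro x; simp; ring
    rw [e1, map_neg, I_ibp, neg_neg, D_mul, D_mul]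
    have e2 : q * ((D i d.φ * d.φ + d.φ * D i d.φ) * g + d.φ * d.φ * D i g) =
       (2 : ℝ) • ((d.φ * D i d.φ) * (g * q)) + (d.φ * d.φ) * (D i g * q) := by
      apply Sch.ext'; intro x; simp; ring
    rw [e2, map_add, map_smul]; rfl
  rw [key, key]
  have hz : I ((d.φ * d.φ) * (D 0 (dw w (d.f 0)) * dw w d.p)) + I ((d.φ * d.φ) * (D 1 (dw w (d.f 1)) * dw w d.p)) = 0 := by
    rw [← map_add, ← mul_add, ← add_mul]
    have := congrArg (dw w) hd.du
    rw [map_add, dw_D, dw_D, map_zero] at this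
    rw [this]; simp
  linarith

/-- full Hall contribution for one word -/
def hallw (w : List (Fin 2)) (d : Dat) : ℝ :=
  I ((d.φ * d.φ) * (dw w (d.f 3) * dw w (D 1 (Qc d.f)))) -
  I ((d.φ * d.φ) * (dw w (d.f 4) * dw w (D 0 (Qc d.f)))) +
  I ((d.φ * d.φ) * (dw w (d.f 5) * dw w (D 0 (d.f 3 * Jc d.f) + D 1 (d.f 4 * Jc d.f))))

lemma ibp_w (φ g q : Sch) (i : Fin 2) :
    I ((φ * φ) * (g * D i q)) = - I ((φ * φ) * (D i g * q)) - 2 * I ((φ * D i φ) * (g * q)) := by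
  have e1 : (φ * φ) * (g * (D i q)) = (D i q * (φ * φ * g)) := by
    apply Sch.ext'; intro x; simp; ring
  rw [e1, I_ibp, D_mul, D_mul]
  have e2 : q * ((D i φ * φ + φ * D i φ) * g + φ * φ * D i g) =
       (2 : ℝ) • ((φ * D i φ) * (g * q)) + (φ * φ) * (D i g * q) := by
    apply Sch.ext'; intro x; simp; ring
  rw [e2, map_add, map_smul, smul_eq_mul]; ring

lemma R1_sub (w : List (Fin 2)) (f g h : Sch) : R1 w f (g - h) = R1 w f g - R1 w f h := by
  have h1 := leib1 w f (g - h)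
  have h2 := leib1 w f g
  have h3 := leib1 w f h
  rw [mul_sub, map_sub, h2, h3, map_sub, mul_sub] at h1
  have : R1 w f (g - h) = (f * (dw w) g - f * (dw w) h + R1 w f (g - h)) - (f * (dw w) g - f * (dw w) h) := by abel
  rw [this, ← h1]; abel

lemma ctrl_hallw {k : ℕ} (hk : 2 ≤ k) (w : List (Fin 2)) (hw : w.length = k) :
    Ctrl k (hallw w) := by
  -- commutator terms: R1(b_i, D_i h) * D_w J  and R1(b_i, J) * D_i D_w h
  have A := (((ctrl_hall hk w hw 3 5 4 0 0).sub (ctrl_hall hk w hw 3 5 3 0 1)).add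
    ((ctrl_hall hk w hw 4 5 4 1 0).sub (ctrl_hall hk w hw 4 5 3 1 1)))
  have B := (((ctrl_hall hk w hw 3 4 5 0 0).sub (ctrl_hall hk w hw 3 3 5 1 0)).add
    ((ctrl_hall hk w hw 4 4 5 0 1).sub (ctrl_hall hk w hw 4 3 5 1 1)))
  have E1 := ((ctrl_hall_err hk w hw 3 5 4 0 0).add (ctrl_hall_err hk w hw 4 5 4 1 0)).sub
    ((ctrl_hall_err hk w hw 3 5 3 0 1).add (ctrl_hall_err hk w hw 4 5 3 1 1))
  have E2 := ((ctrl_hall_err hk w hw 3 4 5 0 0).sub (ctrl_hall_err hk w hw 3 3 5 1 0)).add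
    ((ctrl_hall_err hk w hw 4 4 5 0 1).sub (ctrl_hall_err hk w hw 4 3 5 1 1))
  refine ((A.sub B).add ((E1.sub E2).smul 2)).congr fun d hd => ?_
  unfold hallw
  rw [map_add, dw_D, dw_D, dw_D, dw_D, mul_add, mul_add, map_add, ibp_w, ibp_w, ibp_w, ibp_w]
  have eQ : dw w (Qc d.f) = dw w (d.f 3 * D 0 (d.f 5)) + dw w (d.f 4 * D 1 (d.f 5)) := by
    rw [Qc, map_add]
  have eJ : ∀ c, dw w (d.f c * Jc d.f) = dw w (d.f c * D 0 (d.f 4)) - dw w (d.f c * D 1 (d.f 3)) := by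
    intro c; rw [Jc, mul_sub, map_sub]
  rw [eQ, eJ, eJ]
  have hadd : ∀ a b, I a + I b = I (a + b) := fun a b => (map_add I a b).symm
  have hsub : ∀ a b, I a - I b = I (a - b) := fun a b => (map_sub I a b).symm
  have hneg : ∀ a, - I a = I (- a) := fun a => (map_neg I a).symm
  have hmul : ∀ (c : ℝ) a, c * I a = I (c • a) := fun c a => (map_smul I c a).symm
  simp only [hadd, hsub, hneg, hmul]
  simp only [leib1 w _ (D _ _), dw_D]
  congr 1
  apply Sch.ext'; intro x; simp; ring

lemma level_k (ν η ε : ℝ) (hν : 0 < ν) (hη : 0 < η) {k : ℕ} (hk : 2 ≤ k) :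
    ∃ C : ℝ, 0 ≤ C ∧ ∀ d, Adm d →
      ∑ c, ∑ w ∈ words k, I ((d.φ * d.φ) * (dw w (d.f c) * dw w (rhs ν η ε d.f d.p c)))
        + (min ν η / 2) * yk (k + 1) d ≤ C * Xk k d := by
  have hμ : 0 < min ν η := lt_min hν hη
  have key : ∀ w ∈ words k, Ctrl k (fun d =>
      ∑ c, I ((d.φ * d.φ) * (dw w (d.f c) * dw w (rhs ν η ε d.f d.p c)))
      + ∑ c, vc ν η c * (N2 (d.φ * dw (0 :: w) (d.f c)) + N2 (d.φ * dw (1 :: w) (d.f c)))) := by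
    intro w hw
    rw [mem_words] at hw
    have h1 := Ctrl.sum (k := k) Finset.univ (fun c _ => ctrl_visc w hw c (vc ν η c))
    have h2 := Ctrl.sum (k := k) Finset.univ (fun c _ => ctrl_tra hk w hw c)
    have h3 := ctrl_ext_p (by omega) w hw
    have h4 := (ctrl_hallw hk w hw).smul (-ε)
    refine (((h1.add h2).add h3).add h4).congr fun d hd => ?_
    simp only [rhs, map_add, mul_add, Finset.sum_add_distrib]
    have e : ∑ c, I ((d.φ * d.φ) * (dw w (d.f c) * dw w (ext ε d.f d.p c)))
       = I ((d.φ * d.φ) * (dw w (d.f 0) * dw w (-D 0 d.p))) +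
      I ((d.φ * d.φ) * (dw w (d.f 1) * dw w (-D 1 d.p))) + -ε * hallw w d := by
      rw [Fin.sum_univ_six]
      simp only [ext, hallw, map_neg, map_smul, map_add, mul_neg, mul_smul_comm, mul_add, smul_eq_mul,
        Matrix.cons_val, Matrix.cons_val_zero, Matrix.cons_val_one, map_zero, mul_zero]
      ring
    rw [e]; ring
  have key2 := Ctrl.sum (words k) key
  obtain ⟨C, hC, h⟩ := key2 (min ν η / 2) (by positivity)
  refine ⟨C, hC, fun d hd => ?_⟩
  have h1 := (le_abs_self _).trans (h d hd)
  beta_reduce at h1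
  rw [Finset.sum_add_distrib, Finset.sum_comm] at h1
  have h2 : min ν η * yk (k + 1) d ≤ ∑ w ∈ words k, ∑ c, vc ν η c *
      (N2 (d.φ * dw (0 :: w) (d.f c)) + N2 (d.φ * dw (1 :: w) (d.f c))) := by
    unfold yk
    rw [Finset.sum_comm (s := words k), Finset.mul_sum]
    apply Finset.sum_le_sum
    intro c _
    rw [sum_words_succ, Finset.mul_sum]
    apply Finset.sum_le_sum
    intro w _
    have := N2_nonneg (d.φ * dw (0 :: w) (d.f c)); have := N2_nonneg (d.φ * dw (1 :: w) (d.f c))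
    have : min ν η ≤ vc ν η c := by fin_cases c <;> simp [vc]
    gcongr
  linarith

end HMHD
end


open MeasureTheory
open scoped ENNReal

noncomputable section
namespace HMHD

/-- divergence-free data with pressure equation -/
structure Inc (f : Fin 6 → Sch) : Prop where
  du : D 0 (f 0) + D 1 (f 1) = 0
  db : D 0 (f 3) + D 1 (f 4) = 0

lemma flux {a0 a1 : Sch} (h : D 0 a0 + D 1 a1 = 0) (g : Sch) : I (a0 * D 0 g) + I (a1 * D 1 g) = 0 := by
  have h0 := I_ibp 0 a0 g
  have h1 := I_ibp 1 a1 g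
  have : I (D 0 a0 * g) + I (D 1 a1 * g) = 0 := by
    rw [← map_add, ← add_mul, h]; simp
  linarith

lemma level0 (ν η ε : ℝ) (f : Fin 6 → Sch) (p : Sch) (hf : Inc f) :
    ∑ c, I (f c * rhs ν η ε f p c) = - ∑ c, vc ν η c * G2 (f c) := by
  have hv : ∀ c, I (f c * (D 0 (D 0 (f c)) + D 1 (D 1 (f c)))) = - G2 (f c) := by
    intro c
    have h0 := I_ibp 0 (D 0 (f c)) (f c)
    have h1 := I_ibp 1 (D 1 (f c)) (f c)
    rw [mul_comm, add_mul, map_add, h0, h1]; unfold G2 N2; ring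
  have ht : ∑ c, I (f c * tra f c) = 0 := by
    have hu : ∀ c, I (f c * (f 0 * D 0 (f c))) + I (f c * (f 1 * D 1 (f c))) = 0 := by
      intro c
      have := flux hf.du (f c * f c)
      have e : ∀ i (a : Sch), a * D i (f c * f c) = (2 : ℝ) • (f c * (a * D i (f c))) := by
        intro i a; rw [D_mul]; apply Sch.ext'; intro x; simp; ring
      rw [e, e, map_smul, map_smul, smul_eq_mul, smul_eq_mul] at this
      linarith
    have hb : ∀ c e : Fin 6, I (f c * (f 3 * D 0 (f e))) + I (f c * (f 4 * D 1 (f e)))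
        + I (f e * (f 3 * D 0 (f c))) + I (f e * (f 4 * D 1 (f c))) = 0 := by
      intro c e
      have := flux hf.db (f c * f e)
      have e : ∀ i (a : Sch), a * D i (f c * f e) = (f c * (a * D i (f e))) + (f e * (a * D i (f c))) := by
        intro i a; rw [D_mul]; apply Sch.ext'; intro x; simp; ring
      rw [e, e, map_add, map_add] at this
      linarith
    have e : ∀ c, I (f c * tra f c) = I (f c * (f 3 * D 0 (f (c + 3)))) + I (f c * (f 4 * D 1 (f (c + 3)))) := by
      intro c
      have := hu c
      simp only [tra, mul_add, mul_neg, map_add, map_neg]; linarith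
    simp only [e]
    rw [Fin.sum_univ_six]
    have h0 := hb 0 3; have h1 := hb 1 4; have h2 := hb 2 5
    simp only [Fin.reduceAdd] at *
    have a1 : (0 : Fin 6) + 3 = 3 := rfl
    linarith
  have hx : ∑ c, I (f c * ext ε f p c) = 0 := by
    rw [Fin.sum_univ_six]
    have hp := flux hf.du p
    have q1 := I_ibp 1 (Qc f) (f 3)
    have q0 := I_ibp 0 (Qc f) (f 4)
    have r0 := I_ibp 0 (f 3 * Jc f) (f 5)
    have r1 := I_ibp 1 (f 4 * Jc f) (f 5)
    have z : I (Qc f * D 0 (f 4)) - I (Qc f * D 1 (f 3)) - I (f 3 * Jc f * D 0 (f 5)) - I (f 4 * Jc f * D 1 (f 5)) = 0 := by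
      rw [← map_sub, ← map_sub, ← map_sub]
      have : Qc f * D 0 (f 4) - Qc f * D 1 (f 3) - (f 3 * Jc f * D 0 (f 5)) - f 4 * Jc f * D 1 (f 5) = 0 := by
        unfold Qc Jc; apply Sch.ext'; intro x; simp; ring
      rw [this, map_zero]
    simp only [ext, map_neg, map_smul, map_add, mul_neg, mul_smul_comm, mul_add, smul_eq_mul,
        Matrix.cons_val, Matrix.cons_val_zero, Matrix.cons_val_one, map_zero, mul_zero]
    rw [mul_comm (f 3) (D 1 _), mul_comm (f 4) (D 0 _), mul_comm (f 5), mul_comm (f 5), q1, q0, r0, r1]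
    linear_combination (-1 : ℝ) * hp - ε * z
  simp only [rhs, mul_add, map_add, Finset.sum_add_distrib, ht, hx, mul_smul_comm, map_smul, add_zero]
  rw [← Finset.sum_neg_distrib]
  apply Finset.sum_congr rfl
  intro c _
  have := hv c
  rw [mul_add, map_add] at this
  simp only [smul_eq_mul]
  linear_combination (vc ν η c) * this

/-- laplacian -/
def Lp (f : Sch) : Sch := D 0 (D 0 f) + D 1 (D 1 f)

lemma N2_lap (f : Sch) : N2 (Lp f) = G2 (D 0 f) + G2 (D 1 f) := by
  have h1 : I (D 0 (D 0 f) * D 1 (D 1 f)) = N2 (D 1 (D 0 f)) := by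
    have a := I_ibp 0 (D 0 f) (D 1 (D 1 f))
    have b := I_ibp 1 (D 0 (D 1 f)) (D 0 f)
    rw [a, D_comm 0 1 (D 1 f), mul_comm, b, neg_neg, D_comm 0 1 f]; rfl
  have e : Lp f * Lp f = D 0 (D 0 f) * D 0 (D 0 f) + D 1 (D 1 f) * D 1 (D 1 f)
     + (2 : ℝ) • (D 0 (D 0 f) * D 1 (D 1 f)) := by
    unfold Lp; apply Sch.ext'; intro x; simp; ring
  unfold G2
  rw [N2, e, map_add, map_add, map_smul, h1, D_comm 0 1 f]
  simp only [N2, smul_eq_mul]; ring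

lemma Yk1 (f : Fin 6 → Sch) : Yk 1 f = ∑ c, G2 (f c) := by
  unfold Yk; apply Finset.sum_congr rfl; intro c _
  rw [sum_words_succ]; simp [words, dw, G2]

lemma Yk2 (f : Fin 6 → Sch) : Yk 2 f = ∑ c, N2 (Lp (f c)) := by
  unfold Yk; apply Finset.sum_congr rfl; intro c _
  rw [N2_lap, sum_words_succ, Finset.sum_add_distrib, sum_words_succ, sum_words_succ]
  simp [words, dw, G2]; ring

lemma Yk0 (f : Fin 6 → Sch) : Yk 0 f = ∑ c, N2 (f c) := by
  unfold Yk; simp [words, dw]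

/-- the controlling factor at level one -/
def Z1 (p : ℝ≥0∞) (r : ℝ) (f : Fin 6 → Sch) : ℝ :=
  (1 + Lam 1 f + (eLpNorm (Jc f : E2 → ℝ) p volume).toReal ^ r) * Yk 1 f

lemma Z1_nonneg (p r f) : 0 ≤ Z1 p r f := by
  have := Lam_nonneg 1 f; have := Yk_nonneg 1 f
  unfold Z1; positivity

/-- control at level one -/
def Ct (p : ℝ≥0∞) (r : ℝ) (F : (Fin 6 → Sch) → ℝ) : Prop :=
  ∀ δ > 0, ∃ C : ℝ, 0 ≤ C ∧ ∀ f, Inc f → |F f| ≤ δ * Yk 2 f + C * Z1 p r f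

variable {p : ℝ≥0∞} {r : ℝ}

lemma Ct.zero : Ct p r (fun _ => 0) := fun δ hδ => ⟨0, le_rfl, fun f _ => by
  have := Yk_nonneg 2 f
  simp; positivity⟩

lemma Ct.add {F G} (hF : Ct p r F) (hG : Ct p r G) : Ct p r (fun d => F d + G d) := by
  intro δ hδ
  obtain ⟨C1, h1, k1⟩ := hF (δ / 2) (by positivity)
  obtain ⟨C2, h2, k2⟩ := hG (δ / 2) (by positivity)
  refine ⟨C1 + C2, by positivity, fun d hd => ?_⟩
  have a := k1 d hd; have b := k2 d hd
  have := abs_add_le (F d) (G d)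
  linarith

lemma Ct.smul {F} (hF : Ct p r F) (a : ℝ) : Ct p r (fun d => a * F d) := by
  intro δ hδ
  obtain ⟨C1, h1, k1⟩ := hF (δ / (|a| + 1)) (by positivity)
  refine ⟨(|a| + 1) * C1, by positivity, fun d hd => ?_⟩
  have h := k1 d hd
  have hX := Z1_nonneg p r d
  rw [abs_mul]
  calc |a| * |F d| ≤ (|a| + 1) * |F d| := by gcongr; linarith
    _ ≤ (|a| + 1) * (δ / (|a| + 1) * Yk 2 d + C1 * Z1 p r d) := by gcongr
    _ = _ := by field_simp

lemma Ct.congr {F G} (hF : Ct p r F) (h : ∀ d, Inc d → G d = F d) : Ct p r G := by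
  intro δ hδ
  obtain ⟨C1, h1, k1⟩ := hF δ hδ
  exact ⟨C1, h1, fun d hd => by rw [h d hd]; exact k1 d hd⟩

lemma Ct.sum {ι : Type} (s : Finset ι) {F : ι → (Fin 6 → Sch) → ℝ} (h : ∀ i ∈ s, Ct p r (F i)) :
    Ct p r (fun d => ∑ i ∈ s, F i d) := by
  classical
  induction s using Finset.induction_on with
  | empty => simpa using Ct.zero
  | insert a s ha ih =>
    simp only [Finset.sum_insert ha]
    exact (h a (by simp)).add (ih fun i hi => h i (by simp [hi]))

lemma ct_young (a : (Fin 6 → Sch) → Sch) (ha : Ct p r (fun f => N2 (a f))) (i j : Fin 2) (q : Fin 6) :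
    Ct p r (fun f => I (a f * D i (D j (f q)))) := by
  intro δ hδ
  obtain ⟨C, hC, h⟩ := ha (δ ^ 2) (by positivity)
  refine ⟨(2 * δ)⁻¹ * C, by positivity, fun f hf => ?_⟩
  have h1 := (I_young (a f) (D i (D j (f q))) (δ := (2 * δ)⁻¹) (by positivity))
  have h2 := (le_abs_self _).trans (h f hf)
  have h3 := le_Yk (w := [i, j]) (k := 2) rfl f q
  have e : (4 * (2 * δ)⁻¹)⁻¹ = δ / 2 := by field_simp; norm_num
  rw [e] at h1
  change N2 (D i (D j (f q))) ≤ _ at h3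
  unfold N2 at *
  calc _ ≤ _ := h1
    _ ≤ (2 * δ)⁻¹ * (δ ^ 2 * Yk 2 f + C * Z1 p r f) + δ / 2 * Yk 2 f := by gcongr
    _ = _ := by field_simp; ring

lemma ct_fD (a b : Fin 6) (i : Fin 2) : Ct p r (fun f => N2 (f a * D i (f b))) := by
  intro δ hδ
  refine ⟨4 / δ, by positivity, fun f hf => ?_⟩
  beta_reduce
  rw [abs_of_nonneg (N2_nonneg _)]
  have h1 := N2_mul_le (f a) (D i (f b))
  have h2 := lady (D i (f b))
  have h3 := le_Lam (w := []) (k := 1) (by simp) f a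
  have h4 := le_Yk (w := [i]) (k := 1) rfl f b
  have h5 := le_Yk (w := [0, i]) (k := 2) rfl f b
  have h6 := le_Yk (w := [1, i]) (k := 2) rfl f b
  have hL := Lam_nonneg 1 f; have hY1 := Yk_nonneg 1 f; have hY2 := Yk_nonneg 2 f
  change N4 (f a) ≤ _ at h3
  change N2 (D i (f b)) ≤ _ at h4
  change N2 (D 0 (D i (f b))) ≤ _ at h5
  change N2 (D 1 (D i (f b))) ≤ _ at h6
  have hG : G2 (D i (f b)) ≤ 2 * Yk 2 f := by unfold G2; linarith
  have hG0 := G2_nonneg (D i (f b))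
  have h7 : N2 (f a * D i (f b)) ^ 2 ≤ Lam 1 f * (8 * (Yk 1 f * (2 * Yk 2 f))) := by
    refine h1.trans ?_
    gcongr
    · exact N4_nonneg _
    · refine h2.trans ?_
      gcongr
  have h8 := le_of_sq_le (N := N2 (f a * D i (f b))) (a := δ * Yk 2 f) (b := 4 / δ * (Lam 1 f * Yk 1 f))
    (by positivity) (by positivity) (h7.trans (le_of_eq (by field_simp; ring)))
  have h9 : Lam 1 f * Yk 1 f ≤ Z1 p r f := by
    unfold Z1
    have : 0 ≤ (eLpNorm (Jc f : E2 → ℝ) p volume).toReal ^ r := by positivity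
    nlinarith
  refine h8.trans ?_
  gcongr

lemma ct_J (hp : 2 < p) (hr : 2 ≤ r) (hpr : 2 / p + 2 / ENNReal.ofReal r ≤ 1) (b : Fin 6) (i : Fin 2) :
    Ct p r (fun f => N2 (Jc f * D i (f b))) := by
  intro δ hδ
  obtain ⟨C, hC, h⟩ := gn_crit p r hp hr hpr (δ / 2) (by positivity)
  refine ⟨C, hC, fun f hf => ?_⟩
  beta_reduce
  rw [abs_of_nonneg (N2_nonneg _)]
  have h1 := h (Jc f) (D i (f b))
  have h4 := le_Yk (w := [i]) (k := 1) rfl f b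
  have h5 := le_Yk (w := [0, i]) (k := 2) rfl f b
  have h6 := le_Yk (w := [1, i]) (k := 2) rfl f b
  have hL := Lam_nonneg 1 f; have hY1 := Yk_nonneg 1 f; have hY2 := Yk_nonneg 2 f
  change N2 (D i (f b)) ≤ _ at h4
  change N2 (D 0 (D i (f b))) ≤ _ at h5
  change N2 (D 1 (D i (f b))) ≤ _ at h6
  have hG : G2 (D i (f b)) ≤ 2 * Yk 2 f := by unfold G2; linarith
  set M := (eLpNorm (Jc f : E2 → ℝ) p volume).toReal ^ r with hM
  have hM0 : 0 ≤ M := by positivity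
  calc _ ≤ _ := h1
    _ ≤ δ / 2 * (2 * Yk 2 f) + C * (1 + M) * Yk 1 f := by gcongr
    _ ≤ δ / 2 * (2 * Yk 2 f) + C * (1 + Lam 1 f + M) * Yk 1 f := by gcongr; linarith
    _ = _ := by unfold Z1; ring

lemma level1 (ν η ε : ℝ) (hν : 0 < ν) (hη : 0 < η) (p : ℝ≥0∞) (r : ℝ)
    (hp : 2 < p) (hr : 2 ≤ r) (hpr : 2 / p + 2 / ENNReal.ofReal r ≤ 1) :
    ∃ C : ℝ, 0 ≤ C ∧ ∀ f q, Inc f →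
      - ∑ c, I (Lp (f c) * rhs ν η ε f q c) + (min ν η / 2) * Yk 2 f ≤ C * Z1 p r f := by
  have hμ : 0 < min ν η := lt_min hν hη
  have T1 : ∀ (c a b : Fin 6) (i : Fin 2), Ct p r (fun f => I (Lp (f c) * (f a * D i (f b)))) := by
    intro c a b i
    refine ((ct_young _ (ct_fD a b i) 0 0 c).add (ct_young _ (ct_fD a b i) 1 1 c)).congr fun f _ => ?_
    rw [← map_add, Lp, add_mul, mul_comm (f a * _), mul_comm (f a * _)]
  have T2 : Ct p r (fun f => ∑ c, I (Lp (f c) * tra f c)) := by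
    apply Ct.sum
    intro c _
    refine ((((T1 c 0 c 0).add (T1 c 1 c 1)).smul (-1)).add ((T1 c 3 (c + 3) 0).add (T1 c 4 (c + 3) 1))).congr fun f _ => ?_
    simp only [tra, mul_add, mul_neg, map_add, map_neg]; ring
  have H1 : ∀ (b c : Fin 6) (i k l : Fin 2), Ct p r (fun f => I ((Jc f * D i (f b)) * D k (D l (f c)))) :=
    fun b c i k l => ct_young _ (ct_J hp hr hpr b i) k l c
  have H2 : Ct p r (fun f => I (Lp (f 3) * D 1 (Qc f)) - I (Lp (f 4) * D 0 (Qc f)) +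
      I (Lp (f 5) * (D 0 (f 3 * Jc f) + D 1 (f 4 * Jc f)))) := by
    have S1 := ((H1 5 3 0 0 0).add (H1 5 3 0 1 1)).add ((H1 5 4 1 0 0).add (H1 5 4 1 1 1))
    have S2 := ((H1 3 5 0 0 0).add (H1 3 5 1 1 0)).add ((H1 4 5 0 0 1).add (H1 4 5 1 1 1))
    refine (S1.add (S2.smul 2)).congr fun f hf => ?_
    have d3 : Lp (f 3) = - D 1 (Jc f) := by
      have := congrArg (D 0) hf.db
      rw [map_add, map_zero] at this
      unfold Lp Jc
      rw [map_sub, D_comm 1 0]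
      have e : D 0 (D 0 (f 3)) = - D 0 (D 1 (f 4)) := eq_neg_of_add_eq_zero_left this
      rw [e]; abel
    have d4 : Lp (f 4) = D 0 (Jc f) := by
      have := congrArg (D 1) hf.db
      rw [map_add, map_zero] at this
      unfold Lp Jc
      rw [map_sub, D_comm 0 1 (f 3)]
      have e : D 1 (D 1 (f 4)) = - D 1 (D 0 (f 3)) := eq_neg_of_add_eq_zero_right this
      rw [e]; abel
    have i1 : I (Lp (f 3) * D 1 (Qc f)) = I (Jc f * D 1 (D 1 (Qc f))) := by
      rw [d3, neg_mul, map_neg, I_ibp, neg_neg]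
    have i0 : I (Lp (f 4) * D 0 (Qc f)) = - I (Jc f * D 0 (D 0 (Qc f))) := by
      rw [d4, I_ibp]
    have i2 : I (Lp (f 5) * (D 0 (f 3 * Jc f) + D 1 (f 4 * Jc f))) =
        - I (f 3 * Jc f * D 0 (Lp (f 5))) - I (f 4 * Jc f * D 1 (Lp (f 5))) := by
      rw [mul_add, map_add, mul_comm (Lp (f 5)), mul_comm (Lp (f 5)), I_ibp 0 (f 3 * Jc f), I_ibp 1 (f 4 * Jc f)]; ring
    rw [i1, i0, i2]
    have hadd : ∀ a b, I a + I b = I (a + b) := fun a b => (map_add I a b).symm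
    have hsub : ∀ a b, I a - I b = I (a - b) := fun a b => (map_sub I a b).symm
    have hneg : ∀ a, - I a = I (- a) := fun a => (map_neg I a).symm
    have hmul : ∀ (c : ℝ) a, c * I a = I (c • a) := fun c a => (map_smul I c a).symm
    simp only [hadd, hsub, hneg, hmul]
    congr 1
    have eQ : ∀ i, D i (D i (Qc f)) = D i (D i (f 3)) * D 0 (f 5) + (2 : ℝ) • (D i (f 3) * D i (D 0 (f 5)))
        + f 3 * D 0 (D i (D i (f 5))) + (D i (D i (f 4)) * D 1 (f 5) + (2 : ℝ) • (D i (f 4) * D i (D 1 (f 5)))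
        + f 4 * D 1 (D i (D i (f 5)))) := by
      intro i
      simp only [Qc, map_add, D_mul]
      rw [D_comm 0 i (D i (f 5)), D_comm 0 i (f 5), D_comm 1 i (D i (f 5)), D_comm 1 i (f 5)]
      apply Sch.ext'; intro x; simp; ring
    rw [eQ, eQ]
    simp only [Lp, map_add]
    apply Sch.ext'; intro x; simp; ring
  have all := (T2.smul (-1)).add (H2.smul ε)
  obtain ⟨C, hC, h⟩ := all (min ν η / 2) (by positivity)
  refine ⟨C, hC, fun f q hf => ?_⟩
  have h1 := (le_abs_self _).trans (h f hf)
  beta_reduce at h1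
  have hP : I (Lp (f 0) * D 0 q) + I (Lp (f 1) * D 1 q) = 0 := by
    apply flux
    have a0 := congrArg (fun g => D 0 (D 0 g)) hf.du
    have a1 := congrArg (fun g => D 1 (D 1 g)) hf.du
    simp only [map_add, map_zero] at a0 a1
    simp only [Lp, map_add]
    rw [D_comm 0 1 (D 1 (f 0)), D_comm 0 1 (f 0), D_comm 1 0 (D 0 (f 1)), D_comm 1 0 (f 1)]
    calc _ = (D 0 (D 0 (D 0 (f 0))) + D 0 (D 0 (D 1 (f 1)))) + (D 1 (D 1 (D 0 (f 0))) + D 1 (D 1 (D 1 (f 1)))) := by abel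
      _ = 0 := by rw [a0, a1, add_zero]
  have hx : ∑ c, I (Lp (f c) * ext ε f q c) = -(ε * (I (Lp (f 3) * D 1 (Qc f)) - I (Lp (f 4) * D 0 (Qc f)) +
      I (Lp (f 5) * (D 0 (f 3 * Jc f) + D 1 (f 4 * Jc f))))) := by
    rw [Fin.sum_univ_six]
    simp only [ext, map_neg, map_smul, map_add, mul_neg, mul_smul_comm, mul_add, smul_eq_mul,
        Matrix.cons_val, Matrix.cons_val_zero, Matrix.cons_val_one, map_zero, mul_zero]
    linear_combination (-1 : ℝ) * hP
  have hs : ∑ c, I (Lp (f c) * rhs ν η ε f q c) = ∑ c, vc ν η c * N2 (Lp (f c)) + ∑ c, I (Lp (f c) * tra f c)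
      + ∑ c, I (Lp (f c) * ext ε f q c) := by
    rw [← Finset.sum_add_distrib, ← Finset.sum_add_distrib]
    apply Finset.sum_congr rfl
    intro c _
    simp only [rhs, mul_add, map_add, mul_smul_comm, map_smul, smul_eq_mul]
    simp only [N2, Lp, mul_add, map_add]
  have hv : min ν η * Yk 2 f ≤ ∑ c, vc ν η c * N2 (Lp (f c)) := by
    rw [Yk2, Finset.mul_sum]
    apply Finset.sum_le_sum
    intro c _
    have := N2_nonneg (Lp (f c))
    have : min ν η ≤ vc ν η c := by fin_cases c <;> simp [vc]
    gcongr
  rw [hs, hx]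
  linarith

end HMHD
end


open MeasureTheory
open scoped ENNReal
noncomputable section
namespace HMHD
open Set

/-- space-time smoothness -/
def Sm (T : ℝ) (G : ℝ → Sch) : Prop :=
  ContDiffOn ℝ (⊤ : ℕ∞) (fun p : ℝ × E2 => (G p.1) p.2) (Ioo 0 T ×ˢ univ)

lemma dom_open (T : ℝ) : IsOpen (Ioo 0 T ×ˢ (univ : Set E2)) := isOpen_Ioo.prod isOpen_univ

lemma dom_mem {T t : ℝ} (ht : t ∈ Ioo 0 T) (x : E2) : (t, x) ∈ Ioo 0 T ×ˢ (univ : Set E2) := ⟨ht, mem_univ _⟩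

lemma Sm.at {T : ℝ} {G : ℝ → Sch} (h : Sm T G) {t : ℝ} (ht : t ∈ Ioo 0 T) (x : E2) :
    ContDiffAt ℝ (⊤ : ℕ∞) (fun p : ℝ × E2 => (G p.1) p.2) (t, x) :=
  h.contDiffAt ((dom_open T).mem_nhds (dom_mem ht x))

lemma Sm.fd {T : ℝ} {G : ℝ → Sch} (h : Sm T G) (v : ℝ × E2) :
    ContDiffOn ℝ (⊤ : ℕ∞) (fun p : ℝ × E2 => fderiv ℝ (fun p : ℝ × E2 => (G p.1) p.2) p v) (Ioo 0 T ×ˢ univ) := by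
  have := h.fderiv_of_isOpen (dom_open T) (m := ((⊤ : ℕ∞) : WithTop ℕ∞)) (by simp)
  exact this.clm_apply contDiffOn_const

lemma Sm.space {T : ℝ} {G : ℝ → Sch} (h : Sm T G) (i : Fin 2) {t : ℝ} (ht : t ∈ Ioo 0 T) (x : E2) :
    (D i (G t)) x = fderiv ℝ (fun p : ℝ × E2 => (G p.1) p.2) (t, x) (0, Pi.single i 1) := by
  have hd : HasFDerivAt (fun p : ℝ × E2 => (G p.1) p.2) _ (t, x) := ((h.at ht x).differentiableAt (by simp)).hasFDerivAt
  have h2 : HasFDerivAt (fun y : E2 => (t, y)) (ContinuousLinearMap.inr ℝ ℝ E2) x := hasFDerivAt_prodMk_right t x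
  have := hd.comp x h2
  rw [D_app, show (G t : E2 → ℝ) = (fun p : ℝ × E2 => (G p.1) p.2) ∘ (fun y : E2 => (t, y)) from rfl, this.fderiv]
  simp

lemma Sm.time {T : ℝ} {G : ℝ → Sch} (h : Sm T G) {t : ℝ} (ht : t ∈ Ioo 0 T) (x : E2) :
    HasDerivAt (fun s => (G s) x) (fderiv ℝ (fun p : ℝ × E2 => (G p.1) p.2) (t, x) (1, 0)) t := by
  have hd : HasFDerivAt (fun p : ℝ × E2 => (G p.1) p.2) _ (t, x) := ((h.at ht x).differentiableAt (by simp)).hasFDerivAt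
  have h2 : HasDerivAt (fun s : ℝ => (s, x)) ((1 : ℝ), (0 : E2)) t := (hasDerivAt_id t).prodMk (hasDerivAt_const t x)
  exact hd.comp_hasDerivAt t h2

lemma Sm.D {T : ℝ} {G : ℝ → Sch} (h : Sm T G) (i : Fin 2) : Sm T (fun t => D i (G t)) :=
  (h.fd (0, Pi.single i 1)).congr fun p hp => h.space i hp.1 p.2

lemma Sm.mul {T : ℝ} {G H : ℝ → Sch} (h : Sm T G) (h' : Sm T H) : Sm T (fun t => G t * H t) :=
  ContDiffOn.mul h h'

lemma Sm.const (T : ℝ) (g : Sch) : Sm T (fun _ => g) :=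
  (g.contDiff.comp contDiff_snd).contDiffOn

/-- time derivative -/
structure TD (T : ℝ) (G G' : ℝ → Sch) : Prop where
  sm : Sm T G
  hd : ∀ t ∈ Ioo 0 T, ∀ x, HasDerivAt (fun s => (G s) x) ((G' t) x) t

lemma TD.eq {T : ℝ} {G G' : ℝ → Sch} (h : TD T G G') {t : ℝ} (ht : t ∈ Ioo 0 T) (x : E2) :
    (G' t) x = fderiv ℝ (fun p : ℝ × E2 => (G p.1) p.2) (t, x) (1, 0) :=
  (h.hd t ht x).unique (h.sm.time ht x)

lemma TD.sm' {T : ℝ} {G G' : ℝ → Sch} (h : TD T G G') : Sm T G' :=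
  (h.sm.fd (1, 0)).congr fun p hp => h.eq hp.1 p.2

lemma mixed_aux1 {H : ℝ × E2 → ℝ} {t : ℝ} {x : E2} {L : ℝ × E2 →L[ℝ] ℝ × E2 →L[ℝ] ℝ}
    (hd2 : HasFDerivAt (fderiv ℝ H) L (t, x)) (e : E2) :
    fderiv ℝ (fun y => fderiv ℝ H (t, y) (1, 0)) x e = L (0, e) (1, 0) := by
  have h2 : HasFDerivAt (fun y : E2 => (t, y)) (ContinuousLinearMap.inr ℝ ℝ E2) x := hasFDerivAt_prodMk_right t x
  have h5 : HasFDerivAt (fun y : E2 => fderiv ℝ H (t, y)) (L.comp (ContinuousLinearMap.inr ℝ ℝ E2)) x := hd2.comp x h2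
  have h3 := h5.clm_apply (hasFDerivAt_const ((1 : ℝ), (0 : E2)) x)
  rw [h3.fderiv]; simp

lemma mixed_aux2 {H : ℝ × E2 → ℝ} {t : ℝ} {x : E2} {L : ℝ × E2 →L[ℝ] ℝ × E2 →L[ℝ] ℝ}
    (hd2 : HasFDerivAt (fderiv ℝ H) L (t, x)) (e : E2) :
    HasDerivAt (fun s => fderiv ℝ H (s, x) (0, e)) (L (1, 0) (0, e)) t := by
  have h2 : HasDerivAt (fun s : ℝ => (s, x)) ((1 : ℝ), (0 : E2)) t := (hasDerivAt_id t).prodMk (hasDerivAt_const t x)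
  have h5 : HasDerivAt (fun s : ℝ => fderiv ℝ H (s, x)) (L (1, 0)) t := hd2.comp_hasDerivAt t h2
  have h3 := h5.clm_apply (hasDerivAt_const t ((0 : ℝ), e))
  simpa using h3

lemma mixed {H : ℝ × E2 → ℝ} {t : ℝ} {x : E2} (hc : ContDiffAt ℝ 2 H (t, x)) (e : E2) :
    HasDerivAt (fun s => fderiv ℝ H (s, x) (0, e)) (fderiv ℝ (fun y => fderiv ℝ H (t, y) (1, 0)) x e) t := by
  have hsym : IsSymmSndFDerivAt ℝ H (t, x) := hc.isSymmSndFDerivAt (by simp)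
  have hd2 : HasFDerivAt (fderiv ℝ H) (fderiv ℝ (fderiv ℝ H) (t, x)) (t, x) :=
    ((hc.fderiv_right (m := 1) (by norm_num)).differentiableAt (by simp)).hasFDerivAt
  have h1 := mixed_aux1 hd2 e
  have h2 := mixed_aux2 hd2 e
  have h3 : fderiv ℝ (fderiv ℝ H) (t, x) (1, 0) (0, e) = fderiv ℝ (fderiv ℝ H) (t, x) (0, e) (1, 0) := hsym (1, 0) (0, e)
  rw [h1, ← h3]
  exact h2

lemma TD.D {T : ℝ} {G G' : ℝ → Sch} (h : TD T G G') (i : Fin 2) :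
    TD T (fun t => D i (G t)) (fun t => D i (G' t)) := by
  refine ⟨h.sm.D i, fun t ht x => ?_⟩
  have hc := mixed ((h.sm.at ht x).of_le (WithTop.coe_le_coe.2 (le_top : (2 : ℕ∞) ≤ ⊤))) (Pi.single i 1)
  have h4 : (fun s => (HMHD.D i (G s)) x) =ᶠ[nhds t]
      fun s => fderiv ℝ (fun p : ℝ × E2 => (G p.1) p.2) (s, x) (0, Pi.single i 1) := by
    filter_upwards [isOpen_Ioo.mem_nhds ht] with s hs
    exact h.sm.space i hs x
  have h5 : (G' t : E2 → ℝ) = fun y => fderiv ℝ (fun p : ℝ × E2 => (G p.1) p.2) (t, y) (1, 0) := by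
    funext y; exact h.eq ht y
  refine HasDerivAt.congr_of_eventuallyEq ?_ h4
  rw [D_app, h5]
  exact hc

lemma TD.dw {T : ℝ} {G G' : ℝ → Sch} (h : TD T G G') (w : List (Fin 2)) :
    TD T (fun t => dw w (G t)) (fun t => dw w (G' t)) := by
  induction w with
  | nil => exact h
  | cons i w ih => exact ih.D i

lemma TD.mul {T : ℝ} {G G' H H' : ℝ → Sch} (h : TD T G G') (h' : TD T H H') :
    TD T (fun t => G t * H t) (fun t => G' t * H t + G t * H' t) :=
  ⟨h.sm.mul h'.sm, fun t ht x => (h.hd t ht x).mul (h'.hd t ht x)⟩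

lemma Sm.contI {T : ℝ} {G : ℝ → Sch} (h : Sm T G) (φ : Sch) (hφ : HasCompactSupport (φ : E2 → ℝ)) :
    ContinuousOn (fun t => I (φ * G t)) (Ioo 0 T) := by
  have : ContinuousOn (fun p : ℝ × E2 => (φ * G p.1) p.2) (Ioo 0 T ×ˢ univ) :=
    ((Sm.const T φ).mul h).continuousOn
  exact continuousOn_integral_of_compact_support (k := tsupport (φ : E2 → ℝ)) hφ this (fun t x ht hx => by
    rw [mul_app, image_eq_zero_of_notMem_tsupport hx, zero_mul])

lemma TD.derI {T : ℝ} {G G' : ℝ → Sch} (h : TD T G G') (φ : Sch) (hφ : HasCompactSupport (φ : E2 → ℝ))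
    {t : ℝ} (ht : t ∈ Ioo 0 T) : HasDerivAt (fun t => I (φ * G t)) (I (φ * G' t)) t := by
  obtain ⟨δ, hδ, hb⟩ := Metric.nhds_basis_closedBall.mem_iff.1 (isOpen_Ioo.mem_nhds ht)
  have hK : IsCompact (Metric.closedBall t δ ×ˢ tsupport (φ : E2 → ℝ)) := (isCompact_closedBall t δ).prod hφ
  have hc : ContinuousOn (fun p : ℝ × E2 => (φ * G' p.1) p.2) (Metric.closedBall t δ ×ˢ tsupport (φ : E2 → ℝ)) :=
    (((Sm.const T φ).mul h.sm').continuousOn).mono (prod_mono hb (subset_univ _))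
  obtain ⟨C, hC⟩ := hK.exists_bound_of_continuousOn hc
  refine (hasDerivAt_integral_of_dominated_loc_of_deriv_le (F := fun s x => (φ * G s) x) (F' := fun s x => (φ * G' s) x)
    (s := Metric.closedBall t δ) (bound := (tsupport (φ : E2 → ℝ)).indicator fun _ => C)
    (Metric.closedBall_mem_nhds t hδ) ?_ (φ * G t).integrable (φ * G' t).cont.aestronglyMeasurable ?_ ?_ ?_).2
  · exact Filter.Eventually.of_forall fun s => (φ * G s).cont.aestronglyMeasurable
  · refine Filter.Eventually.of_forall fun x s hs => ?_
    by_cases hx : x ∈ tsupport (φ : E2 → ℝ)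
    · rw [indicator_of_mem hx]; exact hC (s, x) ⟨hs, hx⟩
    · rw [indicator_of_notMem hx, mul_app, image_eq_zero_of_notMem_tsupport hx]; simp
  · exact (integrable_indicator_iff (isClosed_tsupport _).measurableSet).2
      (integrableOn_const (hφ.measure_lt_top.ne))
  · refine Filter.Eventually.of_forall fun x s hs => ?_
    simp only [mul_app]
    exact (h.hd s (hb hs) x).const_mul _

/-- fundamental theorem for localized energies -/
lemma TD.ftc {T : ℝ} {G G' : ℝ → Sch} (h : TD T G G') (φ : Sch) (hφ : HasCompactSupport (φ : E2 → ℝ))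
    {s t : ℝ} (hs : 0 < s) (hst : s ≤ t) (ht : t < T) :
    I (φ * G t) = I (φ * G s) + ∫ τ in s..t, I (φ * G' τ) := by
  have hsub : uIcc s t ⊆ Ioo 0 T := by
    rw [uIcc_of_le hst]; exact fun x hx => ⟨hs.trans_le hx.1, hx.2.trans_lt ht⟩
  rw [intervalIntegral.integral_eq_sub_of_hasDerivAt (f := fun t => I (φ * G t))
    (fun x hx => h.derI φ hφ (hsub hx)) ((h.sm'.contI φ hφ).mono hsub).intervalIntegrable]
  ring

end HMHD
end


open MeasureTheory
open scoped ENNReal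
noncomputable section
namespace HMHD
open Set Filter Topology

lemma schwartz_of_cs {f : E2 → ℝ} (h : ContDiff ℝ (⊤ : ℕ∞) f) (hc : HasCompactSupport f) : IsSchwartz f := by
  refine ⟨h, fun k n => ?_⟩
  have hcont : Continuous fun x => ‖x‖ ^ k * ‖iteratedFDeriv ℝ n f x‖ :=
    (continuous_norm.pow k).mul (h.continuous_iteratedFDeriv (mod_cast le_top)).norm
  have hcs : HasCompactSupport fun x => ‖x‖ ^ k * ‖iteratedFDeriv ℝ n f x‖ :=
    ((hc.iteratedFDeriv n).norm).mul_left
  obtain ⟨C, hC⟩ := hcs.exists_bound_of_continuous hcont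
  exact ⟨C, fun x => (le_abs_self _).trans (hC x)⟩

/-- cutoff sequences -/
structure Cut (φ : ℕ → Sch) (κ : ℕ → ℝ) : Prop where
  cs : ∀ n, HasCompactSupport (φ n : E2 → ℝ)
  le1 : ∀ n x, |(φ n) x| ≤ 1
  lim : ∀ x, Tendsto (fun n => (φ n) x) atTop (𝓝 1)
  κ0 : ∀ n, 0 ≤ κ n
  κlim : Tendsto κ atTop (𝓝 0)
  hD : ∀ n i x, |(D i (φ n)) x| ≤ κ n

lemma exists_cut : ∃ φ κ, Cut φ κ := by
  let χ : ContDiffBump (0 : E2) := ⟨1, 2, one_pos, one_lt_two⟩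
  have hχ : ContDiff ℝ (⊤ : ℕ∞) (χ : E2 → ℝ) := χ.contDiff
  have hχc : HasCompactSupport (χ : E2 → ℝ) := χ.hasCompactSupport
  obtain ⟨C, hC⟩ := (hχc.fderiv (𝕜 := ℝ)).exists_bound_of_continuous (hχ.continuous_fderiv (by simp))
  have hC0 : 0 ≤ C := (norm_nonneg _).trans (hC 0)
  have hne : ∀ n : ℕ, ((n : ℝ) + 1)⁻¹ ≠ 0 := fun n => by positivity
  let g : ℕ → E2 → ℝ := fun n x => χ (((n : ℝ) + 1)⁻¹ • x)
  have hg : ∀ n, ContDiff ℝ (⊤ : ℕ∞) (g n) := fun n => hχ.comp (contDiff_const_smul _)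
  have hgc : ∀ n, HasCompactSupport (g n) := fun n => hχc.comp_smul (hne n)
  have hgd : ∀ n x, fderiv ℝ (g n) x = ((n : ℝ) + 1)⁻¹ • fderiv ℝ (χ : E2 → ℝ) (((n : ℝ) + 1)⁻¹ • x) := fun n x =>
    fderiv_comp_smul _
  have hk : Tendsto (fun n : ℕ => ((n : ℝ) + 1)⁻¹) atTop (𝓝 0) :=
    tendsto_inv_atTop_zero.comp (tendsto_atTop_add_const_right _ _ tendsto_natCast_atTop_atTop)
  refine ⟨fun n => ⟨g n, schwartz_of_cs (hg n) (hgc n)⟩, fun n => ((n : ℝ) + 1)⁻¹ * C, hgc, ?_, ?_, ?_, ?_, ?_⟩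
  · intro n x
    exact abs_le.2 ⟨(by norm_num : (-1 : ℝ) ≤ 0).trans (χ.nonneg : 0 ≤ g n x), χ.le_one⟩
  · intro x
    have h1 : Tendsto (fun n : ℕ => ((n : ℝ) + 1)⁻¹ • x) atTop (𝓝 0) := by
      simpa using hk.smul_const x
    have h2 : Tendsto (fun n : ℕ => χ (((n : ℝ) + 1)⁻¹ • x)) atTop (𝓝 (χ 0)) :=
      (hχ.continuous.tendsto 0).comp h1
    rwa [χ.one_of_mem_closedBall (by simp [χ])] at h2
  · intro n; positivity
  · simpa using hk.mul_const C
  · intro n i x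
    have : (D i (⟨g n, schwartz_of_cs (hg n) (hgc n)⟩ : Sch)) x = fderiv ℝ (g n) x (Pi.single i 1) := rfl
    rw [this, hgd, _root_.smul_apply, smul_eq_mul, abs_mul, abs_of_nonneg (by positivity)]
    gcongr
    refine ((fderiv ℝ (χ : E2 → ℝ) _).le_opNorm _).trans ?_
    have h3 : ‖(Pi.single i 1 : E2)‖ = 1 := by rw [Pi.norm_single, norm_one]
    rw [h3, mul_one]; exact hC _

variable {φ : ℕ → Sch} {κ : ℕ → ℝ}

lemma Cut.limI (h : Cut φ κ) (g : Sch) : Tendsto (fun n => I (φ n * g)) atTop (𝓝 (I g)) := by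
  refine tendsto_integral_of_dominated_convergence (fun x => ‖g x‖) (fun n => (φ n * g).cont.aestronglyMeasurable)
    g.integrable.norm ?_ ?_
  · intro n; refine Eventually.of_forall fun x => ?_
    change ‖(φ n * g) x‖ ≤ _
    rw [mul_app, norm_mul]
    exact mul_le_of_le_one_left (norm_nonneg _) (h.le1 n x)
  · refine Eventually.of_forall fun x => ?_
    have := (h.lim x).mul_const (g x)
    rw [one_mul] at this; exact this

lemma Cut.sq (h : Cut φ κ) : Cut (fun n => φ n * φ n) (fun n => 2 * κ n) where
  cs n := (h.cs n).mul_left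
  le1 n x := by
    rw [mul_app, abs_mul]; exact mul_le_one₀ (h.le1 n x) (abs_nonneg _) (h.le1 n x)
  lim x := by simpa using (h.lim x).mul (h.lim x)
  κ0 n := by have := h.κ0 n; positivity
  κlim := by simpa using h.κlim.const_mul 2
  hD n i x := by
    rw [D_mul, add_app, mul_app, mul_app, mul_comm, ← two_mul, abs_mul, abs_mul, abs_two]
    have := h.le1 n x; have := h.hD n i x; have := h.κ0 n; have := abs_nonneg ((φ n) x)
    nlinarith [abs_nonneg ((D i (φ n)) x)]

lemma N2_cut (f g : Sch) : N2 (f * g) = I (f * f * (g * g)) := by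
  unfold N2; congr 1; apply Sch.ext'; intro x; simp; ring

lemma Cut.limN (h : Cut φ κ) (g : Sch) : Tendsto (fun n => N2 (φ n * g)) atTop (𝓝 (N2 g)) := by
  simp only [N2_cut]; exact h.sq.limI (g * g)

lemma Sm.meas {T : ℝ} {G : ℝ → Sch} (h : Sm T G) :
    AEStronglyMeasurable (fun t => I (G t)) (volume.restrict (Ioo 0 T)) := by
  obtain ⟨φ, κ, hc⟩ := exists_cut
  refine aestronglyMeasurable_of_tendsto_ae atTop (f := fun n t => I (φ n * G t)) (fun n => ?_) ?_
  · exact (h.contI (φ n) (hc.cs n)).aestronglyMeasurable measurableSet_Ioo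
  · exact Eventually.of_forall fun t => hc.limI (G t)

/-- passing to the limit in the fundamental theorem -/
lemma ftc_lim {s t : ℝ} (hst : s ≤ t) {y : ℕ → ℝ → ℝ} {h : ℕ → ℝ → ℝ} {Y H : ℝ → ℝ} {B : ℝ}
    (hy : ∀ n, y n t = y n s + ∫ τ in s..t, h n τ)
    (hm : ∀ n, AEStronglyMeasurable (h n) (volume.restrict (Ioc s t)))
    (hB : ∀ n, ∀ τ ∈ Ioc s t, |h n τ| ≤ B) (hl : ∀ τ ∈ Ioc s t, Tendsto (fun n => h n τ) atTop (𝓝 (H τ)))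
    (yt : Tendsto (fun n => y n t) atTop (𝓝 (Y t))) (ys : Tendsto (fun n => y n s) atTop (𝓝 (Y s))) :
    IntegrableOn H (Ioc s t) ∧ Y t = Y s + ∫ τ in s..t, H τ := by
  have hla : ∀ᵐ τ ∂(volume.restrict (Ioc s t)), Tendsto (fun n => h n τ) atTop (𝓝 (H τ)) :=
    (ae_restrict_iff' measurableSet_Ioc).2 (Eventually.of_forall hl)
  have hBa : ∀ n, ∀ᵐ τ ∂(volume.restrict (Ioc s t)), ‖h n τ‖ ≤ B := fun n =>
    (ae_restrict_iff' measurableSet_Ioc).2 (Eventually.of_forall (hB n))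
  have hHm := aestronglyMeasurable_of_tendsto_ae atTop hm hla
  have hBi : Integrable (fun _ : ℝ => B) (volume.restrict (Ioc s t)) := integrable_const _
  constructor
  · refine hBi.mono' hHm ((ae_restrict_iff' measurableSet_Ioc).2 (Eventually.of_forall fun τ hτ => ?_))
    exact le_of_tendsto (hl τ hτ).norm (Eventually.of_forall fun n => hB n τ hτ)
  · have h1 := tendsto_integral_of_dominated_convergence _ hm hBi hBa hla
    simp only [← intervalIntegral.integral_of_le hst] at h1
    refine tendsto_nhds_unique yt ?_
    simp only [hy]
    exact ys.add h1

end HMHD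
end


open MeasureTheory
open scoped ENNReal
noncomputable section
namespace HMHD
open Set Filter Topology

lemma integral_le_lint {F : ℝ → ℝ} {s : Set ℝ} {K : ℝ} (hF : IntegrableOn F s) (hK : 0 ≤ K)
    (h : ∫⁻ t in s, ENNReal.ofReal (F t) ≤ ENNReal.ofReal K) : ∫ t in s, F t ≤ K := by
  rw [integral_eq_lintegral_pos_part_sub_lintegral_neg_part hF]
  have := ENNReal.toReal_mono ENNReal.ofReal_ne_top h
  rw [ENNReal.toReal_ofReal hK] at this
  linarith [ENNReal.toReal_nonneg (a := ∫⁻ t in s, ENNReal.ofReal (- F t))]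

lemma gron_core {t0 t1 : ℝ} {y g Dd h a : ℝ → ℝ} {H M : ℝ}
    (hy : ∀ t ∈ Icc t0 t1, y t = y t0 + ∫ s in t0..t, g s)
    (hg : IntegrableOn g (Ioc t0 t1)) (hD : IntegrableOn Dd (Ioc t0 t1))
    (hh : AEMeasurable h (volume.restrict (Ioc t0 t1))) (hh0 : ∀ t, 0 ≤ h t) (hH0 : 0 ≤ H)
    (hH : ∫⁻ t in Ioc t0 t1, ENNReal.ofReal (h t) ≤ ENNReal.ofReal H)
    (hM0 : 0 ≤ M) (hM : ∀ t ∈ Icc t0 t1, y t ≤ M) (ha0 : ∀ t, 0 ≤ a t)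
    (ha : ∫⁻ t in Ioc t0 t1, ENNReal.ofReal (a t) ≤ ENNReal.ofReal (1 / 2))
    (hi : ∀ t ∈ Ioc t0 t1, g t + Dd t ≤ a t * y t + h t) {t : ℝ} (ht : t ∈ Icc t0 t1) :
    y t + ∫ s in Ioc t0 t, Dd s ≤ y t0 + H + M / 2 := by
  have hsub : Ioc t0 t ⊆ Ioc t0 t1 := Ioc_subset_Ioc_right ht.2
  have hg' := hg.mono_set hsub
  have hD' := hD.mono_set hsub
  have e : y t + ∫ s in Ioc t0 t, Dd s = y t0 + ∫ s in Ioc t0 t, (g s + Dd s) := by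
    rw [integral_add hg' hD', hy t ht, intervalIntegral.integral_of_le ht.1]; ring
  have key : ∫ s in Ioc t0 t, (g s + Dd s) ≤ H + M / 2 := by
    refine integral_le_lint (hg'.add hD') (by positivity) ?_
    calc ∫⁻ s in Ioc t0 t, ENNReal.ofReal (g s + Dd s)
        ≤ ∫⁻ s in Ioc t0 t1, ENNReal.ofReal (g s + Dd s) := lintegral_mono_set hsub
      _ ≤ ∫⁻ s in Ioc t0 t1, (ENNReal.ofReal (a s) * ENNReal.ofReal M + ENNReal.ofReal (h s)) := by
          refine setLIntegral_mono' measurableSet_Ioc fun s hs => ?_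
          rw [← ENNReal.ofReal_mul (ha0 s), ← ENNReal.ofReal_add (mul_nonneg (ha0 s) hM0) (hh0 s)]
          refine ENNReal.ofReal_le_ofReal ((hi s hs).trans ?_)
          gcongr
          · exact ha0 s
          · exact hM s (Ioc_subset_Icc_self hs)
      _ = (∫⁻ s in Ioc t0 t1, ENNReal.ofReal (a s)) * ENNReal.ofReal M + ∫⁻ s in Ioc t0 t1, ENNReal.ofReal (h s) := by
          rw [lintegral_add_right' _ hh.ennreal_ofReal, lintegral_mul_const' _ _ ENNReal.ofReal_ne_top]
      _ ≤ ENNReal.ofReal (1 / 2) * ENNReal.ofReal M + ENNReal.ofReal H := by gcongr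
      _ = ENNReal.ofReal (H + M / 2) := by
          rw [← ENNReal.ofReal_mul (by norm_num), ← ENNReal.ofReal_add (by positivity) hH0]; congr 1; ring
  linarith

lemma gron {t0 t1 : ℝ} (h01 : t0 ≤ t1) {y g Dd h a : ℝ → ℝ} {H B : ℝ}
    (hy : ∀ t ∈ Icc t0 t1, y t = y t0 + ∫ s in t0..t, g s)
    (hg : IntegrableOn g (Ioc t0 t1)) (hD : IntegrableOn Dd (Ioc t0 t1)) (hD0 : ∀ t, 0 ≤ Dd t)
    (hh : AEMeasurable h (volume.restrict (Ioc t0 t1))) (hh0 : ∀ t, 0 ≤ h t) (hH0 : 0 ≤ H)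
    (hH : ∫⁻ t in Ioc t0 t1, ENNReal.ofReal (h t) ≤ ENNReal.ofReal H)
    (hB : ∀ t ∈ Icc t0 t1, y t ≤ B) (hy0 : ∀ t, 0 ≤ y t) (ha0 : ∀ t, 0 ≤ a t)
    (ha : ∫⁻ t in Ioc t0 t1, ENNReal.ofReal (a t) ≤ ENNReal.ofReal (1 / 2))
    (hi : ∀ t ∈ Ioc t0 t1, g t + Dd t ≤ a t * y t + h t) :
    (∀ t ∈ Icc t0 t1, y t ≤ 2 * (y t0 + H)) ∧
      ∫⁻ t in Ioc t0 t1, ENNReal.ofReal (Dd t) ≤ ENNReal.ofReal (2 * (y t0 + H)) := by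
  set M := sSup (y '' Icc t0 t1) with hMdef
  have hbd : BddAbove (y '' Icc t0 t1) := ⟨B, by rintro _ ⟨t, ht, rfl⟩; exact hB t ht⟩
  have hM : ∀ t ∈ Icc t0 t1, y t ≤ M := fun t ht => le_csSup hbd (mem_image_of_mem _ ht)
  have hM0 : 0 ≤ M := (hy0 t0).trans (hM t0 (left_mem_Icc.2 h01))
  have core := fun t (ht : t ∈ Icc t0 t1) => gron_core hy hg hD hh hh0 hH0 hH hM0 hM ha0 ha hi ht
  have hM2 : M ≤ y t0 + H + M / 2 := by
    refine csSup_le ((nonempty_Icc.2 h01).image _) ?_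
    rintro _ ⟨t, ht, rfl⟩
    have := core t ht
    have := setIntegral_nonneg (μ := volume) (measurableSet_Ioc (a := t0) (b := t)) (fun s _ => hD0 s)
    linarith
  refine ⟨fun t ht => by linarith [hM t ht], ?_⟩
  rw [← ofReal_integral_eq_lintegral_ofReal hD (Eventually.of_forall hD0)]
  refine ENNReal.ofReal_le_ofReal ?_
  have := core t1 (right_mem_Icc.2 h01)
  linarith [hy0 t1]

lemma tail {t0 T : ℝ} (h0 : t0 < T) {F : ℝ → ℝ≥0∞} (hF : ∫⁻ t in Ioo t0 T, F t < ⊤) :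
    ∃ t1 ∈ Ico t0 T, ∫⁻ t in Ioo t1 T, F t ≤ ENNReal.ofReal (1 / 2) := by
  have hs : Tendsto (fun n : ℕ => (volume.restrict (Ioo t0 T)) (Ioo (T - (T - t0) * ((n : ℝ) + 1)⁻¹) T)) atTop (𝓝 0) := by
    have hk : Tendsto (fun n : ℕ => ((n : ℝ) + 1)⁻¹) atTop (𝓝 0) :=
      tendsto_inv_atTop_zero.comp (tendsto_atTop_add_const_right _ _ tendsto_natCast_atTop_atTop)
    have h1 : Tendsto (fun n : ℕ => ENNReal.ofReal ((T - t0) * ((n : ℝ) + 1)⁻¹)) atTop (𝓝 0) := by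
      have := ENNReal.tendsto_ofReal (hk.const_mul (T - t0))
      simpa using this
    refine tendsto_of_tendsto_of_tendsto_of_le_of_le tendsto_const_nhds h1 (fun _ => zero_le) fun n => ?_
    refine (Measure.restrict_apply_le _ _).trans ?_
    rw [Real.volume_Ioo]; exact ENNReal.ofReal_le_ofReal (by simp)
  have h2 := tendsto_setLIntegral_zero hF.ne hs
  obtain ⟨n, hn⟩ := (h2.eventually (ge_mem_nhds (show 0 < ENNReal.ofReal (1 / 2) by simp))).exists
  have hp : 0 < ((n : ℝ) + 1)⁻¹ := by positivity
  have hp1 : ((n : ℝ) + 1)⁻¹ ≤ 1 := inv_le_one_of_one_le₀ (by linarith [Nat.cast_nonneg (α := ℝ) n])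
  have hsub : t0 ≤ T - (T - t0) * ((n : ℝ) + 1)⁻¹ := by nlinarith
  refine ⟨T - (T - t0) * ((n : ℝ) + 1)⁻¹, ⟨hsub, by nlinarith⟩, ?_⟩
  rwa [Measure.restrict_restrict measurableSet_Ioo, inter_eq_left.2 (Ioo_subset_Ioo_left hsub)] at hn

lemma close {t0 T : ℝ} (h0 : t0 < T) {F : ℝ → ℝ≥0∞} {K : ℝ≥0∞}
    (h : ∀ t1 ∈ Ioo t0 T, ∫⁻ t in Ioc t0 t1, F t ≤ K) : ∫⁻ t in Ioo t0 T, F t ≤ K := by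
  obtain ⟨u, hu, hut, hul⟩ := exists_seq_strictMono_tendsto' h0
  have : Ioo t0 T = ⋃ n, Ioc t0 (u n) := by
    ext x; simp only [mem_iUnion, mem_Ioc, mem_Ioo]
    constructor
    · rintro ⟨h1, h2⟩
      obtain ⟨n, hn⟩ := (hul.eventually (lt_mem_nhds h2)).exists
      exact ⟨n, h1, hn.le⟩
    · rintro ⟨n, h1, h2⟩
      exact ⟨h1, h2.trans_lt (hut n).2⟩
  rw [this, setLIntegral_iUnion_of_directed]
  · exact iSup_le fun n => h _ (hut n)
  · exact (Monotone.directed_le fun a b hab => Ioc_subset_Ioc_right (hu.monotone hab))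

end HMHD
end


open MeasureTheory
open scoped ENNReal
noncomputable section
namespace HMHD
open Set Filter Topology

/-- abstract solution -/
structure Sol (ν η ε T : ℝ) (m : ℕ) (f : ℝ → Fin 6 → Sch) (q : ℝ → Sch) : Prop where
  td : ∀ c, TD T (fun t => f t c) (fun t => rhs ν η ε (f t) (q t) c)
  inc : ∀ t ∈ Ioo 0 T, Inc (f t)
  pois : ∀ t ∈ Ioo 0 T, D 0 (D 0 (q t)) + D 1 (D 1 (q t)) = -(D 0 (Nu (f t) 0 3) + D 1 (Nu (f t) 1 4))
  loc : ∀ k ≤ m, ∀ T' < T, ∃ C : ℝ, ∀ t ∈ Ioc 0 T', Yk k (f t) ≤ C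

/-- bounded in L2 on a set of times -/
def LB (S : Set ℝ) (G : ℝ → Sch) : Prop := ∃ C : ℝ, ∀ t ∈ S, N2 (G t) ≤ C

lemma LB.add {S G H} (h : LB S G) (h' : LB S H) : LB S (fun t => G t + H t) := by
  obtain ⟨C, hC⟩ := h; obtain ⟨C', hC'⟩ := h'
  exact ⟨2 * C + 2 * C', fun t ht => (N2_add_le _ _).trans (by linarith [hC t ht, hC' t ht])⟩

lemma LB.smul {S G} (h : LB S G) (c : ℝ) : LB S (fun t => c • G t) := by
  obtain ⟨C, hC⟩ := h
  exact ⟨c ^ 2 * C, fun t ht => by rw [N2_smul]; exact mul_le_mul_of_nonneg_left (hC t ht) (sq_nonneg c)⟩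

lemma LB.neg {S G} (h : LB S G) : LB S (fun t => - G t) := by
  simpa using h.smul (-1)

lemma LB.sub {S G H} (h : LB S G) (h' : LB S H) : LB S (fun t => G t - H t) := by
  simpa [sub_eq_add_neg] using h.add h'.neg

lemma LB.zero {S} : LB S (fun _ => 0) := ⟨0, fun t _ => by simp [N2]⟩

/-- the derivatives up to order three are bounded -/
def B3 (S : Set ℝ) (f : ℝ → Fin 6 → Sch) : Prop := ∃ C : ℝ, ∀ k ≤ 3, ∀ t ∈ S, Yk k (f t) ≤ C

lemma B3.dw {S f} (h : B3 S f) (w : List (Fin 2)) (hw : w.length ≤ 3) (c : Fin 6) :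
    LB S (fun t => dw w (f t c)) := by
  obtain ⟨C, hC⟩ := h
  exact ⟨C, fun t ht => (le_Yk rfl (f t) c).trans (hC _ hw t ht)⟩

lemma B3.n4 {S f} (h : B3 S f) (w : List (Fin 2)) (hw : w.length ≤ 2) (c : Fin 6) :
    ∃ C, ∀ t ∈ S, N4 (HMHD.dw w (f t c)) ≤ C := by
  obtain ⟨C, hC⟩ := h
  refine ⟨8 * (C * (C + C)), fun t ht => (lady _).trans ?_⟩
  have h1 := (le_Yk (w := w) rfl (f t) c).trans (hC _ (by omega) t ht)
  have h2 := (le_Yk (w := 0 :: w) rfl (f t) c).trans (hC _ (by simp only [List.length_cons]; omega) t ht)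
  have h3 := (le_Yk (w := 1 :: w) rfl (f t) c).trans (hC _ (by simp only [List.length_cons]; omega) t ht)
  rw [dw_cons] at h2 h3
  have h4 := N2_nonneg (HMHD.dw w (f t c))
  have h5 := G2_nonneg (HMHD.dw w (f t c))
  have h6 : G2 (HMHD.dw w (f t c)) ≤ C + C := add_le_add h2 h3
  have : 0 ≤ C := h4.trans h1
  gcongr

lemma B3.mul {S f} (h : B3 S f) (v w : List (Fin 2)) (hv : v.length ≤ 2) (hw : w.length ≤ 2) (c d : Fin 6) :
    LB S (fun t => HMHD.dw v (f t c) * HMHD.dw w (f t d)) := by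
  obtain ⟨C, hC⟩ := h.n4 v hv c
  obtain ⟨C', hC'⟩ := h.n4 w hw d
  refine ⟨1 * C + (4 * 1)⁻¹ * C', fun t ht => (N2_mul_le' _ _ one_pos).trans ?_⟩
  have := hC t ht; have := hC' t ht
  gcongr

lemma B3.nu {S f} (h : B3 S f) (i j : Fin 6) : LB S (fun t => Nu (f t) i j) := by
  unfold Nu
  exact ((h.mul [] [0] (by simp) (by simp) 0 i).add (h.mul [] [1] (by simp) (by simp) 1 i)).sub
    ((h.mul [] [0] (by simp) (by simp) 3 j).add (h.mul [] [1] (by simp) (by simp) 4 j))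

lemma B3.tra {S f} (h : B3 S f) (c : Fin 6) : LB S (fun t => tra (f t) c) := by
  unfold HMHD.tra
  exact ((h.mul [] [0] (by simp) (by simp) 0 c).add (h.mul [] [1] (by simp) (by simp) 1 c)).neg.add
    ((h.mul [] [0] (by simp) (by simp) 3 (c + 3)).add (h.mul [] [1] (by simp) (by simp) 4 (c + 3)))

lemma LB.of_le {S G H K} (h : LB S G) (h' : LB S H) (hK : ∀ t ∈ S, N2 (K t) ≤ N2 (G t) + N2 (H t)) : LB S K := by
  obtain ⟨C, hC⟩ := h; obtain ⟨C', hC'⟩ := h'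
  exact ⟨C + C', fun t ht => (hK t ht).trans (add_le_add (hC t ht) (hC' t ht))⟩

lemma B3.rhs {S f} {q : ℝ → Sch} (h : B3 S f) (ν η ε : ℝ)
    (hp : ∀ t ∈ S, D 0 (D 0 (q t)) + D 1 (D 1 (q t)) = -(D 0 (Nu (f t) 0 3) + D 1 (Nu (f t) 1 4)))
    (c : Fin 6) : LB S (fun t => rhs ν η ε (f t) (q t) c) := by
  have hpr : ∀ i : Fin 2, LB S (fun t => - D i (q t)) := by
    intro i
    refine LB.neg ((h.nu 0 3).of_le (h.nu 1 4) fun t ht => ?_)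
    refine le_trans ?_ (press (hp t ht))
    unfold G2
    have := N2_nonneg (D 0 (q t)); have := N2_nonneg (D 1 (q t))
    fin_cases i <;> simp <;> linarith
  have hQ : ∀ i : Fin 2, LB S (fun t => D i (Qc (f t))) := by
    intro i
    simp only [Qc, map_add, D_mul]
    exact ((h.mul [i] [0] (by simp) (by simp) 3 5).add (h.mul [] [i, 0] (by simp) (by simp) 3 5)).add
      ((h.mul [i] [1] (by simp) (by simp) 4 5).add (h.mul [] [i, 1] (by simp) (by simp) 4 5))
  have hJ : ∀ (i : Fin 2) (a : Fin 6), LB S (fun t => D i (f t a * Jc (f t))) := by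
    intro i a
    simp only [Jc, map_sub, D_mul, mul_sub]
    exact ((h.mul [i] [0] (by simp) (by simp) a 4).add (h.mul [] [i, 0] (by simp) (by simp) a 4)).sub
      ((h.mul [i] [1] (by simp) (by simp) a 3).add (h.mul [] [i, 1] (by simp) (by simp) a 3))
  unfold HMHD.rhs
  refine (((((h.dw [0, 0] (by simp) c).add (h.dw [1, 1] (by simp) c)).smul _).add (h.tra c))).add ?_
  fin_cases c
  · exact hpr 0
  · exact hpr 1
  · exact LB.zero
  · exact ((hQ 1).smul ε).neg
  · exact (hQ 0).smul ε
  · exact (((hJ 0 3).add (hJ 1 4)).smul ε).neg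

lemma I_tri (ψ g h : Sch) {K : ℝ} (hψ : ∀ x, |ψ x| ≤ K) : |I (ψ * (g * h))| ≤ K * (N2 g + N2 h) := by
  have : |I (ψ * (g * h))| ≤ I (K • (g * g + h * h)) := by
    refine I_abs_le fun x => ?_
    simp only [mul_app, smul_app, add_app, abs_mul]
    have h1 := hψ x
    have h2 : |g x| * |h x| ≤ g x * g x + h x * h x := by
      rw [← abs_mul_abs_self (g x), ← abs_mul_abs_self (h x)]
      nlinarith [sq_nonneg (|g x| - |h x|), sq_nonneg (|g x| + |h x|)]
    have h3 := abs_nonneg (ψ x)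
    have h4 : 0 ≤ |g x| * |h x| := by positivity
    exact mul_le_mul h1 h2 h4 (h3.trans h1)
  rw [map_smul, map_add] at this
  exact this

lemma en0 {T s t : ℝ} {G G' : ℝ → Sch} (h : TD T G G') (hs : 0 < s) (hst : s ≤ t) (ht : t < T)
    (hG : LB (Ioc s t) G) (hG' : LB (Ioc s t) G') :
    IntegrableOn (fun τ => 2 * I (G τ * G' τ)) (Ioc s t) ∧
      N2 (G t) = N2 (G s) + ∫ τ in s..t, 2 * I (G τ * G' τ) := by
  obtain ⟨φ, κ, hc⟩ := exists_cut
  obtain ⟨C, hC⟩ := hG; obtain ⟨C', hC'⟩ := hG'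
  have htd := h.mul h
  have e : ∀ n τ, I (φ n * (G' τ * G τ + G τ * G' τ)) = 2 * I (φ n * (G τ * G' τ)) := by
    intro n τ
    rw [mul_comm (G' τ), mul_add, map_add]; ring
  have hsub : Ioc s t ⊆ Ioo 0 T := fun x hx => ⟨hs.trans hx.1, hx.2.trans_lt ht⟩
  refine ftc_lim hst (y := fun n τ => I (φ n * (G τ * G τ))) (h := fun n τ => 2 * I (φ n * (G τ * G' τ)))
    (Y := fun τ => N2 (G τ)) (B := 2 * (1 * (C + C'))) ?_ ?_ ?_ ?_ ?_ ?_
  · intro n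
    have := htd.ftc (φ n) (hc.cs n) hs hst ht
    simp only [e] at this
    exact this
  · intro n
    have := ((htd.sm'.contI (φ n) (hc.cs n)).mono hsub).aestronglyMeasurable measurableSet_Ioc (μ := volume)
    simp only [e] at this
    exact this
  · intro n τ hτ
    rw [abs_mul, abs_two]
    have := I_tri (φ n) (G τ) (G' τ) (hc.le1 n)
    have := hC τ hτ; have := hC' τ hτ
    linarith
  · intro τ hτ
    exact (hc.limI _).const_mul 2
  · exact hc.limI _
  · exact hc.limI _

lemma en1 {T s t : ℝ} {G G' : ℝ → Sch} (h : TD T G G') (i : Fin 2) (hs : 0 < s) (hst : s ≤ t) (ht : t < T)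
    (hG : LB (Ioc s t) fun τ => D i (G τ)) (hG2 : LB (Ioc s t) fun τ => D i (D i (G τ)))
    (hG' : LB (Ioc s t) G') :
    IntegrableOn (fun τ => -2 * I (D i (D i (G τ)) * G' τ)) (Ioc s t) ∧
      N2 (D i (G t)) = N2 (D i (G s)) + ∫ τ in s..t, -2 * I (D i (D i (G τ)) * G' τ) := by
  obtain ⟨φ, κ, hc⟩ := exists_cut
  obtain ⟨C, hC⟩ := hG; obtain ⟨C2, hC2⟩ := hG2; obtain ⟨C', hC'⟩ := hG'
  obtain ⟨K, hK⟩ := hc.κlim.bddAbove_range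
  have hK' : ∀ n, κ n ≤ K := fun n => hK (mem_range_self n)
  have hK0 : 0 ≤ K := (hc.κ0 0).trans (hK' 0)
  have htd := (h.D i).mul (h.D i)
  have e : ∀ n τ, I (φ n * (D i (G' τ) * D i (G τ) + D i (G τ) * D i (G' τ))) =
      -2 * I (D i (φ n) * (D i (G τ) * G' τ)) + -2 * I (φ n * (D i (D i (G τ)) * G' τ)) := by
    intro n τ
    have h1 : φ n * (D i (G' τ) * D i (G τ) + D i (G τ) * D i (G' τ)) = (2 : ℝ) • (D i (G' τ) * (φ n * D i (G τ))) := by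
      apply Sch.ext'; intro x; simp; ring
    have h2 : I (G' τ * D i (φ n * D i (G τ))) =
        I (D i (φ n) * (D i (G τ) * G' τ)) + I (φ n * (D i (D i (G τ)) * G' τ)) := by
      rw [← map_add]; congr 1; rw [D_mul]
      apply Sch.ext'; intro x; simp; ring
    rw [h1, map_smul, I_ibp, h2, smul_eq_mul]; ring
  have hsub : Ioc s t ⊆ Ioo 0 T := fun x hx => ⟨hs.trans hx.1, hx.2.trans_lt ht⟩
  refine ftc_lim hst (y := fun n τ => I (φ n * (D i (G τ) * D i (G τ))))
    (h := fun n τ => -2 * I (D i (φ n) * (D i (G τ) * G' τ)) + -2 * I (φ n * (D i (D i (G τ)) * G' τ)))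
    (Y := fun τ => N2 (D i (G τ))) (B := 2 * (K * (C + C')) + 2 * (1 * (C2 + C'))) ?_ ?_ ?_ ?_ ?_ ?_
  · intro n
    have := htd.ftc (φ n) (hc.cs n) hs hst ht
    simp only [e] at this
    exact this
  · intro n
    have := ((htd.sm'.contI (φ n) (hc.cs n)).mono hsub).aestronglyMeasurable measurableSet_Ioc (μ := volume)
    simp only [e] at this
    exact this
  · intro n τ hτ
    have h1 := I_tri (D i (φ n)) (D i (G τ)) (G' τ) (fun x => (hc.hD n i x).trans (hK' n))
    have h2 := I_tri (φ n) (D i (D i (G τ))) (G' τ) (hc.le1 n)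
    have h3 := hC τ hτ; have h4 := hC' τ hτ; have h5 := hC2 τ hτ
    have h6 : K * (N2 (D i (G τ)) + N2 (G' τ)) ≤ K * (C + C') := by gcongr
    rw [abs_le] at h1 h2 ⊢
    constructor <;> linarith
  · intro τ hτ
    have l1 : Tendsto (fun n => I (D i (φ n) * (D i (G τ) * G' τ))) atTop (𝓝 0) := by
      refine squeeze_zero_norm (fun n => I_tri (D i (φ n)) (D i (G τ)) (G' τ) (hc.hD n i)) ?_
      simpa using hc.κlim.mul_const (N2 (D i (G τ)) + N2 (G' τ))
    simpa using (l1.const_mul (-2)).add ((hc.limI (D i (D i (G τ)) * G' τ)).const_mul (-2))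
  · exact hc.limI _
  · exact hc.limI _

end HMHD
end


open MeasureTheory
open scoped ENNReal
noncomputable section
namespace HMHD
open Set Filter Topology

variable {ν η ε T : ℝ} {m : ℕ} {f : ℝ → Fin 6 → Sch} {q : ℝ → Sch}

lemma Sol.dwsm (h : Sol ν η ε T m f q) (w : List (Fin 2)) (c : Fin 6) : Sm T (fun t => dw w (f t c)) :=
  ((h.td c).dw w).sm

lemma Sol.measY (h : Sol ν η ε T m f q) (k : ℕ) :
    AEStronglyMeasurable (fun t => Yk k (f t)) (volume.restrict (Ioo 0 T)) := by
  unfold Yk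
  refine Finset.aestronglyMeasurable_fun_sum _ fun c _ => Finset.aestronglyMeasurable_fun_sum _ fun w _ => ?_
  exact ((h.dwsm w c).mul (h.dwsm w c)).meas

lemma Sol.measL (h : Sol ν η ε T m f q) (k : ℕ) :
    AEStronglyMeasurable (fun t => Lam k (f t)) (volume.restrict (Ioo 0 T)) := by
  unfold Lam
  refine Finset.aestronglyMeasurable_fun_sum _ fun c _ => Finset.aestronglyMeasurable_fun_sum _ fun l _ =>
    Finset.aestronglyMeasurable_fun_sum _ fun w _ => ?_
  exact (((h.dwsm w c).mul (h.dwsm w c)).mul ((h.dwsm w c).mul (h.dwsm w c))).meas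

lemma Sol.b3 (h : Sol ν η ε T m f q) (hm : 3 ≤ m) {s t : ℝ} (hs : 0 < s) (ht : t < T) : B3 (Icc s t) f := by
  obtain ⟨C0, h0⟩ := h.loc 0 (by omega) t ht
  obtain ⟨C1, h1⟩ := h.loc 1 (by omega) t ht
  obtain ⟨C2, h2⟩ := h.loc 2 (by omega) t ht
  obtain ⟨C3, h3⟩ := h.loc 3 (by omega) t ht
  have hsub : Icc s t ⊆ Ioc 0 t := fun x hx => ⟨hs.trans_le hx.1, hx.2⟩
  refine ⟨max (max C0 C1) (max C2 C3), fun k hk τ hτ => ?_⟩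
  have hτ' := hsub hτ
  interval_cases k
  · exact (h0 τ hτ').trans (by simp)
  · exact (h1 τ hτ').trans (by simp)
  · exact (h2 τ hτ').trans (by simp)
  · exact (h3 τ hτ').trans (by simp)

lemma LB.mono {S S' : Set ℝ} {G} (h : LB S G) (hS : S' ⊆ S) : LB S' G := by
  obtain ⟨C, hC⟩ := h; exact ⟨C, fun t ht => hC t (hS ht)⟩

lemma sum_ftc {ι : Type} (A : Finset ι) {s t : ℝ} {y g : ι → ℝ → ℝ}
    (hst : s ≤ t) (h : ∀ i ∈ A, IntegrableOn (g i) (Ioc s t) ∧ y i t = y i s + ∫ τ in s..t, g i τ) :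
    IntegrableOn (fun τ => ∑ i ∈ A, g i τ) (Ioc s t) ∧
      ∑ i ∈ A, y i t = ∑ i ∈ A, y i s + ∫ τ in s..t, ∑ i ∈ A, g i τ := by
  constructor
  · exact integrable_finsetSum _ fun i hi => (h i hi).1
  · rw [intervalIntegral.integral_finsetSum fun i hi => (intervalIntegrable_iff_integrableOn_Ioc_of_le hst).2 (h i hi).1,
      ← Finset.sum_add_distrib]
    exact Finset.sum_congr rfl fun i hi => (h i hi).2

/-- induction hypothesis -/
def PB (T : ℝ) (f : ℝ → Fin 6 → Sch) (k : ℕ) (t0 : ℝ) : Prop :=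
  (∀ j < k, ∃ C : ℝ, ∀ t ∈ Ico t0 T, Yk j (f t) ≤ C) ∧ IntegrableOn (fun t => Yk k (f t)) (Ioo t0 T)

lemma PB.mono {k t0 t1} (h : PB T f k t0) (h01 : t0 ≤ t1) : PB T f k t1 := by
  refine ⟨fun j hj => ?_, h.2.mono_set (Ioo_subset_Ioo_left h01)⟩
  obtain ⟨C, hC⟩ := h.1 j hj
  exact ⟨C, fun t ht => hC t ⟨h01.trans ht.1, ht.2⟩⟩

lemma Sol.intY (hs : Sol ν η ε T m f q) {j : ℕ} {t0 t1 C : ℝ} (h0 : 0 ≤ t0) (h1 : t1 ≤ T)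
    (hC : ∀ t ∈ Ioo t0 t1, Yk j (f t) ≤ C) : IntegrableOn (fun t => Yk j (f t)) (Ioo t0 t1) := by
  have hm := (hs.measY j).mono_measure (Measure.restrict_mono (Ioo_subset_Ioo h0 h1) le_rfl)
  have hi : IntegrableOn (fun _ : ℝ => C) (Ioo t0 t1) := integrableOn_const (by simp)
  refine hi.mono' hm ((ae_restrict_iff' measurableSet_Ioo).2 (Eventually.of_forall fun t ht => ?_))
  rw [Real.norm_of_nonneg (Yk_nonneg _ _)]
  exact hC t ht

lemma Sol.pbint (hs : Sol ν η ε T m f q) {k : ℕ} {t0 : ℝ} (h0 : 0 ≤ t0) (h : PB T f k t0) {j : ℕ} (hj : j ≤ k) :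
    IntegrableOn (fun t => Yk j (f t)) (Ioo t0 T) := by
  rcases hj.lt_or_eq with hj | rfl
  · obtain ⟨C, hC⟩ := h.1 j hj
    exact hs.intY h0 le_rfl fun t ht => hC t (Ioo_subset_Ico_self ht)
  · exact h.2

lemma Sol.pblam (hs : Sol ν η ε T m f q) {k : ℕ} {t0 : ℝ} (h0 : 0 ≤ t0) (h : PB T f k t0) :
    IntegrableOn (fun t => Lam k (f t)) (Ioo t0 T) := by
  unfold Lam
  refine integrable_finsetSum _ fun c _ => integrable_finsetSum _ fun l hl => integrable_finsetSum _ fun w hw => ?_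
  have hl' : l < k := Finset.mem_range.1 hl
  rw [mem_words] at hw
  obtain ⟨C, hC⟩ := h.1 l hl'
  have hi := (hs.pbint h0 h (j := l + 1) hl').const_mul (16 * C)
  have hm := ((((hs.dwsm w c).mul (hs.dwsm w c)).mul ((hs.dwsm w c).mul (hs.dwsm w c))).meas).mono_measure
    (Measure.restrict_mono (Ioo_subset_Ioo_left h0) le_rfl)
  refine hi.mono' hm ((ae_restrict_iff' measurableSet_Ioo).2 (Eventually.of_forall fun t ht => ?_))
  rw [Real.norm_of_nonneg (N4_nonneg _)]
  refine (lady _).trans ?_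
  have h1 := (le_Yk hw (f t) c).trans (hC t (Ioo_subset_Ico_self ht))
  have h2 := le_Yk (w := 0 :: w) (k := l + 1) (by simp [hw]) (f t) c
  have h3 := le_Yk (w := 1 :: w) (k := l + 1) (by simp [hw]) (f t) c
  rw [dw_cons] at h2 h3
  have h4 := N2_nonneg (dw w (f t c))
  have h6 : G2 (dw w (f t c)) ≤ Yk (l + 1) (f t) + Yk (l + 1) (f t) := add_le_add h2 h3
  have h5 := G2_nonneg (dw w (f t c))
  calc 8 * (N2 (dw w (f t c)) * G2 (dw w (f t c))) ≤ 8 * (C * (Yk (l + 1) (f t) + Yk (l + 1) (f t))) := by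
        have : 0 ≤ C := h4.trans h1
        gcongr
    _ = _ := by ring

lemma Sol.finish (hs : Sol ν η ε T m f q) {k : ℕ} {t0 c K : ℝ} (h0 : 0 < t0) (h1 : t0 < T) (hc : 0 < c)
    (h : ∀ j < k, ∃ C : ℝ, ∀ t ∈ Ico t0 T, Yk j (f t) ≤ C)
    (hb : ∀ t ∈ Ioo t0 T, Yk k (f t) ≤ K)
    (hi : ∀ t ∈ Ioo t0 T, ∫⁻ τ in Ioc t0 t, ENNReal.ofReal (c * Yk (k + 1) (f τ)) ≤ ENNReal.ofReal K) :
    PB T f (k + 1) t0 := by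
  refine ⟨fun j hj => ?_, ?_⟩
  · rcases (Nat.lt_succ_iff.1 hj).lt_or_eq with hj | rfl
    · exact h j hj
    · refine ⟨max K (Yk j (f t0)), fun t ht => ?_⟩
      rcases ht.1.eq_or_lt with rfl | h'
      · exact le_max_right _ _
      · exact (hb t ⟨h', ht.2⟩).trans (le_max_left _ _)
  · have h2 := close h1 hi
    have hm := (hs.measY (k + 1)).mono_measure (Measure.restrict_mono (Ioo_subset_Ioo_left h0.le) le_rfl : volume.restrict (Ioo t0 T) ≤ _)
    have h3 : IntegrableOn (fun t => c * Yk (k + 1) (f t)) (Ioo t0 T) := by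
      refine ⟨hm.const_mul c, ?_⟩
      rw [hasFiniteIntegral_iff_ofReal (Eventually.of_forall fun t => mul_nonneg hc.le (Yk_nonneg _ _))]
      exact h2.trans_lt ENNReal.ofReal_lt_top
    have h4 := h3.const_mul c⁻¹
    refine h4.congr (Eventually.of_forall fun t => ?_)
    field_simp

lemma Sol.rhsLB (hs : Sol ν η ε T m f q) (hm : 3 ≤ m) {s t : ℝ} (h0 : 0 < s) (ht : t < T) (c : Fin 6) :
    LB (Icc s t) (fun t => rhs ν η ε (f t) (q t) c) :=
  (hs.b3 hm h0 ht).rhs ν η ε (fun τ hτ => hs.pois τ ⟨h0.trans_le hτ.1, hτ.2.trans_lt ht⟩) c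

lemma Sol.intIoc (hs : Sol ν η ε T m f q) {k : ℕ} (hk : k ≤ m) {s t : ℝ} (h0 : 0 < s) (ht : t < T) :
    IntegrableOn (fun t => Yk k (f t)) (Ioc s t) := by
  obtain ⟨C, hC⟩ := hs.loc k hk t ht
  rw [integrableOn_Ioc_iff_integrableOn_Ioo]
  exact hs.intY h0.le ht.le fun τ hτ => hC τ ⟨h0.trans hτ.1, hτ.2.le⟩

lemma Sol.step0 (hs : Sol ν η ε T m f q) (hm : 3 ≤ m) (hν : 0 < ν) (hη : 0 < η) {t0 : ℝ} (h0 : 0 < t0) (h1 : t0 < T) :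
    PB T f 1 t0 := by
  have hμ : 0 < min ν η := lt_min hν hη
  have key : ∀ t1 ∈ Ioo t0 T, (∀ t ∈ Icc t0 t1, Yk 0 (f t) ≤ 2 * (Yk 0 (f t0) + 0)) ∧
      ∫⁻ t in Ioc t0 t1, ENNReal.ofReal (2 * min ν η * Yk 1 (f t)) ≤ ENNReal.ofReal (2 * (Yk 0 (f t0) + 0)) := by
    intro t1 ht1
    obtain ⟨B, hB⟩ := hs.loc 0 (by omega) t1 ht1.2
    have hb3 := hs.b3 hm h0 ht1.2
    have hf : ∀ t ∈ Icc t0 t1, IntegrableOn (fun τ => ∑ c, 2 * I (f τ c * rhs ν η ε (f τ) (q τ) c)) (Ioc t0 t) ∧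
        ∑ c, N2 (f t c) = ∑ c, N2 (f t0 c) + ∫ τ in t0..t, ∑ c, 2 * I (f τ c * rhs ν η ε (f τ) (q τ) c) := by
      intro t ht
      have hsub : Ioc t0 t ⊆ Icc t0 t1 := fun x hx => ⟨hx.1.le, hx.2.trans ht.2⟩
      exact sum_ftc Finset.univ (y := fun c τ => N2 (f τ c)) ht.1 fun c _ =>
        en0 (hs.td c) h0 ht.1 (ht.2.trans_lt ht1.2) ((hb3.dw [] (by simp) c).mono hsub)
          ((hs.rhsLB hm h0 ht1.2 c).mono hsub)
    refine gron (a := fun _ => 0) (h := fun _ => 0) (B := B) ht1.1.le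
      (g := fun τ => ∑ c, 2 * I (f τ c * rhs ν η ε (f τ) (q τ) c)) ?_ ?_ ?_ ?_ ?_ ?_ ?_ ?_ ?_ ?_ ?_ ?_ ?_
    · intro t ht; rw [Yk0, Yk0]; exact (hf t ht).2
    · exact (hf t1 (right_mem_Icc.2 ht1.1.le)).1
    · exact (hs.intIoc (by omega) h0 ht1.2).const_mul _
    · intro t; have := Yk_nonneg 1 (f t); positivity
    · exact aemeasurable_const
    · simp
    · simp
    · simp
    · intro t ht; exact hB t ⟨h0.trans_le ht.1, ht.2⟩
    · intro t; exact Yk_nonneg _ _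
    · simp
    · simp
    · intro t ht
      have hl := level0 ν η ε (f t) (q t) (hs.inc t ⟨h0.trans ht.1, ht.2.trans_lt ht1.2⟩)
      rw [← Finset.mul_sum, hl, Yk1]
      have : min ν η * ∑ c, G2 (f t c) ≤ ∑ c, vc ν η c * G2 (f t c) := by
        rw [Finset.mul_sum]
        refine Finset.sum_le_sum fun c _ => mul_le_mul_of_nonneg_right ?_ (G2_nonneg _)
        fin_cases c <;> simp [vc]
      linarith
  exact hs.finish h0 h1 (by positivity : 0 < 2 * min ν η) (fun j hj => absurd hj (by omega))
    (fun t ht => (key t ht).1 t (right_mem_Icc.2 ht.1.le)) (fun t ht => (key t ht).2)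

end HMHD
end


open MeasureTheory
open scoped ENNReal
noncomputable section
namespace HMHD
open Set Filter Topology

variable {ν η ε T : ℝ} {m : ℕ} {f : ℝ → Fin 6 → Sch} {q : ℝ → Sch}

lemma lint_Ioc {t0 t1 T : ℝ} {F : ℝ → ℝ≥0∞} (h : t1 < T) : ∫⁻ t in Ioc t0 t1, F t ≤ ∫⁻ t in Ioo t0 T, F t :=
  lintegral_mono_set fun _ hx => ⟨hx.1, hx.2.trans_lt h⟩

lemma Sol.pbone (hs : Sol ν η ε T m f q) {k : ℕ} {t0 : ℝ} (h0 : 0 ≤ t0) (hP : PB T f k t0) :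
    IntegrableOn (fun t => 1 + Lam k (f t)) (Ioo t0 T) := by
  have h1 : IntegrableOn (fun _ : ℝ => (1 : ℝ)) (Ioo t0 T) := integrableOn_const (by simp)
  have h2 := hs.pblam h0 hP
  exact Integrable.add h1 h2

lemma Sol.step1 (hs : Sol ν η ε T m f q) (hm : 3 ≤ m) (hν : 0 < ν) (hη : 0 < η) {p : ℝ≥0∞} {r : ℝ}
    (hp : 2 < p) (hr : 2 ≤ r) (hpr : 2 / p + 2 / ENNReal.ofReal r ≤ 1)
    (hcrit : ∫⁻ t in Ioo 0 T, ENNReal.ofReal ((eLpNorm (Jc (f t) : E2 → ℝ) p volume).toReal ^ r) < ⊤)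
    {t0 : ℝ} (h0 : 0 < t0) (h1 : t0 < T) (hP : PB T f 1 t0) :
    ∃ t1 ∈ Ico t0 T, PB T f 2 t1 := by
  have hμ : 0 < min ν η := lt_min hν hη
  obtain ⟨C, hC, hlev⟩ := level1 ν η ε hν hη p r hp hr hpr
  set a : ℝ → ℝ := fun t => 2 * C * (1 + Lam 1 (f t) + (eLpNorm (Jc (f t) : E2 → ℝ) p volume).toReal ^ r) with ha
  have ha0 : ∀ t, 0 ≤ a t := fun t => by have := Lam_nonneg 1 (f t); positivity
  have hfin : ∫⁻ t in Ioo t0 T, ENNReal.ofReal (a t) < ⊤ := by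
    have hI : IntegrableOn (fun t => 2 * C * (1 + Lam 1 (f t))) (Ioo t0 T) :=
      (hs.pbone h0.le hP).const_mul _
    have hle : ∀ t, ENNReal.ofReal (a t) = ENNReal.ofReal (2 * C * (1 + Lam 1 (f t))) +
        ENNReal.ofReal (2 * C) * ENNReal.ofReal ((eLpNorm (Jc (f t) : E2 → ℝ) p volume).toReal ^ r) := by
      intro t
      have := Lam_nonneg 1 (f t)
      rw [← ENNReal.ofReal_mul (by positivity), ← ENNReal.ofReal_add (by positivity) (by positivity), ha]
      congr 1; ring
    simp only [hle]
    rw [lintegral_add_left' hI.aestronglyMeasurable.aemeasurable.ennreal_ofReal,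
      lintegral_const_mul' _ _ ENNReal.ofReal_ne_top]
    refine ENNReal.add_lt_top.2 ⟨hI.lintegral_lt_top, ENNReal.mul_lt_top ENNReal.ofReal_lt_top ?_⟩
    exact (lintegral_mono_set (Ioo_subset_Ioo_left h0.le)).trans_lt hcrit
  obtain ⟨s, hs1, hs2⟩ := tail h1 hfin
  have hs0 : 0 < s := h0.trans_le hs1.1
  refine ⟨s, hs1, ?_⟩
  have key : ∀ t1 ∈ Ioo s T, (∀ t ∈ Icc s t1, Yk 1 (f t) ≤ 2 * (Yk 1 (f s) + 0)) ∧
      ∫⁻ t in Ioc s t1, ENNReal.ofReal (min ν η * Yk 2 (f t)) ≤ ENNReal.ofReal (2 * (Yk 1 (f s) + 0)) := by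
    intro t1 ht1
    obtain ⟨B, hB⟩ := hs.loc 1 (by omega) t1 ht1.2
    have hb3 := hs.b3 hm hs0 ht1.2
    have hf : ∀ t ∈ Icc s t1,
        IntegrableOn (fun τ => ∑ c, ∑ i : Fin 2, -2 * I (D i (D i (f τ c)) * rhs ν η ε (f τ) (q τ) c)) (Ioc s t) ∧
        ∑ c, ∑ i : Fin 2, N2 (D i (f t c)) = ∑ c, ∑ i : Fin 2, N2 (D i (f s c)) +
          ∫ τ in s..t, ∑ c, ∑ i : Fin 2, -2 * I (D i (D i (f τ c)) * rhs ν η ε (f τ) (q τ) c) := by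
      intro t ht
      have hsub : Ioc s t ⊆ Icc s t1 := fun x hx => ⟨hx.1.le, hx.2.trans ht.2⟩
      exact sum_ftc Finset.univ (y := fun c τ => ∑ i : Fin 2, N2 (D i (f τ c))) ht.1 fun c _ =>
        sum_ftc Finset.univ (y := fun (i : Fin 2) τ => N2 (D i (f τ c))) ht.1 fun i _ =>
          en1 (hs.td c) i hs0 ht.1 (ht.2.trans_lt ht1.2) ((hb3.dw [i] (by simp) c).mono hsub)
            ((hb3.dw [i, i] (by simp) c).mono hsub) ((hs.rhsLB hm hs0 ht1.2 c).mono hsub)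
    have hY : ∀ t, Yk 1 (f t) = ∑ c, ∑ i : Fin 2, N2 (D i (f t c)) := fun t => by
      rw [Yk1]; simp [G2, Fin.sum_univ_two]
    refine gron (a := a) (h := fun _ => 0) (B := B) ht1.1.le
      (g := fun τ => ∑ c, ∑ i : Fin 2, -2 * I (D i (D i (f τ c)) * rhs ν η ε (f τ) (q τ) c)) ?_ ?_ ?_ ?_ ?_ ?_ ?_ ?_ ?_ ?_ ?_ ?_ ?_
    · intro t ht; rw [hY, hY]; exact (hf t ht).2
    · exact (hf t1 (right_mem_Icc.2 ht1.1.le)).1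
    · exact (hs.intIoc (by omega) hs0 ht1.2).const_mul _
    · intro t; have := Yk_nonneg 2 (f t); positivity
    · exact aemeasurable_const
    · simp
    · simp
    · simp
    · intro t ht; exact hB t ⟨hs0.trans_le ht.1, ht.2⟩
    · intro t; exact Yk_nonneg _ _
    · exact ha0
    · exact (lint_Ioc ht1.2).trans hs2
    · intro t ht
      have hl := hlev (f t) (q t) (hs.inc t ⟨hs0.trans ht.1, ht.2.trans_lt ht1.2⟩)
      have e : ∑ c, ∑ i : Fin 2, -2 * I (D i (D i (f t c)) * rhs ν η ε (f t) (q t) c) =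
          -2 * ∑ c, I (Lp (f t c) * rhs ν η ε (f t) (q t) c) := by
        rw [Finset.mul_sum]
        refine Finset.sum_congr rfl fun c _ => ?_
        rw [Fin.sum_univ_two, Lp, add_mul, map_add]; ring
      beta_reduce
      rw [e, ha]
      unfold Z1 at hl
      linarith
  exact hs.finish hs0 hs1.2 hμ (hP.mono hs1.1).1
    (fun t ht => (key t ht).1 t (right_mem_Icc.2 ht.1.le)) (fun t ht => (key t ht).2)

lemma Sol.supb (hs : Sol ν η ε T m f q) (hm : 3 ≤ m) {s t : ℝ} (h0 : 0 < s) (ht : t < T) :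
    ∃ K : ℝ, 0 ≤ K ∧ ∀ τ ∈ Icc s t, ∀ c x, |(f τ c) x| ≤ K := by
  obtain ⟨C, hC⟩ := hs.b3 hm h0 ht
  refine ⟨|C| * 4 + 1, by positivity, fun τ hτ c x => ?_⟩
  have h := agmon (f τ c) x
  have h1 := (le_Yk (w := []) rfl (f τ) c).trans (hC _ (by simp) τ hτ)
  have h2 := (le_Yk (w := [1, 0]) rfl (f τ) c).trans (hC _ (by simp) τ hτ)
  have h3 := (le_Yk (w := [0]) rfl (f τ) c).trans (hC _ (by simp) τ hτ)
  have h4 := (le_Yk (w := [1]) rfl (f τ) c).trans (hC _ (by simp) τ hτ)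
  simp only [dw_nil, dw_cons] at h1 h2 h3 h4
  have h5 := le_abs_self C
  refine abs_le_of_sq_le_sq (by nlinarith [abs_nonneg C]) (by positivity)

end HMHD
end


open MeasureTheory
open scoped ENNReal
noncomputable section
namespace HMHD
open Set Filter Topology

variable {ν η ε T : ℝ} {m : ℕ} {f : ℝ → Fin 6 → Sch} {q : ℝ → Sch}

lemma Sol.contyk (hs : Sol ν η ε T m f q) (k : ℕ) (φ : Sch) (hφ : HasCompactSupport (φ : E2 → ℝ)) (κ : ℝ) :
    ContinuousOn (fun t => yk k ⟨f t, q t, φ, κ⟩) (Ioo 0 T) := by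
  unfold yk
  refine continuousOn_finsetSum _ fun c _ => continuousOn_finsetSum _ fun w _ => ?_
  simp only [N2_cut]
  exact ((hs.dwsm w c).mul (hs.dwsm w c)).contI (φ * φ) hφ.mul_left

lemma Sol.ftck (hs : Sol ν η ε T m f q) (k : ℕ) (φ : Sch) (hφ : HasCompactSupport (φ : E2 → ℝ)) (κ : ℝ)
    {s t : ℝ} (h0 : 0 < s) (hst : s ≤ t) (ht : t < T) :
    IntegrableOn (fun τ => ∑ c, ∑ w ∈ words k,
      2 * I ((φ * φ) * (dw w (f τ c) * dw w (rhs ν η ε (f τ) (q τ) c)))) (Ioc s t) ∧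
    yk k ⟨f t, q t, φ, κ⟩ = yk k ⟨f s, q s, φ, κ⟩ + ∫ τ in s..t, ∑ c, ∑ w ∈ words k,
      2 * I ((φ * φ) * (dw w (f τ c) * dw w (rhs ν η ε (f τ) (q τ) c))) := by
  refine sum_ftc Finset.univ (y := fun c τ => ∑ w ∈ words k, N2 (φ * dw w (f τ c))) hst fun c _ =>
    sum_ftc _ (y := fun w τ => N2 (φ * dw w (f τ c))) hst fun w _ => ?_
  have htd := ((hs.td c).dw w).mul ((hs.td c).dw w)
  have hc : HasCompactSupport ((φ * φ : Sch) : E2 → ℝ) := hφ.mul_left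
  have e : ∀ τ, I ((φ * φ) * (dw w (rhs ν η ε (f τ) (q τ) c) * dw w (f τ c) + dw w (f τ c) * dw w (rhs ν η ε (f τ) (q τ) c)))
      = 2 * I ((φ * φ) * (dw w (f τ c) * dw w (rhs ν η ε (f τ) (q τ) c))) := by
    intro τ
    rw [mul_comm (dw w (rhs ν η ε (f τ) (q τ) c)), mul_add, map_add]; ring
  have h1 := htd.ftc (φ * φ) hc h0 hst ht
  have h2 := htd.sm'.contI (φ * φ) hc
  simp only [e] at h1 h2
  simp only [N2_cut]
  refine ⟨?_, h1⟩
  have h3 : ContinuousOn _ (Icc s t) := h2.mono fun x hx => ⟨h0.trans_le hx.1, hx.2.trans_lt ht⟩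
  exact h3.integrableOn_Icc.mono_set Ioc_subset_Icc_self

lemma Sol.stepk (hs : Sol ν η ε T m f q) (hm : 3 ≤ m) (hν : 0 < ν) (hη : 0 < η) {k : ℕ} (hk : 2 ≤ k) (hkm : k ≤ m)
    {t0 : ℝ} (h0 : 0 < t0) (h1 : t0 < T) (hP : PB T f k t0) :
    ∃ t1 ∈ Ico t0 T, PB T f (k + 1) t1 := by
  have hμ : 0 < min ν η := lt_min hν hη
  obtain ⟨C, hC, hlev⟩ := level_k ν η ε hν hη hk
  obtain ⟨φ, κ, hcut⟩ := exists_cut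
  set a : ℝ → ℝ := fun t => 2 * C * (1 + Lam k (f t)) with ha
  set h : ℝ → ℝ := fun t => 2 * C * (Lam k (f t) + Yk k (f t)) with hh
  have ha0 : ∀ t, 0 ≤ a t := fun t => by have := Lam_nonneg k (f t); positivity
  have hh0 : ∀ t, 0 ≤ h t := fun t => by have := Lam_nonneg k (f t); have := Yk_nonneg k (f t); positivity
  have haI : IntegrableOn a (Ioo t0 T) :=
    (hs.pbone h0.le hP).const_mul _
  have hhI : IntegrableOn h (Ioo t0 T) := by
    have h2 : IntegrableOn (fun t => Lam k (f t) + Yk k (f t)) (Ioo t0 T) := Integrable.add (hs.pblam h0.le hP) hP.2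
    exact h2.const_mul _
  obtain ⟨s, hs1, hs2⟩ := tail h1 haI.lintegral_lt_top
  have hs0 : 0 < s := h0.trans_le hs1.1
  have hhI' : IntegrableOn h (Ioo s T) := hhI.mono_set (Ioo_subset_Ioo_left hs1.1)
  set H := ∫ t in Ioo s T, h t with hH
  have hH0 : 0 ≤ H := setIntegral_nonneg measurableSet_Ioo fun t _ => hh0 t
  have hHl : ∫⁻ t in Ioo s T, ENNReal.ofReal (h t) = ENNReal.ofReal H :=
    (ofReal_integral_eq_lintegral_ofReal hhI' (Eventually.of_forall hh0)).symm
  refine ⟨s, hs1, ?_⟩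
  set K := 2 * (Yk k (f s) + H) with hK
  have key : ∀ t1 ∈ Ioo s T, ∀ᶠ n in atTop, yk k ⟨f t1, q t1, φ n, κ n⟩ ≤ K ∧
      ∫⁻ t in Ioc s t1, ENNReal.ofReal (min ν η * yk (k + 1) ⟨f t, q t, φ n, κ n⟩) ≤ ENNReal.ofReal K := by
    intro t1 ht1
    obtain ⟨B, hB⟩ := hs.loc k hkm t1 ht1.2
    obtain ⟨M, hM0, hM⟩ := hs.supb hm hs0 ht1.2
    have e1 : ∀ᶠ n in atTop, κ n ≤ 1 := hcut.κlim.eventually (ge_mem_nhds one_pos)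
    have e2 : ∀ᶠ n in atTop, κ n * M ≤ 1 := by
      have : Tendsto (fun n => κ n * M) atTop (𝓝 0) := by simpa using hcut.κlim.mul_const M
      exact this.eventually (ge_mem_nhds one_pos)
    filter_upwards [e1, e2] with n hn1 hn2
    have adm : ∀ t ∈ Icc s t1, Adm ⟨f t, q t, φ n, κ n⟩ := by
      intro t ht
      have htT : t ∈ Ioo 0 T := ⟨hs0.trans_le ht.1, ht.2.trans_lt ht1.2⟩
      exact ⟨hcut.le1 n, hcut.κ0 n, hn1, hcut.hD n, fun c x =>
        (mul_le_mul_of_nonneg_left (hM t ht c x) (hcut.κ0 n)).trans hn2, (hs.inc t htT).du, (hs.inc t htT).db, hs.pois t htT⟩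
    have hsub : Icc s t1 ⊆ Ioo 0 T := fun x hx => ⟨hs0.trans_le hx.1, hx.2.trans_lt ht1.2⟩
    have hIoc : Ioc s t1 ⊆ Ioo s T := fun x hx => ⟨hx.1, hx.2.trans_lt ht1.2⟩
    have hg := gron (a := a) (h := h) (H := H) (B := B) ht1.1.le (y := fun t => yk k ⟨f t, q t, φ n, κ n⟩)
      (Dd := fun t => min ν η * yk (k + 1) ⟨f t, q t, φ n, κ n⟩)
      (fun t ht => (hs.ftck k (φ n) (hcut.cs n) (κ n) hs0 ht.1 (ht.2.trans_lt ht1.2)).2)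
      (hs.ftck k (φ n) (hcut.cs n) (κ n) hs0 ht1.1.le ht1.2).1
      ((((hs.contyk (k + 1) (φ n) (hcut.cs n) (κ n)).mono hsub).integrableOn_Icc.mono_set Ioc_subset_Icc_self).const_mul _)
      (fun t => mul_nonneg hμ.le (yk_nonneg _ _))
      (hhI'.mono_set hIoc).aestronglyMeasurable.aemeasurable hh0 hH0
      ((lint_Ioc ht1.2).trans hHl.le)
      (fun t ht => (yk_le_Yk k (adm t ht)).trans (hB t ⟨hs0.trans_le ht.1, ht.2⟩))
      (fun t => yk_nonneg _ _) ha0 ((lint_Ioc ht1.2).trans hs2)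
      (fun t ht => by
        have hl := hlev _ (adm t (Ioc_subset_Icc_self ht))
        simp only [Xk] at hl
        simp only [← Finset.mul_sum]
        rw [ha, hh]
        linarith)
    have hy := yk_le_Yk k (adm s (left_mem_Icc.2 ht1.1.le))
    have hKle : 2 * (yk k ⟨f s, q s, φ n, κ n⟩ + H) ≤ K := by rw [hK]; linarith
    exact ⟨(hg.1 t1 (right_mem_Icc.2 ht1.1.le)).trans hKle, hg.2.trans (ENNReal.ofReal_le_ofReal hKle)⟩
  have hlim : ∀ j t, Tendsto (fun n => yk j ⟨f t, q t, φ n, κ n⟩) atTop (𝓝 (Yk j (f t))) := fun j t =>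
    tendsto_finsetSum _ fun c _ => tendsto_finsetSum _ fun w _ => hcut.limN _
  refine hs.finish hs0 hs1.2 hμ (K := K) (hP.mono hs1.1).1 (fun t ht => ?_) (fun t ht => ?_)
  · exact le_of_tendsto (hlim k t) ((key t ht).mono fun n hn => hn.1)
  · have hsub : Ioc s t ⊆ Ioo 0 T := fun x hx => ⟨hs0.trans hx.1, hx.2.trans_lt ht.2⟩
    calc ∫⁻ τ in Ioc s t, ENNReal.ofReal (min ν η * Yk (k + 1) (f τ))
        = ∫⁻ τ in Ioc s t, liminf (fun n => ENNReal.ofReal (min ν η * yk (k + 1) ⟨f τ, q τ, φ n, κ n⟩)) atTop := by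
          refine lintegral_congr fun τ => ?_
          exact (ENNReal.tendsto_ofReal ((hlim (k + 1) τ).const_mul (min ν η))).liminf_eq.symm
      _ ≤ liminf (fun n => ∫⁻ τ in Ioc s t, ENNReal.ofReal (min ν η * yk (k + 1) ⟨f τ, q τ, φ n, κ n⟩)) atTop := by
          refine lintegral_liminf_le' fun n => ?_
          exact ((((hs.contyk (k + 1) (φ n) (hcut.cs n) (κ n)).mono hsub).aestronglyMeasurable
            measurableSet_Ioc).aemeasurable.const_mul _).ennreal_ofReal
      _ ≤ ENNReal.ofReal K := liminf_le_of_frequently_le' ((key t ht).mono fun n hn => hn.2).frequently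

theorem Sol.main (hs : Sol ν η ε T m f q) (hm : 3 ≤ m) (hν : 0 < ν) (hη : 0 < η) (hT : 0 < T) {p : ℝ≥0∞} {r : ℝ}
    (hp : 2 < p) (hr : 2 ≤ r) (hpr : 2 / p + 2 / ENNReal.ofReal r ≤ 1)
    (hcrit : ∫⁻ t in Ioo 0 T, ENNReal.ofReal ((eLpNorm (Jc (f t) : E2 → ℝ) p volume).toReal ^ r) < ⊤) :
    ∃ t0 ∈ Ioo 0 T, ∀ k ≤ m, ∃ C : ℝ, ∀ t ∈ Ico t0 T, Yk k (f t) ≤ C := by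
  have h1 : PB T f 1 (T / 2) := hs.step0 hm hν hη (by positivity) (by linarith)
  obtain ⟨t2, ht2, h2⟩ := hs.step1 hm hν hη hp hr hpr hcrit (by positivity) (by linarith) h1
  have key : ∀ k, 2 ≤ k → k ≤ m + 1 → ∃ t0 ∈ Ioo 0 T, PB T f k t0 := by
    intro k hk
    induction k, hk using Nat.le_induction with
    | base => exact fun _ => ⟨t2, ⟨by linarith [ht2.1], ht2.2⟩, h2⟩
    | succ k hk ih =>
      intro hkm
      obtain ⟨t0, ht0, h⟩ := ih (by omega)
      obtain ⟨t1, ht1, h'⟩ := hs.stepk hm hν hη hk (by omega) ht0.1 ht0.2 h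
      exact ⟨t1, ⟨ht0.1.trans_le ht1.1, ht1.2⟩, h'⟩
  obtain ⟨t0, ht0, h⟩ := key (m + 1) (by omega) le_rfl
  exact ⟨t0, ht0, fun k hk => h.1 k (by omega)⟩

end HMHD
end


open MeasureTheory
open scoped ENNReal
noncomputable section
namespace HMHD
open Set Filter Topology

/-- coordinate vectors -/
def ev {k : ℕ} (s : Fin k → Fin 2) : Fin k → E2 := fun i => Pi.single (s i) 1

lemma iter_comp {U : E2 → (Fin 3 → ℝ)} (hU : IsSchwartz U) (c : Fin 3) (k : ℕ) (x : E2) (v : Fin k → E2) :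
    iteratedFDeriv ℝ k (fun y => U y c) x v = iteratedFDeriv ℝ k U x v c := by
  have h := (ContinuousLinearMap.proj (R := ℝ) (φ := fun _ : Fin 3 => ℝ) c).iteratedFDeriv_comp_left
    (hU.1.contDiffAt (x := x)) (i := k) (by exact_mod_cast le_top)
  have h2 := congrArg (fun M => M v) h
  exact h2

lemma comp_isS {U : E2 → (Fin 3 → ℝ)} (hU : IsSchwartz U) (c : Fin 3) : IsSchwartz (fun x => U x c) := by
  refine ⟨contDiff_pi.1 hU.1 c, fun k n => ?_⟩
  obtain ⟨C, hC⟩ := hU.2 k n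
  refine ⟨C, fun x => le_trans ?_ (hC x)⟩
  gcongr
  refine ContinuousMultilinearMap.opNorm_le_bound (norm_nonneg _) fun v => ?_
  rw [iter_comp hU]
  exact (norm_le_pi_norm _ c).trans (ContinuousMultilinearMap.le_opNorm _ _)

lemma dw_iter {k : ℕ} (s : Fin k → Fin 2) (g : Sch) (x : E2) :
    (dw (List.ofFn s) g) x = iteratedFDeriv ℝ k (g : E2 → ℝ) x (ev s) := by
  induction k generalizing x with
  | zero => simp
  | succ k ih =>
    rw [List.ofFn_succ, dw_cons, D_app, iteratedFDeriv_succ_apply_left]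
    have e : ((dw (List.ofFn fun i => s i.succ) g : Sch) : E2 → ℝ) =
        fun y => iteratedFDeriv ℝ k (g : E2 → ℝ) y (ev fun i => s i.succ) := funext fun y => ih _ y
    rw [e]
    have hd : DifferentiableAt ℝ (iteratedFDeriv ℝ k (g : E2 → ℝ)) x :=
      (g.contDiff.differentiable_iteratedFDeriv (m := k) (by exact_mod_cast WithTop.coe_lt_top _)) x
    have := (ContinuousMultilinearMap.apply ℝ (fun _ : Fin k => E2) ℝ (ev fun i => s i.succ)).hasFDerivAt.comp x hd.hasFDerivAt
    have h2 := this.fderiv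
    change fderiv ℝ ((ContinuousMultilinearMap.apply ℝ (fun _ : Fin k => E2) ℝ (ev fun i => s i.succ)) ∘ (iteratedFDeriv ℝ k (g : E2 → ℝ))) x _ = _
    rw [h2]; rfl

lemma multi_bound {k : ℕ} (M : ContinuousMultilinearMap ℝ (fun _ : Fin k => E2) (Fin 3 → ℝ)) :
    ‖M‖ ≤ ∑ s : Fin k → Fin 2, ∑ c, |M (ev s) c| := by
  refine ContinuousMultilinearMap.opNorm_le_bound (by positivity) fun v => ?_
  have hv : v = fun i => ∑ j : Fin 2, v i j • (Pi.single j 1 : E2) := by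
    funext i
    rw [← pi_eq_sum_univ' (v i)]
  have h1 : M v = ∑ s : Fin k → Fin 2, M (fun i => v i (s i) • (Pi.single (s i) 1 : E2)) := by
    conv_lhs => rw [hv]
    exact M.toMultilinearMap.map_sum (fun i j => v i j • (Pi.single j 1 : E2))
  rw [h1, Finset.sum_mul]
  refine (norm_sum_le _ _).trans (Finset.sum_le_sum fun s _ => ?_)
  rw [M.map_smul_univ (fun i => v i (s i)) (fun i => (Pi.single (s i) 1 : E2)), norm_smul, mul_comm]
  refine mul_le_mul ?_ ?_ (norm_nonneg _) (by positivity)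
  · refine (pi_norm_le_iff_of_nonneg (by positivity)).2 fun c => ?_
    exact Finset.single_le_sum (f := fun c => |M (ev s) c|) (fun _ _ => abs_nonneg _) (Finset.mem_univ c)
  · rw [norm_prod]
    exact Finset.prod_le_prod (fun _ _ => norm_nonneg _) fun i _ => norm_le_pi_norm (v i) (s i)

/-- `g` collects the components of `U` -/
structure Cmp (U : E2 → (Fin 3 → ℝ)) (g : Fin 3 → Sch) : Prop where
  sch : IsSchwartz U
  eq : ∀ c, (g c : E2 → ℝ) = fun x => U x c

lemma Cmp.it {U : E2 → (Fin 3 → ℝ)} {g : Fin 3 → Sch} (h : Cmp U g) {k : ℕ} (s : Fin k → Fin 2) (c : Fin 3) (x : E2) :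
    (dw (List.ofFn s) (g c)) x = iteratedFDeriv ℝ k U x (ev s) c := by
  rw [dw_iter, h.eq, iter_comp h.sch]

lemma Cmp.ptw {U : E2 → (Fin 3 → ℝ)} {g : Fin 3 → Sch} (h : Cmp U g) (k : ℕ) (x : E2) :
    ‖iteratedFDeriv ℝ k U x‖ ^ 2 ≤ (2 ^ k * 3) *
      ∑ s : Fin k → Fin 2, ∑ c, (dw (List.ofFn s) (g c) * dw (List.ofFn s) (g c)) x := by
  have h1 := multi_bound (iteratedFDeriv ℝ k U x)
  simp only [← h.it] at h1
  rw [← Fintype.sum_prod_type' (fun s c => |(dw (List.ofFn s) (g c)) x|)] at h1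
  refine (pow_le_pow_left₀ (norm_nonneg _) h1 2).trans (sq_sum_le_card_mul_sum_sq.trans (le_of_eq ?_))
  rw [Fintype.sum_prod_type]
  simp [sq]

lemma sumint {ι : Type*} (S : Finset ι) (F : ι → Sch) : Integrable (fun x => ∑ i ∈ S, (F i) x) :=
  integrable_finsetSum _ fun i _ => (F i).integrable

lemma Cmp.rint {U : E2 → (Fin 3 → ℝ)} {g : Fin 3 → Sch} (_h : Cmp U g) (k : ℕ) :
    Integrable (fun x => ((2 : ℝ) ^ k * 3) *
      ∑ s : Fin k → Fin 2, ∑ c, (dw (List.ofFn s) (g c) * dw (List.ofFn s) (g c)) x) :=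
  (integrable_finsetSum _ fun _ _ => sumint _ _).const_mul _

lemma Cmp.int {U : E2 → (Fin 3 → ℝ)} {g : Fin 3 → Sch} (h : Cmp U g) (k : ℕ) :
    Integrable (fun x => ‖iteratedFDeriv ℝ k U x‖ ^ 2) := by
  refine (h.rint k).mono' ?_ (Eventually.of_forall fun x => ?_)
  · have : Continuous (iteratedFDeriv ℝ k U) := h.sch.1.continuous_iteratedFDeriv (by exact_mod_cast le_top)
    exact (this.norm.pow 2).aestronglyMeasurable
  · rw [Real.norm_of_nonneg (by positivity)]; exact h.ptw k x

lemma Cmp.lower {U : E2 → (Fin 3 → ℝ)} {g : Fin 3 → Sch} (h : Cmp U g) (k : ℕ) {Y : ℝ}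
    (hY : ∀ c w, w.length = k → N2 (dw w (g c)) ≤ Y) :
    ∫ x, ‖iteratedFDeriv ℝ k U x‖ ^ 2 ≤ (2 ^ k * 3) * (2 ^ k * (3 * Y)) := by
  refine (integral_mono (h.int k) (h.rint k) fun x => h.ptw k x).trans ?_
  rw [integral_const_mul, integral_finsetSum _ fun s _ => sumint _ _]
  gcongr
  have : ∀ s : Fin k → Fin 2, ∫ x, ∑ c, (dw (List.ofFn s) (g c) * dw (List.ofFn s) (g c)) x ≤ 3 * Y := by
    intro s
    rw [integral_finsetSum _ fun c _ => (dw (List.ofFn s) (g c) * dw (List.ofFn s) (g c)).integrable]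
    refine (Finset.sum_le_card_nsmul _ _ Y fun c _ => hY c (List.ofFn s) (by simp)).trans ?_
    simp
  refine (Finset.sum_le_card_nsmul _ _ (3 * Y) fun s _ => this s).trans ?_
  simp

lemma Cmp.upper {U : E2 → (Fin 3 → ℝ)} {g : Fin 3 → Sch} (h : Cmp U g) {m : ℕ} (w : List (Fin 2)) (hw : w.length ≤ m)
    (c : Fin 3) : N2 (dw w (g c)) ≤ hSobNorm m U ^ 2 := by
  have h0 : ∀ k, 0 ≤ ∫ x, ‖iteratedFDeriv ℝ k U x‖ ^ 2 := fun k => integral_nonneg fun x => by positivity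
  rw [hSobNorm, Real.sq_sqrt (Finset.sum_nonneg fun k _ => h0 k)]
  refine le_trans ?_ (Finset.single_le_sum (f := fun k => ∫ x, ‖iteratedFDeriv ℝ k U x‖ ^ 2) (fun k _ => h0 k)
    (Finset.mem_range.2 (Nat.lt_succ_of_le hw)))
  refine integral_mono (dw w (g c) * dw w (g c)).integrable (h.int _) fun x => ?_
  have e : w = List.ofFn w.get := by simp
  have : |(dw w (g c)) x| ≤ ‖iteratedFDeriv ℝ w.length U x‖ := by
    conv_lhs => rw [e]
    rw [h.it]
    refine (norm_le_pi_norm (iteratedFDeriv ℝ w.length U x (ev w.get)) c).trans ((ContinuousMultilinearMap.le_opNorm _ _).trans ?_)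
    refine mul_le_of_le_one_right (norm_nonneg _) (Finset.prod_le_one (fun _ _ => norm_nonneg _) fun i _ => ?_)
    simp [ev, Pi.norm_single]
  change (dw w (g c)) x * (dw w (g c)) x ≤ _
  rw [← abs_mul_abs_self, ← sq]
  gcongr

lemma Cmp.norm_le {U : E2 → (Fin 3 → ℝ)} {g : Fin 3 → Sch} (h : Cmp U g) (m : ℕ) {Y : ℕ → ℝ}
    (hY : ∀ k ≤ m, ∀ c w, w.length = k → N2 (dw w (g c)) ≤ Y k) :
    hSobNorm m U ≤ Real.sqrt (∑ k ∈ Finset.range (m + 1), (2 ^ k * 3) * (2 ^ k * (3 * Y k))) :=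
  Real.sqrt_le_sqrt (Finset.sum_le_sum fun k hk =>
    h.lower k (hY k (Nat.lt_succ_iff.1 (Finset.mem_range.1 hk))))

end HMHD
end


open MeasureTheory
open scoped ENNReal
noncomputable section
namespace HMHD
open Set Filter Topology

open Classical in
/-- bundle a function known to be Schwartz -/
def toS (g : E2 → ℝ) : Sch := if h : IsSchwartz g then ⟨g, h⟩ else 0

lemma toS_coe {g : E2 → ℝ} (h : IsSchwartz g) : (toS g : E2 → ℝ) = g := by
  have e : toS g = (⟨g, h⟩ : Sch) := dif_pos h
  rw [e]; rfl

/-- the state vector -/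
def stv (u b : ℝ → E2 → (Fin 3 → ℝ)) (t : ℝ) : Fin 6 → Sch :=
  ![toS (fun y => u t y 0), toS (fun y => u t y 1), toS (fun y => u t y 2),
    toS (fun y => b t y 0), toS (fun y => b t y 1), toS (fun y => b t y 2)]

lemma vec3 (g0 g1 g2 : Sch) (U : E2 → (Fin 3 → ℝ)) (h0 : (g0 : E2 → ℝ) = fun y => U y 0)
    (h1 : (g1 : E2 → ℝ) = fun y => U y 1) (h2 : (g2 : E2 → ℝ) = fun y => U y 2) :
    U = fun y => ![g0 y, g1 y, g2 y] := by
  funext y i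
  fin_cases i
  · simp [h0]
  · simp [h1]
  · simp [h2]

lemma hall (g3 g4 g5 : Sch) (x : E2) (f : Fin 6 → Sch) (e3 : f 3 = g3) (e4 : f 4 = g4) (e5 : f 5 = g5) :
    curl (fun y => crossProduct (curl (fun z => ![g3 z, g4 z, g5 z]) y) ![g3 y, g4 y, g5 y]) x
      = ![(D 1 (Qc f)) x, -(D 0 (Qc f)) x, (D 0 (f 3 * Jc f) + D 1 (f 4 * Jc f)) x] := by
  have hc : ∀ y, curl (fun z => ![g3 z, g4 z, g5 z]) y = ![(D 1 g5) y, -(D 0 g5) y, (D 0 g4) y - (D 1 g3) y] :=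
    fun y => rfl
  have k0 : (fun y => crossProduct (curl (fun z => ![g3 z, g4 z, g5 z]) y) ![g3 y, g4 y, g5 y] 0)
      = ((-(D 0 g5 * g5) - Jc f * f 4 : Sch) : E2 → ℝ) := by
    funext y
    rw [hc, cross_apply]
    simp [Jc, e3, e4]
  have k1 : (fun y => crossProduct (curl (fun z => ![g3 z, g4 z, g5 z]) y) ![g3 y, g4 y, g5 y] 1)
      = ((Jc f * f 3 - D 1 g5 * g5 : Sch) : E2 → ℝ) := by
    funext y
    rw [hc, cross_apply]
    simp [Jc, e3, e4]
  have k2 : (fun y => crossProduct (curl (fun z => ![g3 z, g4 z, g5 z]) y) ![g3 y, g4 y, g5 y] 2)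
      = ((Qc f : Sch) : E2 → ℝ) := by
    funext y
    rw [hc, cross_apply]
    simp [Qc, e3, e4, e5]; ring
  rw [curl, k0, k1, k2, ← D_coe, ← D_coe, ← D_coe, ← D_coe]
  have hz : D 0 (Jc f * f 3 - D 1 g5 * g5) - D 1 (-(D 0 g5 * g5) - Jc f * f 4)
      = D 0 (f 3 * Jc f) + D 1 (f 4 * Jc f) := by
    rw [map_sub, map_sub, map_neg, D_mul 0 (D 1 g5), D_mul 1 (D 0 g5), D_comm 1 0 g5, mul_comm (D 0 g5) (D 1 g5),
      mul_comm (Jc f) (f 3), mul_comm (Jc f) (f 4)]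
    abel
  rw [← hz]; rfl

lemma eq_u {ν η ε : ℝ} (F : Fin 6 → Sch) (P : Sch) (x : E2) (i : Fin 3) (c : Fin 6) (hic : ![0, 1, 2] i = c) :
    ν * lap (fun y => ![F 0 y, F 1 y, F 2 y] i) x
      + advect (fun y => ![F 3 y, F 4 y, F 5 y]) (fun y => ![F 3 y, F 4 y, F 5 y]) x i
      - advect (fun y => ![F 0 y, F 1 y, F 2 y]) (fun y => ![F 0 y, F 1 y, F 2 y]) x i
      - ![pd 0 P x, pd 1 P x, 0] i = (rhs ν η ε F P c) x := by
  have e : ∀ (j : Fin 2) (g : Sch), pd j (fun y => g y) = fun y => (D j g) y := fun _ _ => rfl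
  have a1 : (0 : Fin 6) + 3 = 3 := rfl
  have a2 : (1 : Fin 6) + 3 = 4 := rfl
  have a3 : (2 : Fin 6) + 3 = 5 := rfl
  subst hic
  fin_cases i <;> simp [rhs, tra, ext, vc, lap, advect, e, a1, a2, a3] <;> ring

lemma eq_b {ν η ε : ℝ} (F : Fin 6 → Sch) (P : Sch) (x : E2) (i : Fin 3) (c : Fin 6) (hic : ![3, 4, 5] i = c) :
    η * lap (fun y => ![F 3 y, F 4 y, F 5 y] i) x
      + advect (fun y => ![F 3 y, F 4 y, F 5 y]) (fun y => ![F 0 y, F 1 y, F 2 y]) x i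
      - ε * curl (fun y => crossProduct (curl (fun z => ![F 3 z, F 4 z, F 5 z]) y) ![F 3 y, F 4 y, F 5 y]) x i
      - advect (fun y => ![F 0 y, F 1 y, F 2 y]) (fun y => ![F 3 y, F 4 y, F 5 y]) x i = (rhs ν η ε F P c) x := by
  rw [hall (F 3) (F 4) (F 5) x F rfl rfl rfl]
  have e : ∀ (j : Fin 2) (g : Sch), pd j (fun y => g y) = fun y => (D j g) y := fun _ _ => rfl
  have a1 : (3 : Fin 6) + 3 = 0 := rfl
  have a2 : (4 : Fin 6) + 3 = 1 := rfl
  have a3 : (5 : Fin 6) + 3 = 2 := rfl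
  subst hic
  fin_cases i <;> simp [rhs, tra, ext, vc, lap, advect, e, a1, a2, a3] <;> ring

section
variable {ν η ε T : ℝ} {u b : ℝ → (Fin 2 → ℝ) → (Fin 3 → ℝ)} {π : ℝ → (Fin 2 → ℝ) → ℝ}

lemma stv_u (hs : IsHallMHDSolution ν η ε (Ico 0 T) u b π) {t : ℝ} (ht : t ∈ Ico 0 T) :
    Cmp (u t) ![stv u b t 0, stv u b t 1, stv u b t 2] := by
  refine ⟨hs.schwartz_u t ht, fun c => ?_⟩
  fin_cases c <;> exact toS_coe (comp_isS (hs.schwartz_u t ht) _)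

lemma stv_b (hs : IsHallMHDSolution ν η ε (Ico 0 T) u b π) {t : ℝ} (ht : t ∈ Ico 0 T) :
    Cmp (b t) ![stv u b t 3, stv u b t 4, stv u b t 5] := by
  refine ⟨hs.schwartz_b t ht, fun c => ?_⟩
  fin_cases c <;> exact toS_coe (comp_isS (hs.schwartz_b t ht) _)

lemma u_eq (hs : IsHallMHDSolution ν η ε (Ico 0 T) u b π) {t : ℝ} (ht : t ∈ Ico 0 T) :
    u t = fun y => ![stv u b t 0 y, stv u b t 1 y, stv u b t 2 y] :=
  vec3 _ _ _ _ ((stv_u hs ht).eq 0) ((stv_u hs ht).eq 1) ((stv_u hs ht).eq 2)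

lemma b_eq (hs : IsHallMHDSolution ν η ε (Ico 0 T) u b π) {t : ℝ} (ht : t ∈ Ico 0 T) :
    b t = fun y => ![stv u b t 3 y, stv u b t 4 y, stv u b t 5 y] :=
  vec3 _ _ _ _ ((stv_b hs ht).eq 0) ((stv_b hs ht).eq 1) ((stv_b hs ht).eq 2)

lemma mk_td {G G' : ℝ → Sch} {V : ℝ → E2 → (Fin 3 → ℝ)} {c : Fin 3}
    (hV : ContDiffOn ℝ (⊤ : ℕ∞) (fun p : ℝ × E2 => V p.1 p.2) (Ico 0 T ×ˢ univ))
    (hG : ∀ t ∈ Ico 0 T, (G t : E2 → ℝ) = fun y => V t y c)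
    (hd : ∀ t ∈ Ioo 0 T, ∀ x, deriv (fun s => V s x c) t = (G' t) x) : TD T G G' := by
  have hsm : Sm T G := by
    have h1 := (contDiffOn_pi.1 hV c).mono (prod_mono_left Ioo_subset_Ico_self (t := (univ : Set E2)))
    exact h1.congr fun p hp => congrFun (hG p.1 (Ioo_subset_Ico_self hp.1)) p.2
  refine ⟨hsm, fun t ht x => ?_⟩
  have h1 := hsm.time ht x
  have h2 : (fun s => V s x c) =ᶠ[𝓝 t] fun s => (G s) x :=
    eventually_of_mem (isOpen_Ioo.mem_nhds ht) fun s hs => (congrFun (hG s (Ioo_subset_Ico_self hs)) x).symm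
  have h3 := hd t ht x
  rw [h2.deriv_eq, h1.deriv] at h3
  rwa [h3] at h1

lemma sol_td (hs : IsHallMHDSolution ν η ε (Ico 0 T) u b π) (c : Fin 6) :
    TD T (fun t => stv u b t c) (fun t => rhs ν η ε (stv u b t) (toS (π t)) c) := by
  have hp : ∀ t ∈ Ico 0 T, π t = toS (π t) := fun t ht => (toS_coe (hs.schwartz_pi t ht)).symm
  have hm : ∀ t ∈ Ioo 0 T, ∀ x i, deriv (fun s => u s x i) t =
      ν * lap (fun y => u t y i) x + advect (b t) (b t) x i - advect (u t) (u t) x i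
        - ![pd 0 (π t) x, pd 1 (π t) x, 0] i := fun t ht x i => by
    linarith [hs.momentum t (Ioo_subset_Ico_self ht) x i]
  have hi : ∀ t ∈ Ioo 0 T, ∀ x i, deriv (fun s => b s x i) t =
      η * lap (fun y => b t y i) x + advect (b t) (u t) x i
        - ε * curl (fun y => crossProduct (curl (b t) y) (b t y)) x i - advect (u t) (b t) x i := fun t ht x i => by
    linarith [hs.induction t (Ioo_subset_Ico_self ht) x i]
  have ht' : ∀ t ∈ Ioo 0 T, t ∈ Ico 0 T := fun t ht => Ioo_subset_Ico_self ht
  have hmu : ∀ (i : Fin 3) (c : Fin 6), ![0, 1, 2] i = c → ∀ t ∈ Ioo 0 T, ∀ x, deriv (fun s => u s x i) t =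
      (rhs ν η ε (stv u b t) (toS (π t)) c) x := by
    intro i c hic t ht x
    have e0 : ∀ j, pd j (π t) x = pd j (toS (π t) : E2 → ℝ) x := fun j => by rw [← hp t (ht' t ht)]
    rw [hm t ht x i, u_eq hs (ht' t ht), b_eq hs (ht' t ht), e0, e0]
    exact eq_u _ _ x i c hic
  have hmb : ∀ (i : Fin 3) (c : Fin 6), ![3, 4, 5] i = c → ∀ t ∈ Ioo 0 T, ∀ x, deriv (fun s => b s x i) t =
      (rhs ν η ε (stv u b t) (toS (π t)) c) x := by
    intro i c hic t ht x
    rw [hi t ht x i, u_eq hs (ht' t ht), b_eq hs (ht' t ht)]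
    exact eq_b _ _ x i c hic
  fin_cases c
  · exact mk_td hs.smooth_u (fun t ht => (stv_u hs ht).eq 0) (hmu 0 0 rfl)
  · exact mk_td hs.smooth_u (fun t ht => (stv_u hs ht).eq 1) (hmu 1 1 rfl)
  · exact mk_td hs.smooth_u (fun t ht => (stv_u hs ht).eq 2) (hmu 2 2 rfl)
  · exact mk_td hs.smooth_b (fun t ht => (stv_b hs ht).eq 0) (hmb 0 3 rfl)
  · exact mk_td hs.smooth_b (fun t ht => (stv_b hs ht).eq 1) (hmb 1 4 rfl)
  · exact mk_td hs.smooth_b (fun t ht => (stv_b hs ht).eq 2) (hmb 2 5 rfl)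

end

end HMHD
end


open MeasureTheory
open scoped ENNReal
noncomputable section
namespace HMHD
open Set Filter Topology
variable {ν η ε T : ℝ} {u b : ℝ → (Fin 2 → ℝ) → (Fin 3 → ℝ)} {π : ℝ → (Fin 2 → ℝ) → ℝ}

lemma sol_inc (hs : IsHallMHDSolution ν η ε (Ico 0 T) u b π) {t : ℝ} (ht : t ∈ Ico 0 T) : Inc (stv u b t) := by
  constructor
  · apply Sch.ext'; intro x
    have := hs.div_u t ht x
    rw [← (stv_u hs ht).eq 0, ← (stv_u hs ht).eq 1] at this
    exact this
  · apply Sch.ext'; intro x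
    have := hs.div_b t ht x
    rw [← (stv_b hs ht).eq 0, ← (stv_b hs ht).eq 1] at this
    exact this

lemma pois_alg {F : Fin 6 → Sch} {P : Sch} (hi : Inc F) (h : D 0 (rhs ν η ε F P 0) + D 1 (rhs ν η ε F P 1) = 0) :
    D 0 (D 0 P) + D 1 (D 1 P) = -(D 0 (Nu F 0 3) + D 1 (Nu F 1 4)) := by
  have a1 : (0 : Fin 6) + 3 = 3 := rfl
  have a2 : (1 : Fin 6) + 3 = 4 := rfl
  have r0 : rhs ν η ε F P 0 = ν • (D 0 (D 0 (F 0)) + D 1 (D 1 (F 0))) - Nu F 0 3 - D 0 P := by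
    simp only [rhs, tra, ext, vc, Nu, a1, Matrix.cons_val_zero]; abel
  have r1 : rhs ν η ε F P 1 = ν • (D 0 (D 0 (F 1)) + D 1 (D 1 (F 1))) - Nu F 1 4 - D 1 P := by
    simp only [rhs, tra, ext, vc, Nu, a2, Matrix.cons_val_one, Matrix.cons_val_zero]; abel
  have d0 : D 0 (D 0 (D 0 (F 0) + D 1 (F 1))) + D 1 (D 1 (D 0 (F 0) + D 1 (F 1))) = 0 := by simp [hi.du]
  have d1 : D 0 (D 0 (D 0 (F 0)) + D 1 (D 1 (F 0))) + D 1 (D 0 (D 0 (F 1)) + D 1 (D 1 (F 1))) = 0 := by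
    rw [← d0]
    simp only [map_add]
    rw [D_comm 0 1 (D 1 (F 0)), D_comm 0 1 (F 0), D_comm 1 0 (D 0 (F 1)), D_comm 1 0 (F 1)]
    abel
  rw [r0, r1, map_sub, map_sub, map_sub, map_sub, map_smul, map_smul] at h
  have d2 := congrArg (fun z => ν • z) d1
  simp only [smul_add, smul_zero] at d2
  have : D 0 (D 0 P) + D 1 (D 1 P) + (D 0 (Nu F 0 3) + D 1 (Nu F 1 4)) =
    (ν • D 0 (D 0 (D 0 (F 0)) + D 1 (D 1 (F 0))) + ν • D 1 (D 0 (D 0 (F 1)) + D 1 (D 1 (F 1)))) := by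
    rw [← sub_eq_zero, ← neg_eq_zero, ← h]; abel
  rw [d2] at this
  exact eq_neg_of_add_eq_zero_left this

lemma sol_pois (hs : IsHallMHDSolution ν η ε (Ico 0 T) u b π) {t : ℝ} (ht : t ∈ Ioo 0 T) :
    D 0 (D 0 (toS (π t))) + D 1 (D 1 (toS (π t))) = -(D 0 (Nu (stv u b t) 0 3) + D 1 (Nu (stv u b t) 1 4)) := by
  refine pois_alg (ν := ν) (η := η) (ε := ε) (sol_inc hs (Ioo_subset_Ico_self ht)) (Sch.ext' fun x => ?_)
  have h := (((sol_td hs 0).D 0).hd t ht x).add (((sol_td hs 1).D 1).hd t ht x)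
  have h2 : (fun s => (D 0 (stv u b s 0)) x + (D 1 (stv u b s 1)) x) =ᶠ[𝓝 t] fun _ => (0 : ℝ) :=
    eventually_of_mem (isOpen_Ioo.mem_nhds ht) fun s hs' => by
      have := congrArg (fun g : Sch => g x) (sol_inc hs (Ioo_subset_Ico_self hs')).du
      exact this
  exact h.unique ((hasDerivAt_const t (0 : ℝ)).congr_of_eventuallyEq h2)

lemma yk_le_of {k : ℕ} {F : Fin 6 → Sch} {B : ℝ} (h : ∀ c, ∀ w ∈ words k, N2 (dw w (F c)) ≤ B) :
    Yk k F ≤ 6 * ((words k).card * B) := by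
  unfold Yk
  refine (Finset.sum_le_card_nsmul _ _ ((words k).card * B) fun c _ => ?_).trans (by simp)
  exact (Finset.sum_le_card_nsmul _ _ B (h c)).trans (by simp)

lemma hSob_nonneg (m : ℕ) (U : E2 → (Fin 3 → ℝ)) : 0 ≤ hSobNorm m U := Real.sqrt_nonneg _

lemma sol_loc (hs : IsHallMHDSolution ν η ε (Ico 0 T) u b π) {m : ℕ}
    (hloc : ∀ T' ∈ Ico (0 : ℝ) T, ∃ C : ℝ, ∀ t ∈ Icc (0 : ℝ) T', hSobNorm m (u t) + hSobNorm m (b t) ≤ C) :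
    ∀ k ≤ m, ∀ T' < T, ∃ C : ℝ, ∀ t ∈ Ioc 0 T', Yk k (stv u b t) ≤ C := by
  intro k hk T' hT'
  by_cases h0 : 0 ≤ T'
  · obtain ⟨C, hC⟩ := hloc T' ⟨h0, hT'⟩
    refine ⟨6 * ((words k).card * C ^ 2), fun t ht => yk_le_of fun c w hw => ?_⟩
    have ht' : t ∈ Ico 0 T := ⟨ht.1.le, ht.2.trans_lt hT'⟩
    have hw' : w.length ≤ m := (mem_words.1 hw).trans_le hk
    have hC' := hC t ⟨ht.1.le, ht.2⟩
    have n1 := hSob_nonneg m (u t)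
    have n2 := hSob_nonneg m (b t)
    have b1 : hSobNorm m (u t) ^ 2 ≤ C ^ 2 := pow_le_pow_left₀ n1 (by linarith) 2
    have b2 : hSobNorm m (b t) ^ 2 ≤ C ^ 2 := pow_le_pow_left₀ n2 (by linarith) 2
    have U := fun i => ((stv_u hs ht').upper w hw' i).trans b1
    have V := fun i => ((stv_b hs ht').upper w hw' i).trans b2
    fin_cases c
    · exact U 0
    · exact U 1
    · exact U 2
    · exact V 0
    · exact V 1
    · exact V 2
  · exact ⟨0, fun t ht => absurd (ht.1.le.trans ht.2) h0⟩

lemma sol_sol (hs : IsHallMHDSolution ν η ε (Ico 0 T) u b π) {m : ℕ}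
    (hloc : ∀ T' ∈ Ico (0 : ℝ) T, ∃ C : ℝ, ∀ t ∈ Icc (0 : ℝ) T', hSobNorm m (u t) + hSobNorm m (b t) ≤ C) :
    Sol ν η ε T m (stv u b) (fun t => toS (π t)) :=
  ⟨sol_td hs, fun _ ht => sol_inc hs (Ioo_subset_Ico_self ht), fun _ ht => sol_pois hs ht, sol_loc hs hloc⟩

lemma sol_crit (hs : IsHallMHDSolution ν η ε (Ico 0 T) u b π) {p : ℝ≥0∞} {r : ℝ} (hr : 2 ≤ r)
    (hcrit : ∫⁻ t in Ico (0 : ℝ) T,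
        (eLpNorm (fun x => pd 0 (fun y => b t y 1) x - pd 1 (fun y => b t y 0) x) p volume) ^ r < ⊤) :
    ∫⁻ t in Ioo 0 T, ENNReal.ofReal ((eLpNorm (Jc (stv u b t) : E2 → ℝ) p volume).toReal ^ r) < ⊤ := by
  refine lt_of_le_of_lt ?_ hcrit
  refine le_trans (setLIntegral_mono' measurableSet_Ioo fun t ht => ?_) (lintegral_mono_set Ioo_subset_Ico_self)
  have ht' := Ioo_subset_Ico_self ht
  have e : (fun x => pd 0 (fun y => b t y 1) x - pd 1 (fun y => b t y 0) x) = (Jc (stv u b t) : E2 → ℝ) := by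
    rw [← (stv_b hs ht').eq 0, ← (stv_b hs ht').eq 1]; rfl
  rw [e, ← ENNReal.ofReal_rpow_of_nonneg ENNReal.toReal_nonneg (by linarith),
    ENNReal.ofReal_toReal ((Jc (stv u b t)).memLp p).2.ne]

theorem final (m : ℕ) (hm : 2 < m) (hν : 0 < ν) (hη : 0 < η) (hT : 0 < T)
    (hsol : IsHallMHDSolution ν η ε (Set.Ico 0 T) u b π)
    (hloc : ∀ T' ∈ Set.Ico (0 : ℝ) T, ∃ C : ℝ, ∀ t ∈ Set.Icc (0 : ℝ) T',
      hSobNorm m (u t) + hSobNorm m (b t) ≤ C)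
    (p : ℝ≥0∞) (r : ℝ) (hp : 2 < p) (hr : 2 ≤ r)
    (hpr : 2 / p + 2 / ENNReal.ofReal r ≤ 1)
    (hcrit : ∫⁻ t in Set.Ico (0 : ℝ) T,
        (eLpNorm (fun x => pd 0 (fun y => b t y 1) x - pd 1 (fun y => b t y 0) x)
          p volume) ^ r < ⊤) :
    ∃ C : ℝ, ∀ t ∈ Set.Ico (0 : ℝ) T, hSobNorm m (u t) + hSobNorm m (b t) ≤ C := by
  obtain ⟨t0, ht0, H⟩ := (sol_sol hsol hloc).main hm hν hη hT hp hr hpr (sol_crit hsol hr hcrit)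
  choose! Y hY using H
  obtain ⟨C, hC⟩ := hloc t0 (Ioo_subset_Ico_self ht0)
  set K := Real.sqrt (∑ k ∈ Finset.range (m + 1), (2 ^ k * 3) * (2 ^ k * (3 * Y k))) with hK
  refine ⟨max C (K + K), fun t ht => ?_⟩
  rcases le_total t t0 with h | h
  · exact (hC t ⟨ht.1, h⟩).trans (le_max_left _ _)
  · refine le_trans (add_le_add ?_ ?_) (le_max_right _ _)
    · refine (stv_u hsol ht).norm_le m fun k hk c w hw => le_trans ?_ (hY k hk t ⟨h, ht.2⟩)
      fin_cases c
      · exact le_Yk hw (stv u b t) 0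
      · exact le_Yk hw (stv u b t) 1
      · exact le_Yk hw (stv u b t) 2
    · refine (stv_b hsol ht).norm_le m fun k hk c w hw => le_trans ?_ (hY k hk t ⟨h, ht.2⟩)
      fin_cases c
      · exact le_Yk hw (stv u b t) 3
      · exact le_Yk hw (stv u b t) 4
      · exact le_Yk hw (stv u b t) 5

end HMHD
end

/-- Theorem 2.2: regularity criterion for the 2½-dimensional Hall-MHD system in terms of
only the third component `j₃ = ∂₁b₂ − ∂₂b₁` of the current density: if
`∫₀ᵀ ‖j₃‖_{Lᵖ}^r dt < ∞` with `2/p + 2/r ≤ 1`, `p ∈ (2,∞]`, then the `Hᵐ` norms of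
`(u, b)` remain bounded up to time `T`. -/
theorem regularity_criterion_j3 (m : ℕ) (hm : 2 < m)
    (ν η ε T : ℝ) (hν : 0 < ν) (hη : 0 < η) (hε : 0 < ε) (hT : 0 < T)
    (u b : ℝ → (Fin 2 → ℝ) → (Fin 3 → ℝ)) (π : ℝ → (Fin 2 → ℝ) → ℝ)
    (hsol : IsHallMHDSolution ν η ε (Set.Ico 0 T) u b π)
    (hloc : ∀ T' ∈ Set.Ico (0 : ℝ) T, ∃ C : ℝ, ∀ t ∈ Set.Icc (0 : ℝ) T',
      hSobNorm m (u t) + hSobNorm m (b t) ≤ C)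
    (p : ℝ≥0∞) (r : ℝ) (hp : 2 < p) (hr : 2 ≤ r)
    (hpr : 2 / p + 2 / ENNReal.ofReal r ≤ 1)
    (hcrit : ∫⁻ t in Set.Ico (0 : ℝ) T,
        (eLpNorm (fun x => pd 0 (fun y => b t y 1) x - pd 1 (fun y => b t y 0) x)
          p volume) ^ r < ⊤) :
    ∃ C : ℝ, ∀ t ∈ Set.Ico (0 : ℝ) T,
      hSobNorm m (u t) + hSobNorm m (b t) ≤ C := by
  exact HMHD.final m hm hν hη hT hsol hloc p r hp hr hpr hcrit
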